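/- arXiv:1904.00989 — 2 statements merged into one kernel-verified Lean document; each statement's English description precedes it below -/
import Mathlib

section
/- Consistency of plug-in estimators (Theorem 1): under Assumptions Φ(i), Φ(ii) and M(i)–(v), if (γ̂_n, P̂_n) are random elements of Γ×ℝ^{d1+d2} with (γ̂_n, P̂_n) → (γ0, P0) in probability, then the plug-in estimators κ̲̂_n(N_δ) = inf_{θ∈Θ} K̲_δ(θ; γ̂_n, P̂_n) and κ̄̂_n(N_δ) = sup_{θ∈Θ} K̄_δ(θ; γ̂_n, P̂_n) satisfy (κ̲̂_n(N_δ), κ̄̂_n(N_δ)) → (κ̲(N_δ), κ̄(N_δ)) in probability. -/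
open MeasureTheory Filter Set
open scoped ENNReal Pointwise Classical

noncomputable section

namespace CFSens

/-- map an extended real to `ℝ≥0∞` (negatives go to `0`; only used on nonnegative values). -/
def erealToENNReal (x : EReal) : ℝ≥0∞ := if x = ⊤ then ⊤ else ENNReal.ofReal x.toReal

/-- Euclidean dot product. -/
def dot {ι : Type*} [Fintype ι] (a b : ι → ℝ) : ℝ := ∑ i, a i * b i

/-- Convex conjugate `φ*(x) = sup_{t ≥ 0} (t x - φ t)` (`EReal`-valued). -/
def phiStar (φ : ℝ → ℝ) (x : ℝ) : EReal :=
  ⨆ t ∈ Set.Ici (0:ℝ), ((t * x - φ t : ℝ) : EReal)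

/-- Convex conjugate `(ηφ)*(x) = sup_{t ≥ 0} (t x - η φ t)` of `ηφ`, for `η ≥ 0`. -/
def etaPhiStar (φ : ℝ → ℝ) (η x : ℝ) : EReal :=
  ⨆ t ∈ Set.Ici (0:ℝ), ((t * x - η * φ t : ℝ) : EReal)

/-- `ψ(x) = φ*(x) - x`. -/
def psi (φ : ℝ → ℝ) (x : ℝ) : EReal := phiStar φ x - (x : EReal)

/-- Assumption Φ(i).  Here `φ : ℝ → ℝ` records the (finite) values of the divergence cost
on `[0,∞)`; the paper's extension `φ(x) = +∞` for `x < 0` is encoded separately wherever it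
matters (nonnegativity of densities), and `φ(0) < ∞` is automatic since `φ` is real-valued. -/
structure PhiOne (φ : ℝ → ℝ) : Prop where
  smooth : ContDiffOn ℝ 2 φ (Set.Ioi (0:ℝ))
  sconvex : StrictConvexOn ℝ (Set.Ici (0:ℝ)) φ
  one : φ 1 = 0
  done : deriv φ 1 = 0
  superlinear : Tendsto (fun x => φ x / x) atTop atTop
  dzero : ∃ L : EReal, L < 0 ∧
    Tendsto (fun x => ((deriv φ x : ℝ) : EReal)) (nhdsWithin 0 (Set.Ioi 0)) (nhds L)
  dinfty : ∃ L : EReal, 0 < L ∧ Tendsto (fun x => ((deriv φ x : ℝ) : EReal)) atTop (nhds L)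
  delta2 : ∃ L : ℝ, Tendsto (fun x => x * deriv φ x / φ x) atTop (nhds L)

variable {U : Type*} [MeasurableSpace U] {dθ d1 d2 d3 d4 : ℕ} {Γ : Type*}

/-- Stacked moment values/multipliers `(v1,v2,v3,v4)`. -/
abbrev Vec4 (d1 d2 d3 d4 : ℕ) :=
  (Fin d1 → ℝ) × (Fin d2 → ℝ) × (Fin d3 → ℝ) × (Fin d4 → ℝ)

/-- The targeted moments `P = (P1,P2)`. -/
abbrev Vec12 (d1 d2 : ℕ) := (Fin d1 → ℝ) × (Fin d2 → ℝ)

/-- `λ'g` for stacked vectors. -/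
def dot4 (a b : Vec4 d1 d2 d3 d4) : ℝ :=
  dot a.1 b.1 + dot a.2.1 b.2.1 + dot a.2.2.1 b.2.2.1 + dot a.2.2.2 b.2.2.2

/-- dot product on `Vec12`. -/
def dot12 (a b : Vec12 d1 d2) : ℝ := dot a.1 b.1 + dot a.2 b.2

/-- `λ ∈ Λ`, i.e. the multipliers on the inequality constraints are nonnegative. -/
def inLambda (l : Vec4 d1 d2 d3 d4) : Prop := (∀ i, 0 ≤ l.1 i) ∧ (∀ i, 0 ≤ l.2.2.1 i)

/-- `λ12'P`. -/
def dotP (l : Vec4 d1 d2 d3 d4) (P : Vec12 d1 d2) : ℝ := dot l.1 P.1 + dot l.2.1 P.2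

/-- The φ-divergence `D_φ(F‖F*)` (`= +∞` unless `F ≪ F*`). -/
def Dphi (φ : ℝ → ℝ) (Fstar F : Measure U) : ℝ≥0∞ :=
  if F ≪ Fstar then ∫⁻ u, ENNReal.ofReal (φ (F.rnDeriv Fstar u).toReal) ∂Fstar else ⊤

/-- Membership in the Orlicz heart `ℰ`: `∫ ψ(c|f|) dF* < ∞` for all `c > 0`. -/
def MemE (φ : ℝ → ℝ) (Fstar : Measure U) (f : U → ℝ) : Prop :=
  Measurable f ∧ ∀ c : ℝ, 0 < c → ∫⁻ u, erealToENNReal (psi φ (c * |f u|)) ∂Fstar < ⊤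

/-- The Orlicz norm `‖f‖_ψ = inf_{c>0} c⁻¹ (1 + ∫ ψ(c|f|) dF*)`. -/
def psiNorm (φ : ℝ → ℝ) (Fstar : Measure U) (f : U → ℝ) : ℝ≥0∞ :=
  ⨅ c ∈ Set.Ioi (0:ℝ),
    (ENNReal.ofReal c)⁻¹ * (1 + ∫⁻ u, erealToENNReal (psi φ (c * |f u|)) ∂Fstar)

/-- `E^{F*}[f]` for an `EReal`-valued integrand bounded below by `-c`. -/
def eExp (Fstar : Measure U) (c : ℝ) (f : U → EReal) : EReal :=
  ((∫⁻ u, erealToENNReal (f u + (c : EReal)) ∂Fstar : ℝ≥0∞) : EReal) - (c : EReal)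

/-- Sequential lower hemicontinuity of a correspondence `A` (sequences taken in `S`). -/
def LowerHemicontinuousAt {α β : Type*} [TopologicalSpace α] [TopologicalSpace β]
    (A : α → Set β) (S : Set α) (x : α) : Prop :=
  ∀ xs : ℕ → α, (∀ n, xs n ∈ S) → Tendsto xs atTop (nhds x) →
    ∀ y ∈ A x, ∃ ys : ℕ → β, (∀ n, ys n ∈ A (xs n)) ∧ Tendsto ys atTop (nhds y)

section Model

variable (φ : ℝ → ℝ) (Fstar : Measure U)
variable (g : U → (Fin dθ → ℝ) → Γ → Vec4 d1 d2 d3 d4)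
variable (k : U → (Fin dθ → ℝ) → Γ → ℝ)

/-- All components of `g(·,θ,γ)` are integrable under `F`. -/
def GIntegrable (θ : Fin dθ → ℝ) (γ : Γ) (F : Measure U) : Prop :=
  (∀ i, Integrable (fun u => (g u θ γ).1 i) F) ∧
  (∀ i, Integrable (fun u => (g u θ γ).2.1 i) F) ∧
  (∀ i, Integrable (fun u => (g u θ γ).2.2.1 i) F) ∧
  (∀ i, Integrable (fun u => (g u θ γ).2.2.2 i) F)

/-- The model constraints (1)–(4): `E^F[g1] ≤ P1`, `E^F[g2] = P2`, `E^F[g3] ≤ 0`, `E^F[g4] = 0`. -/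
def ConstraintsHold (θ : Fin dθ → ℝ) (γ : Γ) (P : Vec12 d1 d2) (F : Measure U) : Prop :=
  GIntegrable g θ γ F ∧
  (∀ i, ∫ u, (g u θ γ).1 i ∂F ≤ P.1 i) ∧
  (∀ i, ∫ u, (g u θ γ).2.1 i ∂F = P.2 i) ∧
  (∀ i, ∫ u, (g u θ γ).2.2.1 i ∂F ≤ 0) ∧
  (∀ i, ∫ u, (g u θ γ).2.2.2 i ∂F = 0)

/-- `F ∈ N_δ` and the model constraints hold at `(θ,γ,P)` under `F`. -/
def Feasible (δ : ℝ) (θ : Fin dθ → ℝ) (γ : Γ) (P : Vec12 d1 d2) (F : Measure U) : Prop :=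
  IsProbabilityMeasure F ∧ Dphi φ Fstar F ≤ ENNReal.ofReal δ ∧ ConstraintsHold g θ γ P F

/-- `κ̲_δ(θ;γ,P)`: primal lower value (explicit-dependence case); `= ⊤` if infeasible. -/
def kappaLow (δ : ℝ) (θ : Fin dθ → ℝ) (γ : Γ) (P : Vec12 d1 d2) : EReal :=
  sInf {x : EReal | ∃ F : Measure U, Feasible φ Fstar g δ θ γ P F ∧
    Integrable (fun u => k u θ γ) F ∧ x = ((∫ u, k u θ γ ∂F : ℝ) : EReal)}

/-- `κ̄_δ(θ;γ,P)`: primal upper value (explicit-dependence case); `= ⊥` if infeasible. -/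
def kappaHigh (δ : ℝ) (θ : Fin dθ → ℝ) (γ : Γ) (P : Vec12 d1 d2) : EReal :=
  sSup {x : EReal | ∃ F : Measure U, Feasible φ Fstar g δ θ γ P F ∧
    Integrable (fun u => k u θ γ) F ∧ x = ((∫ u, k u θ γ ∂F : ℝ) : EReal)}

/-- `κ̲*_δ(θ;γ,P)`: the dual program of `κ̲_δ`.  Multipliers with
`E^{F*}[(ηφ)*(...)] = +∞` contribute `-∞` to the supremum and are omitted from the
index set; `w` is a real-valued integrable version of the conjugate integrand. -/
def kappaLowDual (δ : ℝ) (θ : Fin dθ → ℝ) (γ : Γ) (P : Vec12 d1 d2) : EReal :=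
  sSup {x : EReal | ∃ η : ℝ, 0 ≤ η ∧ ∃ ζ : ℝ, ∃ l : Vec4 d1 d2 d3 d4, inLambda l ∧
    ∃ w : U → ℝ, Integrable w Fstar ∧
      (∀ᵐ u ∂Fstar, (w u : EReal) = etaPhiStar φ η (-(k u θ γ) - ζ - dot4 l (g u θ γ))) ∧
      x = ((-(∫ u, w u ∂Fstar) - η * δ - ζ - dotP l P : ℝ) : EReal)}

/-- `κ̄*_δ(θ;γ,P)`: the dual program of `κ̄_δ`. -/
def kappaHighDual (δ : ℝ) (θ : Fin dθ → ℝ) (γ : Γ) (P : Vec12 d1 d2) : EReal :=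
  sInf {x : EReal | ∃ η : ℝ, 0 ≤ η ∧ ∃ ζ : ℝ, ∃ l : Vec4 d1 d2 d3 d4, inLambda l ∧
    ∃ w : U → ℝ, Integrable w Fstar ∧
      (∀ᵐ u ∂Fstar, (w u : EReal) = etaPhiStar φ η (k u θ γ - ζ - dot4 l (g u θ γ))) ∧
      x = (((∫ u, w u ∂Fstar) + η * δ + ζ + dotP l P : ℝ) : EReal)}

/-- `δ*(θ;γ,P) = sup_{ζ,λ∈Λ} ( -E^{F*}[φ*(-ζ-λ'g)] - ζ - λ12'P )`. -/
def deltaStar (θ : Fin dθ → ℝ) (γ : Γ) (P : Vec12 d1 d2) : EReal :=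
  sSup {x : EReal | ∃ ζ : ℝ, ∃ l : Vec4 d1 d2 d3 d4, inLambda l ∧
    ∃ w : U → ℝ, Integrable w Fstar ∧
      (∀ᵐ u ∂Fstar, (w u : EReal) = phiStar φ (-ζ - dot4 l (g u θ γ))) ∧
      x = ((-(∫ u, w u ∂Fstar) - ζ - dotP l P : ℝ) : EReal)}

/-- `{E^F[g(U,θ,γ)] : F ∈ N_∞}`. -/
def momentSet (θ : Fin dθ → ℝ) (γ : Γ) : Set (Vec4 d1 d2 d3 d4) :=
  {v | ∃ F : Measure U, IsProbabilityMeasure F ∧ Dphi φ Fstar F < ⊤ ∧ GIntegrable g θ γ F ∧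
    v = ((fun i => ∫ u, (g u θ γ).1 i ∂F), (fun i => ∫ u, (g u θ γ).2.1 i ∂F),
         (fun i => ∫ u, (g u θ γ).2.2.1 i ∂F), (fun i => ∫ u, (g u θ γ).2.2.2 i ∂F))}

/-- The cone `𝒞 = ℝ^{d1}_{≥0} × {0} × ℝ^{d3}_{≥0} × {0}`. -/
def coneC : Set (Vec4 d1 d2 d3 d4) :=
  {c | (∀ i, 0 ≤ c.1 i) ∧ c.2.1 = 0 ∧ (∀ i, 0 ≤ c.2.2.1 i) ∧ c.2.2.2 = 0}

/-- Condition S at `(θ,γ,P)`. -/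
def ConditionS (θ : Fin dθ → ℝ) (γ : Γ) (P : Vec12 d1 d2) : Prop :=
  ((P.1, P.2, (0 : Fin d3 → ℝ), (0 : Fin d4 → ℝ)) : Vec4 d1 d2 d3 d4) ∈
    interior (momentSet φ Fstar g θ γ + coneC)

/-- Assumption Φ(ii): `k(·,θ,γ)` and each component of `g(·,θ,γ)` lie in `ℰ`. -/
def PhiTwo : Prop :=
  ∀ (θ : Fin dθ → ℝ) (γ : Γ), MemE φ Fstar (fun u => k u θ γ) ∧
    (∀ i, MemE φ Fstar (fun u => (g u θ γ).1 i)) ∧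
    (∀ i, MemE φ Fstar (fun u => (g u θ γ).2.1 i)) ∧
    (∀ i, MemE φ Fstar (fun u => (g u θ γ).2.2.1 i)) ∧
    (∀ i, MemE φ Fstar (fun u => (g u θ γ).2.2.2 i))

/-- `Θ_δ = {θ ∈ Θ : δ*(θ;γ0,P0) < δ}`. -/
def ThetaDelta (Θ : Set (Fin dθ → ℝ)) (γ0 : Γ) (P0 : Vec12 d1 d2) (δ : ℝ) :
    Set (Fin dθ → ℝ) :=
  {θ ∈ Θ | deltaStar φ Fstar g θ γ0 P0 < ((δ : ℝ) : EReal)}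

/-- Implicit-dependence lower value: `kI(θ,γ)` if feasible, `+∞` otherwise. -/
def kappaLowImp (kI : (Fin dθ → ℝ) → Γ → ℝ) (δ : ℝ) (θ : Fin dθ → ℝ) (γ : Γ)
    (P : Vec12 d1 d2) : EReal :=
  sInf {x : EReal | ∃ F : Measure U, Feasible φ Fstar g δ θ γ P F ∧ x = ((kI θ γ : ℝ) : EReal)}

/-- Implicit-dependence upper value: `kI(θ,γ)` if feasible, `-∞` otherwise. -/
def kappaHighImp (kI : (Fin dθ → ℝ) → Γ → ℝ) (δ : ℝ) (θ : Fin dθ → ℝ) (γ : Γ)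
    (P : Vec12 d1 d2) : EReal :=
  sSup {x : EReal | ∃ F : Measure U, Feasible φ Fstar g δ θ γ P F ∧ x = ((kI θ γ : ℝ) : EReal)}

/-- The criterion `K̲_δ(θ;γ,P)`. -/
def KLowCrit (δ : ℝ) (θ : Fin dθ → ℝ) (γ : Γ) (P : Vec12 d1 d2) : EReal :=
  if deltaStar φ Fstar g θ γ P < ((δ : ℝ) : EReal) then kappaLowDual φ Fstar g k δ θ γ P
  else if deltaStar φ Fstar g θ γ P = ((δ : ℝ) : EReal) then kappaLow φ Fstar g k δ θ γ P
  else ⊤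

/-- The criterion `K̄_δ(θ;γ,P)`. -/
def KHighCrit (δ : ℝ) (θ : Fin dθ → ℝ) (γ : Γ) (P : Vec12 d1 d2) : EReal :=
  if deltaStar φ Fstar g θ γ P < ((δ : ℝ) : EReal) then kappaHighDual φ Fstar g k δ θ γ P
  else if deltaStar φ Fstar g θ γ P = ((δ : ℝ) : EReal) then kappaHigh φ Fstar g k δ θ γ P
  else ⊥

/-- ℰ-continuity of a family `f(·,θ,γ)` in `(θ,γ)` on `Θ × Γ`. -/
def EContinuousIn [TopologicalSpace Γ] (Θ : Set (Fin dθ → ℝ))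
    (f : U → (Fin dθ → ℝ) → Γ → ℝ) : Prop :=
  ∀ θ0 ∈ Θ, ∀ γ0 : Γ,
    Tendsto (fun p : (Fin dθ → ℝ) × Γ => psiNorm φ Fstar (fun u => f u p.1 p.2 - f u θ0 γ0))
      (nhdsWithin (θ0, γ0) (Θ ×ˢ (Set.univ : Set Γ))) (nhds 0)

/-- Assumption M(i) for the moment functions. -/
def MOneG [TopologicalSpace Γ] (Θ : Set (Fin dθ → ℝ)) : Prop :=
  (∀ i, EContinuousIn φ Fstar Θ (fun u θ γ => (g u θ γ).1 i)) ∧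
  (∀ i, EContinuousIn φ Fstar Θ (fun u θ γ => (g u θ γ).2.1 i)) ∧
  (∀ i, EContinuousIn φ Fstar Θ (fun u θ γ => (g u θ γ).2.2.1 i)) ∧
  (∀ i, EContinuousIn φ Fstar Θ (fun u θ γ => (g u θ γ).2.2.2 i))

/-- Assumption M(v). -/
def MFive [TopologicalSpace Γ] (Θ : Set (Fin dθ → ℝ)) : Prop :=
  ∀ (c1 c2 : ℝ) (c3 : Vec4 d1 d2 d3 d4), ContinuousOn
    (fun p : (Fin dθ → ℝ) × Γ =>
      eExp Fstar (φ 0) (fun u => phiStar φ (c1 + c2 * k u p.1 p.2 + dot4 c3 (g u p.1 p.2))))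
    (Θ ×ˢ (Set.univ : Set Γ))

/-- Objective of the dual program for the lower value, as a function of `(η,ζ,λ)`. -/
def lowObj (δ : ℝ) (θ : Fin dθ → ℝ) (γ : Γ) (P : Vec12 d1 d2) (η ζ : ℝ)
    (l : Vec4 d1 d2 d3 d4) : EReal :=
  -(eExp Fstar (η * φ 0) (fun u => etaPhiStar φ η (-(k u θ γ) - ζ - dot4 l (g u θ γ))))
    - ((η * δ : ℝ) : EReal) - ((ζ : ℝ) : EReal) - ((dotP l P : ℝ) : EReal)

/-- Objective of the dual program for the upper value. -/
def highObj (δ : ℝ) (θ : Fin dθ → ℝ) (γ : Γ) (P : Vec12 d1 d2) (η ζ : ℝ)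
    (l : Vec4 d1 d2 d3 d4) : EReal :=
  (eExp Fstar (η * φ 0) (fun u => etaPhiStar φ η (k u θ γ - ζ - dot4 l (g u θ γ))))
    + ((η * δ : ℝ) : EReal) + ((ζ : ℝ) : EReal) + ((dotP l P : ℝ) : EReal)

/-- `Ξ̲_δ(θ)`: maximizers of the lower dual program. -/
def XiLow (δ : ℝ) (θ : Fin dθ → ℝ) (γ : Γ) (P : Vec12 d1 d2) :
    Set (ℝ × ℝ × Vec4 d1 d2 d3 d4) :=
  {ξ | 0 ≤ ξ.1 ∧ inLambda ξ.2.2 ∧ ∀ ξ' : ℝ × ℝ × Vec4 d1 d2 d3 d4, 0 ≤ ξ'.1 → inLambda ξ'.2.2 →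
    lowObj φ Fstar g k δ θ γ P ξ'.1 ξ'.2.1 ξ'.2.2 ≤ lowObj φ Fstar g k δ θ γ P ξ.1 ξ.2.1 ξ.2.2}

/-- `Ξ̄_δ(θ)`: minimizers of the upper dual program. -/
def XiHigh (δ : ℝ) (θ : Fin dθ → ℝ) (γ : Γ) (P : Vec12 d1 d2) :
    Set (ℝ × ℝ × Vec4 d1 d2 d3 d4) :=
  {ξ | 0 ≤ ξ.1 ∧ inLambda ξ.2.2 ∧ ∀ ξ' : ℝ × ℝ × Vec4 d1 d2 d3 d4, 0 ≤ ξ'.1 → inLambda ξ'.2.2 →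
    highObj φ Fstar g k δ θ γ P ξ.1 ξ.2.1 ξ.2.2 ≤ highObj φ Fstar g k δ θ γ P ξ'.1 ξ'.2.1 ξ'.2.2}

/-- `Λ̲_δ(θ)`: `(λ1,λ2)`-projections of `Ξ̲_δ(θ)`. -/
def LamLow (δ : ℝ) (θ : Fin dθ → ℝ) (γ : Γ) (P : Vec12 d1 d2) : Set (Vec12 d1 d2) :=
  {p | ∃ ξ ∈ XiLow φ Fstar g k δ θ γ P, ξ.2.2.1 = p.1 ∧ ξ.2.2.2.1 = p.2}

/-- `Λ̄_δ(θ)`: `(λ1,λ2)`-projections of `Ξ̄_δ(θ)`. -/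
def LamHigh (δ : ℝ) (θ : Fin dθ → ℝ) (γ : Γ) (P : Vec12 d1 d2) : Set (Vec12 d1 d2) :=
  {p | ∃ ξ ∈ XiHigh φ Fstar g k δ θ γ P, ξ.2.2.1 = p.1 ∧ ξ.2.2.2.1 = p.2}

end Model

end CFSens

open CFSens

namespace CFSens

section Conjugate

variable {φ : ℝ → ℝ}

/-- Real-valued version of the conjugate `φ*`. -/
def pStar (φ : ℝ → ℝ) (x : ℝ) : ℝ := (phiStar φ x).toReal

theorem PhiOne.nonneg (h : PhiOne φ) {t : ℝ} (ht : 0 ≤ t) : 0 ≤ φ t := by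
  have hd : HasDerivAt φ 0 1 := by
    have := ((h.smooth.contDiffAt (Ioi_mem_nhds one_pos)).differentiableAt (by norm_num)).hasDerivAt
    rwa [h.done] at this
  have hw : derivWithin φ (Ioi 1) 1 = 0 := hd.hasDerivWithinAt.derivWithin (uniqueDiffWithinAt_Ioi 1)
  have := h.sconvex.convexOn.isMinOn_of_rightDeriv_eq_zero (x := 1) (by simp) hw
  have h1 : φ 1 ≤ φ t := this (a := t) ht
  rwa [h.one] at h1

theorem PhiOne.bddAbove (h : PhiOne φ) (x : ℝ) : ∃ B : ℝ, ∀ t, 0 ≤ t → t * x - φ t ≤ B := by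
  obtain ⟨T, hT⟩ := (h.superlinear.eventually_ge_atTop x).exists_forall_of_atTop
  refine ⟨(max T 1) * |x|, fun t ht => ?_⟩
  rcases le_total (max T 1) t with hh | hh
  · have h1 : x ≤ φ t / t := hT t (le_trans (le_max_left _ _) hh)
    have ht0 : 0 < t := lt_of_lt_of_le one_pos (le_trans (le_max_right _ _) hh)
    rw [le_div_iff₀ ht0] at h1
    have : 0 ≤ max T 1 * |x| := by positivity
    linarith
  · have h1 := h.nonneg ht
    have : t * x ≤ t * |x| := mul_le_mul_of_nonneg_left (le_abs_self x) ht
    have : t * |x| ≤ max T 1 * |x| := mul_le_mul_of_nonneg_right hh (abs_nonneg x)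
    linarith

theorem PhiOne.coe_pStar (h : PhiOne φ) (x : ℝ) : ((pStar φ x : ℝ) : EReal) = phiStar φ x := by
  obtain ⟨B, hB⟩ := h.bddAbove x
  apply EReal.coe_toReal
  · refine ne_of_lt (lt_of_le_of_lt (b := (B : EReal)) ?_ (EReal.coe_lt_top B))
    exact iSup₂_le fun t ht => EReal.coe_le_coe_iff.2 (hB t ht)
  · refine ne_of_gt (lt_of_lt_of_le (EReal.bot_lt_coe ((1:ℝ) * x - φ 1)) ?_)
    exact le_iSup₂ (f := fun t (_ : t ∈ Ici (0:ℝ)) => ((t * x - φ t : ℝ) : EReal)) 1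
      (by simp)

theorem PhiOne.young (h : PhiOne φ) {t : ℝ} (ht : 0 ≤ t) (x : ℝ) : t * x - φ t ≤ pStar φ x := by
  rw [← EReal.coe_le_coe_iff, h.coe_pStar]
  exact le_iSup₂ (f := fun t (_ : t ∈ Ici (0:ℝ)) => ((t * x - φ t : ℝ) : EReal)) t ht

theorem PhiOne.pStar_le (h : PhiOne φ) {x c : ℝ} (hc : ∀ t, 0 ≤ t → t * x - φ t ≤ c) :
    pStar φ x ≤ c := by
  rw [← EReal.coe_le_coe_iff, h.coe_pStar]
  exact iSup₂_le fun t ht => EReal.coe_le_coe_iff.2 (hc t ht)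

theorem PhiOne.pStar_mono (h : PhiOne φ) : Monotone (pStar φ) := fun x y hxy =>
  h.pStar_le fun t ht => by
    have := h.young ht y
    have := mul_le_mul_of_nonneg_left hxy ht
    linarith

theorem PhiOne.measurable_pStar (h : PhiOne φ) : Measurable (pStar φ) := h.pStar_mono.measurable

theorem PhiOne.le_pStar (h : PhiOne φ) (x : ℝ) : x ≤ pStar φ x := by
  have := h.young zero_le_one x
  rw [h.one] at this
  linarith

theorem PhiOne.neg_le_pStar (h : PhiOne φ) (x : ℝ) : -φ 0 ≤ pStar φ x := by
  have := h.young le_rfl x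
  linarith

theorem PhiOne.pStar_midpoint (h : PhiOne φ) (x y : ℝ) :
    pStar φ (x + y) ≤ (pStar φ (2 * x) + pStar φ (2 * y)) / 2 :=
  h.pStar_le fun t ht => by
    have := h.young ht (2 * x)
    have := h.young ht (2 * y)
    linarith

theorem PhiOne.coe_etaPhiStar (h : PhiOne φ) {η : ℝ} (hη : 0 < η) (x : ℝ) :
    etaPhiStar φ η x = ((η * pStar φ (x / η) : ℝ) : EReal) := by
  apply le_antisymm
  · refine iSup₂_le fun t ht => EReal.coe_le_coe_iff.2 ?_
    have := mul_le_mul_of_nonneg_left (h.young ht (x / η)) hη.le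
    have e : η * (t * (x / η) - φ t) = t * x - η * φ t := by field_simp
    linarith
  · by_contra hlt
    obtain ⟨z, hz, hz'⟩ := EReal.lt_iff_exists_real_btwn.1 (not_le.1 hlt)
    have hle : ∀ t, 0 ≤ t → t * x - η * φ t ≤ z := by
      intro t ht
      rw [← EReal.coe_le_coe_iff]
      refine le_trans ?_ hz.le
      exact le_iSup₂ (f := fun t (_ : t ∈ Ici (0:ℝ)) => ((t * x - η * φ t : ℝ) : EReal)) t ht
    have : pStar φ (x / η) ≤ z / η := h.pStar_le fun t ht => by
      rw [le_div_iff₀ hη]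
      have e : (t * (x / η) - φ t) * η = t * x - η * φ t := by field_simp
      linarith [hle t ht]
    rw [le_div_iff₀ hη] at this
    rw [EReal.coe_lt_coe_iff] at hz'
    linarith

theorem PhiOne.continuousAt (h : PhiOne φ) {t : ℝ} (ht : 0 < t) : ContinuousAt φ t :=
  (h.smooth.contDiffAt (Ioi_mem_nhds ht)).continuousAt

theorem PhiOne.measurable_comp (h : PhiOne φ) {U : Type*} [MeasurableSpace U] {f : U → ℝ}
    (hf : Measurable f) (hf0 : ∀ u, 0 ≤ f u) : Measurable fun u => φ (f u) := by
  have hm : Measurable ((Ioi (0:ℝ)).piecewise φ fun _ => φ 0) :=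
    ContinuousOn.measurable_piecewise (fun t ht => (h.continuousAt ht).continuousWithinAt)
      continuousOn_const measurableSet_Ioi
  convert hm.comp hf using 1
  funext u
  rcases (hf0 u).eq_or_lt with h0 | h0
  · simp [← h0]
  · simp [h0]

/-- Convexity gap of `φ` at the midpoint. -/
def gap (φ : ℝ → ℝ) (x y : ℝ) : ℝ := (φ x + φ y) / 2 - φ ((x + y) / 2)

theorem PhiOne.gap_nonneg (h : PhiOne φ) {x y : ℝ} (hx : 0 ≤ x) (hy : 0 ≤ y) : 0 ≤ gap φ x y := by
  have := h.sconvex.convexOn.2 hx hy (show (0:ℝ) ≤ 1/2 by norm_num) (show (0:ℝ) ≤ 1/2 by norm_num) (by norm_num)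
  simp only [smul_eq_mul] at this
  rw [show 1/2 * x + 1/2 * y = (x + y) / 2 by ring] at this
  unfold gap; linarith

theorem PhiOne.gap_pos (h : PhiOne φ) {x y : ℝ} (hx : 0 ≤ x) (hy : 0 ≤ y) (hxy : x ≠ y) :
    0 < gap φ x y := by
  have := h.sconvex.2 hx hy hxy (show (0:ℝ) < 1/2 by norm_num) (show (0:ℝ) < 1/2 by norm_num) (by norm_num)
  simp only [smul_eq_mul] at this
  rw [show 1/2 * x + 1/2 * y = (x + y) / 2 by ring] at this
  unfold gap; linarith

theorem PhiOne.gap_anti (h : PhiOne φ) {x x' y : ℝ} (hx : 0 ≤ x) (hxx : x ≤ x') (hxy : x' ≤ y) :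
    gap φ x' y ≤ gap φ x y := by
  rcases hxx.eq_or_lt with rfl | hlt
  · rfl
  have hy : x < y := hlt.trans_le hxy
  set z := (x' + y) / 2 with hz
  have hxz : x < z := by rw [hz]; linarith
  have hcv : ∀ w, x ≤ w → w ≤ z → (z - x) * φ w ≤ (z - w) * φ x + (w - x) * φ z := by
    intro w h1 h2
    have hzx : 0 < z - x := by linarith
    have := h.sconvex.convexOn.2 (show x ∈ Ici 0 from hx) (show z ∈ Ici 0 from le_trans hx hxz.le)
      (show 0 ≤ (z - w) / (z - x) from div_nonneg (by linarith) hzx.le)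
      (show 0 ≤ (w - x) / (z - x) from div_nonneg (by linarith) hzx.le)
      (by field_simp; ring)
    simp only [smul_eq_mul] at this
    have e : (z - w) / (z - x) * x + (w - x) / (z - x) * z = w := by field_simp; ring
    rw [e] at this
    have := mul_le_mul_of_nonneg_left this hzx.le
    calc _ ≤ _ := this
      _ = _ := by field_simp
  have h1 := hcv x' hxx (by rw [hz]; linarith)
  have h2 := hcv ((x + y) / 2) (by linarith) (by rw [hz]; linarith)
  have hzx : 0 < z - x := by linarith
  unfold gap
  have key : (z - x) * (φ x' + 2 * φ ((x + y) / 2)) ≤ (z - x) * (φ x + 2 * φ z) := by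
    have e1 : (z - x') * φ x + 2 * ((z - (x + y) / 2) * φ x) = (z - x) * φ x := by
      rw [hz]; ring
    have e2 : (x' - x) * φ z + 2 * (((x + y) / 2 - x) * φ z) = 2 * ((z - x) * φ z) := by
      rw [hz]; ring
    linarith
  have := le_of_mul_le_mul_left key hzx
  linarith

theorem PhiOne.exists_gap_modulus (h : PhiOne φ) (R : ℝ) {ε : ℝ} (hε : 0 < ε) :
    ∃ C : ℝ, 0 ≤ C ∧ ∀ x y, 0 ≤ x → 0 ≤ y → x ≤ R → y ≤ R → |x - y| ≤ ε + C * gap φ x y := by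
  let S : Set (ℝ × ℝ) := (Icc (ε/2) R ×ˢ Icc (ε/2) R) ∩ {p | ε/2 ≤ |p.1 - p.2|}
  have hS : IsCompact S := (isCompact_Icc.prod isCompact_Icc).inter_right
    (isClosed_le continuous_const (by fun_prop))
  have hcont : ContinuousOn (fun p : ℝ × ℝ => gap φ p.1 p.2) S := by
    rintro ⟨x, y⟩ ⟨⟨hx, hy⟩, -⟩
    have hx0 : 0 < x := lt_of_lt_of_le (by linarith) hx.1
    have hy0 : 0 < y := lt_of_lt_of_le (by linarith) hy.1
    apply ContinuousAt.continuousWithinAt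
    unfold gap
    have c1 : ContinuousAt (fun p : ℝ × ℝ => φ p.1) (x, y) :=
      ContinuousAt.comp (f := Prod.fst) (h.continuousAt hx0) continuousAt_fst
    have c2 : ContinuousAt (fun p : ℝ × ℝ => φ p.2) (x, y) :=
      ContinuousAt.comp (f := Prod.snd) (h.continuousAt hy0) continuousAt_snd
    have c3 : ContinuousAt (fun p : ℝ × ℝ => φ ((p.1 + p.2) / 2)) (x, y) :=
      ContinuousAt.comp (f := fun p : ℝ × ℝ => (p.1 + p.2) / 2)
        (h.continuousAt (t := (x + y) / 2) (by linarith)) (by fun_prop)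
    exact ((c1.add c2).div_const 2).sub c3
  obtain ⟨c, hc, hcS⟩ : ∃ c, 0 < c ∧ ∀ p ∈ S, c ≤ gap φ p.1 p.2 := by
    rcases S.eq_empty_or_nonempty with he | hne
    · exact ⟨1, one_pos, fun p hp => by simp [he] at hp⟩
    · obtain ⟨p, hp, hmin⟩ := hS.exists_isMinOn hne hcont
      refine ⟨_, h.gap_pos (x := p.1) (y := p.2) ?_ ?_ ?_, fun q hq => hmin hq⟩
      · linarith [hp.1.1.1]
      · linarith [hp.1.2.1]
      · intro he
        have := hp.2
        simp only [mem_ofPred_eq, he, sub_self, abs_zero] at this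
        linarith
  have main : ∀ x y, 0 ≤ x → x ≤ y → y ≤ R → |x - y| ≤ ε + (R / c) * gap φ x y := by
    intro x y hx hxy hy
    have hg := h.gap_nonneg hx (hx.trans hxy)
    have hR : 0 ≤ R := by linarith
    rw [abs_of_nonpos (by linarith)]
    rcases le_or_gt (y - x) ε with hle | hgt
    · have : 0 ≤ R / c * gap φ x y := by positivity
      linarith
    · have h1 := h.gap_anti hx (x' := x + ε / 2) (y := y) (by linarith) (by linarith)
      have h2 : c ≤ gap φ (x + ε/2) y := hcS (x + ε/2, y) ⟨⟨⟨by linarith, by linarith⟩,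
        ⟨by linarith, by linarith⟩⟩, by
          simp only [mem_ofPred_eq]; rw [abs_of_nonpos (by linarith)]; linarith⟩
      have : R ≤ R / c * gap φ x y := by
        rw [div_mul_eq_mul_div, le_div_iff₀ hc]
        exact mul_le_mul_of_nonneg_left (h2.trans h1) hR
      linarith
  refine ⟨|R| / c, by positivity, fun x y hx hy hxR hyR => ?_⟩
  have hR : |R| = R := abs_of_nonneg (hx.trans hxR)
  rw [hR]
  rcases le_total x y with hxy | hxy
  · exact main x y hx hxy hyR
  · have := main y x hy hxy hxR
    rw [abs_sub_comm, show gap φ x y = gap φ y x by unfold gap; rw [add_comm x y, add_comm (φ x)]]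
    exact this

end Conjugate

section Orlicz

variable {U : Type*} [MeasurableSpace U] {φ : ℝ → ℝ} {Q : Measure U}

/-- The Orlicz heart, described by integrability of the real-valued conjugate. -/
def OHeart (φ : ℝ → ℝ) (Q : Measure U) (f : U → ℝ) : Prop :=
  Measurable f ∧ ∀ c : ℝ, 0 < c → Integrable (fun u => pStar φ (c * |f u|)) Q

/-- Unnormalized densities with integrable divergence cost. -/
def Adm (φ : ℝ → ℝ) (Q : Measure U) (f : U → ℝ) : Prop :=
  Measurable f ∧ (∀ u, 0 ≤ f u) ∧ Integrable (fun u => φ (f u)) Q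

theorem PhiOne.erealToENNReal_psi (h : PhiOne φ) (x : ℝ) :
    erealToENNReal (psi φ x) = ENNReal.ofReal (pStar φ x - x) := by
  have e : psi φ x = ((pStar φ x - x : ℝ) : EReal) := by
    rw [psi, ← h.coe_pStar, EReal.coe_sub]
  rw [e, erealToENNReal, if_neg (EReal.coe_ne_top _), EReal.toReal_coe]

theorem PhiOne.pStar_le_psi (h : PhiOne φ) (x : ℝ) : pStar φ x ≤ 2 * (pStar φ x - x) + φ 2 := by
  have := h.young zero_le_two x
  linarith

theorem MemE.oHeart [IsProbabilityMeasure Q] (h : PhiOne φ) {f : U → ℝ} (hf : MemE φ Q f) :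
    OHeart φ Q f := by
  refine ⟨hf.1, fun c hc => ?_⟩
  have hm : Measurable fun u => pStar φ (c * |f u|) :=
    h.measurable_pStar.comp ((measurable_const.mul hf.1.abs))
  have hi : Integrable (fun u => pStar φ (c * |f u|) - c * |f u|) Q := by
    refine ⟨(hm.sub (measurable_const.mul hf.1.abs)).aestronglyMeasurable, ?_⟩
    rw [hasFiniteIntegral_iff_ofReal (ae_of_all _ fun u => sub_nonneg.2 (h.le_pStar _))]
    have := hf.2 c hc
    simpa only [h.erealToENNReal_psi] using this
  refine ((hi.const_mul 2).add (integrable_const (φ 2))).mono' hm.aestronglyMeasurable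
    (ae_of_all _ fun u => ?_)
  have h0 : 0 ≤ c * |f u| := by positivity
  rw [Real.norm_eq_abs, abs_of_nonneg (h0.trans (h.le_pStar _))]
  exact h.pStar_le_psi _

theorem OHeart.congr_abs {f f' : U → ℝ} (hf : OHeart φ Q f) (hm : Measurable f')
    (he : ∀ u, |f' u| = |f u|) : OHeart φ Q f' :=
  ⟨hm, fun c hc => by simpa only [he] using hf.2 c hc⟩

theorem OHeart.neg {f : U → ℝ} (hf : OHeart φ Q f) : OHeart φ Q fun u => -f u :=
  hf.congr_abs hf.1.neg fun _ => abs_neg _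

theorem OHeart.const [IsProbabilityMeasure Q] (a : ℝ) : OHeart φ Q fun _ => a :=
  ⟨measurable_const, fun _ _ => integrable_const _⟩

theorem OHeart.const_mul [IsProbabilityMeasure Q] {f : U → ℝ} (hf : OHeart φ Q f) (a : ℝ) :
    OHeart φ Q fun u => a * f u := by
  rcases eq_or_ne a 0 with rfl | ha
  · simpa using OHeart.const (φ := φ) (Q := Q) 0
  · refine ⟨hf.1.const_mul a, fun c hc => ?_⟩
    have := hf.2 (c * |a|) (mul_pos hc (abs_pos.2 ha))
    simpa only [abs_mul, mul_assoc] using this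

theorem OHeart.add (h : PhiOne φ) {f f' : U → ℝ} (hf : OHeart φ Q f) (hf' : OHeart φ Q f') :
    OHeart φ Q fun u => f u + f' u := by
  refine ⟨hf.1.add hf'.1, fun c hc => ?_⟩
  refine (((hf.2 (2 * c) (by positivity)).add (hf'.2 (2 * c) (by positivity))).div_const 2).mono'
    (h.measurable_pStar.comp ((measurable_const.mul (hf.1.add hf'.1).abs))).aestronglyMeasurable
    (ae_of_all _ fun u => ?_)
  have h0 : 0 ≤ c * |f u + f' u| := by positivity
  rw [Real.norm_eq_abs, abs_of_nonneg (h0.trans (h.le_pStar _))]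
  have h1 : c * |f u + f' u| ≤ c * |f u| + c * |f' u| := by
    rw [← mul_add]; exact mul_le_mul_of_nonneg_left (abs_add_le _ _) hc.le
  have h2 := (h.pStar_mono h1).trans (h.pStar_midpoint _ _)
  simpa only [Pi.add_apply, mul_assoc] using h2

theorem OHeart.sub (h : PhiOne φ) {f f' : U → ℝ} (hf : OHeart φ Q f) (hf' : OHeart φ Q f') :
    OHeart φ Q fun u => f u - f' u := by
  simpa only [sub_eq_add_neg] using hf.add h hf'.neg

theorem OHeart.sum [IsProbabilityMeasure Q] (h : PhiOne φ) {ι : Type*} (s : Finset ι)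
    {f : ι → U → ℝ} (hf : ∀ i, OHeart φ Q (f i)) : OHeart φ Q fun u => ∑ i ∈ s, f i u := by
  induction s using Finset.induction_on with
  | empty => simpa using OHeart.const (φ := φ) (Q := Q) 0
  | insert a s ha ih => simpa only [Finset.sum_insert ha] using (hf a).add h ih

theorem OHeart.integrable_pStar [IsProbabilityMeasure Q] (h : PhiOne φ) {f : U → ℝ}
    (hf : OHeart φ Q f) : Integrable (fun u => pStar φ (f u)) Q := by
  refine ((hf.2 1 one_pos).add (integrable_const (φ 0))).mono'
    (h.measurable_pStar.comp hf.1).aestronglyMeasurable (ae_of_all _ fun u => ?_)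
  have h1 := h.neg_le_pStar (f u)
  have h2 := h.pStar_mono (le_abs_self (f u))
  have h3 := h.nonneg le_rfl
  have h4 := (abs_nonneg (f u)).trans (h.le_pStar _)
  rw [Real.norm_eq_abs, abs_le]
  simp only [Pi.add_apply, one_mul]
  constructor <;> linarith

theorem Adm.integrable_mul (h : PhiOne φ) {f k : U → ℝ} (hf : Adm φ Q f) (hk : OHeart φ Q k) :
    Integrable (fun u => f u * k u) Q := by
  refine (hf.2.2.add (hk.2 1 one_pos)).mono' (hf.1.mul hk.1).aestronglyMeasurable
    (ae_of_all _ fun u => ?_)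
  have := h.young (hf.2.1 u) |k u|
  rw [Real.norm_eq_abs, abs_mul, abs_of_nonneg (hf.2.1 u)]
  simp only [Pi.add_apply, one_mul]
  linarith

theorem Adm.integrable [IsProbabilityMeasure Q] (h : PhiOne φ) {f : U → ℝ} (hf : Adm φ Q f) :
    Integrable f Q := by
  simpa using hf.integrable_mul h (OHeart.const (φ := φ) 1)

theorem Adm.const [IsProbabilityMeasure Q] {a : ℝ} (ha : 0 ≤ a) : Adm φ Q fun _ => a :=
  ⟨measurable_const, fun _ => ha, integrable_const _⟩

theorem Adm.integral_nonneg (h : PhiOne φ) {f : U → ℝ} (hf : Adm φ Q f) :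
    0 ≤ ∫ u, φ (f u) ∂Q := MeasureTheory.integral_nonneg fun u => h.nonneg (hf.2.1 u)

theorem PhiOne.convex_ineq (h : PhiOne φ) {x y a b : ℝ} (hx : 0 ≤ x) (hy : 0 ≤ y) (ha : 0 ≤ a)
    (hb : 0 ≤ b) (hab : a + b = 1) : φ (a * x + b * y) ≤ a * φ x + b * φ y := by
  simpa using h.sconvex.convexOn.2 hx hy ha hb hab

theorem Adm.convexComb (h : PhiOne φ) {f f' : U → ℝ} (hf : Adm φ Q f) (hf' : Adm φ Q f')
    {a b : ℝ} (ha : 0 ≤ a) (hb : 0 ≤ b) (hab : a + b = 1) :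
    Adm φ Q fun u => a * f u + b * f' u := by
  have hm : Measurable fun u => a * f u + b * f' u := (hf.1.const_mul a).add (hf'.1.const_mul b)
  have h0 : ∀ u, 0 ≤ a * f u + b * f' u := fun u =>
    add_nonneg (mul_nonneg ha (hf.2.1 u)) (mul_nonneg hb (hf'.2.1 u))
  refine ⟨hm, h0, ((hf.2.2.const_mul a).add (hf'.2.2.const_mul b)).mono'
    (h.measurable_comp hm h0).aestronglyMeasurable (ae_of_all _ fun u => ?_)⟩
  rw [Real.norm_eq_abs, abs_of_nonneg (h.nonneg (h0 u))]
  exact h.convex_ineq (hf.2.1 u) (hf'.2.1 u) ha hb hab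

theorem Adm.integral_convexComb_le (h : PhiOne φ) {f f' : U → ℝ} (hf : Adm φ Q f)
    (hf' : Adm φ Q f') {a b : ℝ} (ha : 0 ≤ a) (hb : 0 ≤ b) (hab : a + b = 1) :
    ∫ u, φ (a * f u + b * f' u) ∂Q ≤ a * ∫ u, φ (f u) ∂Q + b * ∫ u, φ (f' u) ∂Q := by
  rw [← integral_const_mul, ← integral_const_mul,
    ← integral_add (hf.2.2.const_mul a) (hf'.2.2.const_mul b)]
  exact integral_mono (hf.convexComb h hf' ha hb hab).2.2
    ((hf.2.2.const_mul a).add (hf'.2.2.const_mul b))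
    fun u => h.convex_ineq (hf.2.1 u) (hf'.2.1 u) ha hb hab

theorem Adm.integral_convexComb_mul (h : PhiOne φ) {f f' k : U → ℝ} (hf : Adm φ Q f)
    (hf' : Adm φ Q f') (hk : OHeart φ Q k) (a b : ℝ) :
    ∫ u, (a * f u + b * f' u) * k u ∂Q = a * ∫ u, f u * k u ∂Q + b * ∫ u, f' u * k u ∂Q := by
  rw [← integral_const_mul, ← integral_const_mul,
    ← integral_add ((hf.integrable_mul h hk).const_mul a) ((hf'.integrable_mul h hk).const_mul b)]
  exact integral_congr_ae (ae_of_all _ fun u => by ring)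

/-- Orlicz-norm control of moments, uniform over bounded divergence. -/
theorem Adm.ofReal_integral_le [IsProbabilityMeasure Q] (h : PhiOne φ) {f k : U → ℝ}
    (hf : Adm φ Q f) (hk : OHeart φ Q k) {B : ℝ} (hB : ∫ u, φ (f u) ∂Q ≤ B) :
    ENNReal.ofReal |∫ u, f u * k u ∂Q| ≤ ENNReal.ofReal (B + φ 2 + 2) * psiNorm φ Q k := by
  have h2 := h.nonneg zero_le_two
  have hB0 := (hf.integral_nonneg h).trans hB
  have hK : 0 < B + φ 2 + 2 := by linarith
  rw [mul_comm, ← ENNReal.div_le_iff_le_mul (Or.inl (by simpa using hK))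
    (Or.inl ENNReal.ofReal_ne_top)]
  refine le_iInf₂ fun c hc => ?_
  have hc : 0 < c := hc
  rw [ENNReal.div_le_iff_le_mul (Or.inl (by simpa using hK)) (Or.inl ENNReal.ofReal_ne_top)]
  have hi := hk.2 c hc
  have hci : Integrable (fun u => c * |k u|) Q := hi.mono'
    (measurable_const.mul hk.1.abs).aestronglyMeasurable (ae_of_all _ fun u => by
      rw [Real.norm_eq_abs, abs_of_nonneg (by positivity)]; exact h.le_pStar _)
  have hψ : Integrable (fun u => pStar φ (c * |k u|) - c * |k u|) Q := hi.sub hci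
  have hψ0 : ∀ u, 0 ≤ pStar φ (c * |k u|) - c * |k u| := fun u => sub_nonneg.2 (h.le_pStar _)
  simp only [h.erealToENNReal_psi]
  rw [← ofReal_integral_eq_lintegral_ofReal hψ (ae_of_all _ hψ0)]
  set Ψ := ∫ u, (pStar φ (c * |k u|) - c * |k u|) ∂Q with hΨ
  have hΨ0 : 0 ≤ Ψ := MeasureTheory.integral_nonneg hψ0
  rw [← ENNReal.ofReal_inv_of_pos hc, ← ENNReal.ofReal_one, ← ENNReal.ofReal_add zero_le_one hΨ0,
    ← ENNReal.ofReal_mul (by positivity), ← ENNReal.ofReal_mul (by positivity)]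
  apply ENNReal.ofReal_le_ofReal
  have habs : |∫ u, f u * k u ∂Q| ≤ ∫ u, f u * |k u| ∂Q := by
    refine (abs_integral_le_integral_abs).trans (le_of_eq (integral_congr_ae (ae_of_all _ fun u => ?_)))
    simp only [abs_mul, abs_of_nonneg (hf.2.1 u)]
  have hbound : c * ∫ u, f u * |k u| ∂Q ≤ B + 2 * Ψ + φ 2 := by
    have hkabs : OHeart φ Q fun u => |k u| := hk.congr_abs hk.1.abs fun u => abs_abs _
    rw [← integral_const_mul]
    calc ∫ u, c * (f u * |k u|) ∂Q
        ≤ ∫ u, (φ (f u) + (2 * (pStar φ (c * |k u|) - c * |k u|) + φ 2)) ∂Q := by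
          refine integral_mono ((hf.integrable_mul h hkabs).const_mul c)
            (hf.2.2.add ((hψ.const_mul 2).add (integrable_const _))) fun u => ?_
          have h1 := h.young (hf.2.1 u) (c * |k u|)
          have h2 := h.pStar_le_psi (c * |k u|)
          simp only
          linarith [show f u * (c * |k u|) = c * (f u * |k u|) by ring]
      _ = (∫ u, φ (f u) ∂Q) + (2 * Ψ + φ 2) := by
          have hψ2 : Integrable (fun u => 2 * (pStar φ (c * |k u|) - c * |k u|) + φ 2) Q :=
            (hψ.const_mul 2).add (integrable_const _)
          rw [integral_add hf.2.2 hψ2, integral_add (hψ.const_mul 2) (integrable_const _),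
            integral_const_mul]
          simp [hΨ]
      _ ≤ _ := by linarith
  calc |∫ u, f u * k u ∂Q| ≤ c⁻¹ * (c * ∫ u, f u * |k u| ∂Q) := by
        rw [← mul_assoc, inv_mul_cancel₀ hc.ne', one_mul]; exact habs
    _ ≤ c⁻¹ * ((1 + Ψ) * (B + φ 2 + 2)) := by
        refine mul_le_mul_of_nonneg_left (hbound.trans ?_) (by positivity)
        nlinarith [mul_nonneg hΨ0 hB0, mul_nonneg hΨ0 h2]
    _ = _ := by ring

theorem tendsto_integral_of_psiNorm [IsProbabilityMeasure Q] (h : PhiOne φ) {α : Type*}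
    {l : Filter α} {f k : α → U → ℝ} (hf : ∀ a, Adm φ Q (f a)) (hk : ∀ a, OHeart φ Q (k a)) {B : ℝ}
    (hB : ∀ a, ∫ u, φ (f a u) ∂Q ≤ B) (hlim : Tendsto (fun a => psiNorm φ Q (k a)) l (nhds 0)) :
    Tendsto (fun a => ∫ u, f a u * k a u ∂Q) l (nhds 0) := by
  have h1 : Tendsto (fun a => ENNReal.ofReal (B + φ 2 + 2) * psiNorm φ Q (k a)) l (nhds 0) := by
    simpa using ENNReal.Tendsto.const_mul hlim (Or.inr ENNReal.ofReal_ne_top)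
  have h2 : Tendsto (fun a => ENNReal.ofReal |∫ u, f a u * k a u ∂Q|) l (nhds 0) :=
    tendsto_of_tendsto_of_tendsto_of_le_of_le tendsto_const_nhds h1 (fun _ => bot_le)
      fun a => (hf a).ofReal_integral_le h (hk a) (hB a)
  rw [tendsto_zero_iff_abs_tendsto_zero]
  have h3 := (ENNReal.tendsto_toReal ENNReal.zero_ne_top).comp h2
  refine Tendsto.congr (fun a => ?_) h3
  simp [ENNReal.toReal_ofReal]

/-- Interchange of infimum over densities and integration. -/
theorem le_neg_integral_pStar [IsProbabilityMeasure Q] (h : PhiOne φ) {k : U → ℝ}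
    (hk : OHeart φ Q k) {v : ℝ}
    (hv : ∀ f, Adm φ Q f → v ≤ ∫ u, f u * k u ∂Q + ∫ u, φ (f u) ∂Q) :
    v ≤ -∫ u, pStar φ (-k u) ∂Q := by
  obtain ⟨q, hq0, hqsup⟩ : ∃ q : ℕ → ℝ, (∀ n, 0 ≤ q n) ∧ q 0 = 0 ∧
      ∀ x c, (∀ n, q n * x - φ (q n) ≤ c) → pStar φ x ≤ c := by
    obtain ⟨r, hr⟩ := TopologicalSpace.exists_dense_seq ℝ
    refine ⟨fun n => if n = 0 then 0 else |r (n - 1)|, fun n => by positivity, by simp,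
      fun x c hc => h.pStar_le fun t ht => ?_⟩
    rcases ht.eq_or_lt with rfl | ht
    · simpa using hc 0
    · by_contra! hlt
      have hcont : ContinuousAt (fun s => |s| * x - φ |s|) t := by
        have : ContinuousAt φ |t| := h.continuousAt (abs_pos.2 ht.ne')
        exact (continuous_abs.continuousAt.mul continuousAt_const).sub
          (ContinuousAt.comp (f := fun s : ℝ => |s|) this continuous_abs.continuousAt)
      have hev : ∀ᶠ s in nhds t, c < |s| * x - φ |s| :=
        hcont.eventually (lt_mem_nhds (by simpa [abs_of_pos ht] using hlt))
      obtain ⟨O, hO, hOo, htO⟩ := eventually_nhds_iff.1 hev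
      obtain ⟨n, hn⟩ := hr.exists_mem_open hOo ⟨t, htO⟩
      have h1 := hO _ hn
      have h2 := hc (n + 1)
      simp only [Nat.add_eq_zero_iff, one_ne_zero, and_false, if_false, Nat.add_sub_cancel] at h2
      linarith
  obtain ⟨hq00, hqsup⟩ := hqsup
  let f : ℕ → U → ℝ := fun n => Nat.rec (fun _ => q 0)
    (fun n fn u => if fn u * (-k u) - φ (fn u) < q (n + 1) * (-k u) - φ (q (n + 1))
      then q (n + 1) else fn u) n
  have hf0 : f 0 = fun _ => q 0 := rfl
  have hfs : ∀ n, f (n + 1) = fun u => if f n u * (-k u) - φ (f n u) <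
      q (n + 1) * (-k u) - φ (q (n + 1)) then q (n + 1) else f n u := fun n => rfl
  have hadm : ∀ n, Adm φ Q (f n) := by
    intro n
    induction n with
    | zero => rw [hf0]; exact Adm.const (hq0 0)
    | succ n ih =>
      have hset : MeasurableSet {u | f n u * (-k u) - φ (f n u) <
          q (n + 1) * (-k u) - φ (q (n + 1))} :=
        measurableSet_lt ((ih.1.mul hk.1.neg).sub (h.measurable_comp ih.1 ih.2.1))
          ((measurable_const.mul hk.1.neg).sub measurable_const)
      have hm : Measurable (f (n + 1)) := by
        rw [hfs]; exact Measurable.ite hset measurable_const ih.1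
      have h0 : ∀ u, 0 ≤ f (n + 1) u := fun u => by
        rw [hfs]; dsimp only; split_ifs
        · exact hq0 _
        · exact ih.2.1 u
      refine ⟨hm, h0, (ih.2.2.add (integrable_const (φ (q (n + 1))))).mono'
        (h.measurable_comp hm h0).aestronglyMeasurable (ae_of_all _ fun u => ?_)⟩
      have a1 := h.nonneg (ih.2.1 u)
      have a2 := h.nonneg (hq0 (n + 1))
      rw [Real.norm_eq_abs, abs_of_nonneg (h.nonneg (h0 u)), hfs]
      simp only [Pi.add_apply]
      split_ifs <;> linarith
  have hge : ∀ u n, ∀ m ≤ n, q m * (-k u) - φ (q m) ≤ f n u * (-k u) - φ (f n u) := by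
    intro u n
    induction n with
    | zero => intro m hm; obtain rfl : m = 0 := by omega
              rw [hf0]
    | succ n ih =>
      intro m hm
      rw [hfs]; dsimp only
      split_ifs with hc
      · rcases Nat.lt_or_ge m (n + 1) with hl | hl
        · exact (ih m (by omega)).trans hc.le
        · obtain rfl : m = n + 1 := by omega
          rfl
      · rcases Nat.lt_or_ge m (n + 1) with hl | hl
        · exact ih m (by omega)
        · obtain rfl : m = n + 1 := by omega
          exact not_lt.1 hc
  have hle : ∀ u n, f n u * (-k u) - φ (f n u) ≤ pStar φ (-k u) := fun u n =>
    h.young ((hadm n).2.1 u) _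
  have hmono : ∀ u, Tendsto (fun n => f n u * (-k u) - φ (f n u)) atTop (nhds (pStar φ (-k u))) := by
    intro u
    refine tendsto_order.2 ⟨fun a ha => ?_, fun a ha => Eventually.of_forall fun n =>
      (hle u n).trans_lt ha⟩
    obtain ⟨m, hm⟩ : ∃ m, a < q m * (-k u) - φ (q m) := by
      by_contra! hc
      exact absurd (hqsup _ _ hc) (not_le.2 ha)
    exact eventually_atTop.2 ⟨m, fun n hn => hm.trans_le (hge u n m hn)⟩
  have hint := hk.neg.integrable_pStar h
  have hlim : Tendsto (fun n => ∫ u, (f n u * (-k u) - φ (f n u)) ∂Q) atTop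
      (nhds (∫ u, pStar φ (-k u) ∂Q)) := by
    refine tendsto_integral_of_dominated_convergence
      (fun u => |pStar φ (-k u)| + φ 0) (fun n => ?_) (hint.abs.add (integrable_const _))
      (fun n => ae_of_all _ fun u => ?_) (ae_of_all _ hmono)
    · exact (((hadm n).1.mul hk.1.neg).sub
        (h.measurable_comp (hadm n).1 (hadm n).2.1)).aestronglyMeasurable
    · have h1 := hge u n 0 (Nat.zero_le _)
      rw [hq00] at h1
      have h2 := hle u n
      have h3 := le_abs_self (pStar φ (-k u))
      have h4 := abs_nonneg (pStar φ (-k u))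
      have h5 := h.nonneg le_rfl
      rw [Real.norm_eq_abs, abs_le]
      constructor <;> linarith
  have hfin : ∫ u, pStar φ (-k u) ∂Q ≤ -v := by
    refine le_of_tendsto hlim (Eventually.of_forall fun n => ?_)
    have h1 := hv _ (hadm n)
    have h2 : ∫ u, (f n u * (-k u) - φ (f n u)) ∂Q
        = -(∫ u, f n u * k u ∂Q) - ∫ u, φ (f n u) ∂Q := by
      have hneg : Integrable (fun u => -(f n u * k u)) Q := ((hadm n).integrable_mul h hk).neg
      rw [← integral_neg, ← integral_sub hneg (hadm n).2.2]
      exact integral_congr_ae (ae_of_all _ fun u => by simp)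
    linarith
  linarith

end Orlicz

section Separation

/-- A nonempty convex set of a finite-dimensional space avoiding `0` lies in a half-space. -/
theorem exists_nonneg_functional {E : Type*} [NormedAddCommGroup E] [NormedSpace ℝ E]
    [FiniteDimensional ℝ E] {A : Set E} (hA : Convex ℝ A) (hne : A.Nonempty) (h0 : (0 : E) ∉ A) :
    ∃ F : E →ₗ[ℝ] ℝ, F ≠ 0 ∧ ∀ y ∈ A, 0 ≤ F y := by
  by_cases hint : (interior A).Nonempty
  · obtain ⟨F, hF, hle⟩ := geometric_hahn_banach_of_nonempty_interior_point hA
      (fun h => h0 (interior_subset h)) hint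
    refine ⟨-(F : E →ₗ[ℝ] ℝ), fun h => hF ?_, fun y hy => ?_⟩
    · ext y
      have := LinearMap.congr_fun h y
      simpa using this
    · have := hle y hy
      simpa using this
  · rw [hA.interior_nonempty_iff_affineSpan_eq_top] at hint
    obtain ⟨y0, hy0⟩ := hne
    have hd : (affineSpan ℝ A).direction < ⊤ := by
      rw [lt_top_iff_ne_top]
      intro h
      exact hint ((AffineSubspace.direction_eq_top_iff_of_nonempty
        ⟨y0, subset_affineSpan ℝ A hy0⟩).1 h)
    obtain ⟨F, hF, hker⟩ := Submodule.exists_le_ker_of_lt_top _ hd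
    have hc : ∀ y ∈ A, F y = F y0 := fun y hy => by
      have : y -ᵥ y0 ∈ (affineSpan ℝ A).direction :=
        AffineSubspace.vsub_mem_direction (subset_affineSpan ℝ A hy) (subset_affineSpan ℝ A hy0)
      have := hker this
      rw [LinearMap.mem_ker, vsub_eq_sub, map_sub] at this
      linarith
    rcases le_total 0 (F y0) with h | h
    · exact ⟨F, hF, fun y hy => by rw [hc y hy]; exact h⟩
    · exact ⟨-F, neg_ne_zero.2 hF, fun y hy => by
        rw [LinearMap.neg_apply, hc y hy]; linarith⟩

end Separation

section MomentModel

variable {U : Type*} [MeasurableSpace U] {φ : ℝ → ℝ} {Q : Measure U} {ι : Type*}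

/-- Moment constraints `∫ f G i ≤ b i`, with equality off the index set `I`. -/
def Con (Q : Measure U) (I : ι → Prop) (G : ι → U → ℝ) (b : ι → ℝ) (f : U → ℝ) : Prop :=
  ∀ i, ∫ u, f u * G i u ∂Q ≤ b i ∧ (¬ I i → ∫ u, f u * G i u ∂Q = b i)

/-- Multipliers that are nonnegative on the inequality constraints. -/
def MulNonneg (I : ι → Prop) (l : ι → ℝ) : Prop := ∀ i, I i → 0 ≤ l i

/-- Values of objective, divergence and moments, up to relaxation through `R` in the first two
coordinates and through the constraint cone in the others. -/
def relaxSet (φ : ℝ → ℝ) (Q : Measure U) (I : ι → Prop) (k : U → ℝ) (G : ι → U → ℝ) (b : ι → ℝ)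
    (m δ : ℝ) (R : ℝ → ℝ → Prop) : Set (ℝ × ℝ × (ι → ℝ)) :=
  {z | ∃ f, Adm φ Q f ∧ R (∫ u, f u * k u ∂Q - m) z.1 ∧ R (∫ u, φ (f u) ∂Q - δ) z.2.1 ∧
    ∀ i, ∫ u, f u * G i u ∂Q - b i ≤ z.2.2 i ∧ (¬ I i → ∫ u, f u * G i u ∂Q - b i = z.2.2 i)}

/-- Relations between strict and weak order, stable under convex combinations. -/
structure RelaxRel (R : ℝ → ℝ → Prop) : Prop where
  of_lt : ∀ {x y}, x < y → R x y
  of_le_left : ∀ {x y z}, x ≤ y → R y z → R x z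
  comb : ∀ {x y x' y' s t : ℝ}, 0 ≤ s → 0 ≤ t → s + t = 1 → R x y → R x' y' →
    R (s * x + t * x') (s * y + t * y')

theorem relaxRel_le : RelaxRel (· ≤ ·) where
  of_lt := fun h => h.le
  of_le_left := le_trans
  comb := fun hs ht _ h h' =>
    add_le_add (mul_le_mul_of_nonneg_left h hs) (mul_le_mul_of_nonneg_left h' ht)

theorem relaxRel_lt : RelaxRel (· < ·) where
  of_lt := fun h => h
  of_le_left := lt_of_le_of_lt
  comb := fun {x y x' y' s t} hs ht hst h h' => by
    rcases hs.eq_or_lt with rfl | hs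
    · obtain rfl : t = 1 := by linarith
      simpa using h'
    · exact add_lt_add_of_lt_of_le (mul_lt_mul_of_pos_left h hs)
        (mul_le_mul_of_nonneg_left h'.le ht)

variable {I : ι → Prop} {k : U → ℝ} {G : ι → U → ℝ} {b : ι → ℝ} {m δ : ℝ}

theorem relaxSet_convex (h : PhiOne φ) (hk : OHeart φ Q k) (hG : ∀ i, OHeart φ Q (G i))
    {R : ℝ → ℝ → Prop} (hR : RelaxRel R) : Convex ℝ (relaxSet φ Q I k G b m δ R) := by
  rintro z ⟨f, hf, h1, h2, h3⟩ z' ⟨f', hf', h1', h2', h3'⟩ s t hs ht hst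
  have hst' : ∀ x : ℝ, x = s * x + t * x := fun x => by rw [← add_mul, hst, one_mul]
  refine ⟨_, hf.convexComb h hf' hs ht hst, ?_, ?_, fun i => ?_⟩
  · rw [hf.integral_convexComb_mul h hf' hk]
    have := hR.comb hs ht hst h1 h1'
    refine hR.of_le_left (le_of_eq ?_) this
    have := hst' m
    linarith
  · have := hR.comb hs ht hst h2 h2'
    refine hR.of_le_left ?_ this
    have h4 := hf.integral_convexComb_le h hf' hs ht hst
    have := hst' δ
    linarith
  · rw [hf.integral_convexComb_mul h hf' (hG i)]
    have hb := hst' (b i)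
    have e : s * ∫ u, f u * G i u ∂Q + t * ∫ u, f' u * G i u ∂Q - b i =
      s * (∫ u, f u * G i u ∂Q - b i) + t * (∫ u, f' u * G i u ∂Q - b i) := by linarith
    rw [e]
    refine ⟨relaxRel_le.comb hs ht hst (h3 i).1 (h3' i).1, fun hi => ?_⟩
    rw [(h3 i).2 hi, (h3' i).2 hi]
    rfl

variable [Fintype ι]

/-- Weighted Lagrangian of the moment problem. -/
def lagr (φ : ℝ → ℝ) (Q : Measure U) (k : U → ℝ) (G : ι → U → ℝ) (b : ι → ℝ) (m δ a η : ℝ)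
    (l : ι → ℝ) (f : U → ℝ) : ℝ :=
  a * (∫ u, f u * k u ∂Q - m) + η * (∫ u, φ (f u) ∂Q - δ) + ∑ i, l i * (∫ u, f u * G i u ∂Q - b i)

/-- Dual objective at `η > 0`. -/
def dVal (φ : ℝ → ℝ) (Q : Measure U) (k : U → ℝ) (G : ι → U → ℝ) (b : ι → ℝ) (δ η : ℝ)
    (l : ι → ℝ) : ℝ :=
  -(η * ∫ u, pStar φ ((-k u - ∑ i, l i * G i u) / η) ∂Q) - η * δ - ∑ i, l i * b i

/-- No nonzero multiplier supports the moments of admissible densities at `b`. -/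
def Nondegenerate (φ : ℝ → ℝ) (Q : Measure U) (I : ι → Prop) (G : ι → U → ℝ) (b : ι → ℝ) : Prop :=
  ∀ l, MulNonneg I l → (∀ f, Adm φ Q f → 0 ≤ ∑ i, l i * (∫ u, f u * G i u ∂Q - b i)) → l = 0

theorem Con.sum_nonpos {I : ι → Prop} {G : ι → U → ℝ} {b : ι → ℝ} {f : U → ℝ}
    (hf : Con Q I G b f) {l : ι → ℝ} (hl : MulNonneg I l) :
    ∑ i, l i * (∫ u, f u * G i u ∂Q - b i) ≤ 0 := by
  refine Finset.sum_nonpos fun i _ => ?_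
  by_cases hi : I i
  · exact mul_nonpos_of_nonneg_of_nonpos (hl i hi) (sub_nonpos.2 (hf i).1)
  · rw [(hf i).2 hi, sub_self, mul_zero]

theorem linear_apply_prod (F : ℝ × ℝ × (ι → ℝ) →ₗ[ℝ] ℝ) (x y : ℝ) (w : ι → ℝ) :
    F (x, y, w) = F (1, 0, 0) * x + F (0, 1, 0) * y + ∑ i, F (0, 0, Pi.single i 1) * w i := by
  have e : (x, y, w) = x • ((1 : ℝ), (0 : ℝ), (0 : ι → ℝ)) + y • ((0 : ℝ), (1 : ℝ), (0 : ι → ℝ)) +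
      ∑ i, w i • ((0 : ℝ), (0 : ℝ), (Pi.single i 1 : ι → ℝ)) := by
    refine Prod.ext ?_ (Prod.ext ?_ ?_)
    · simp [Prod.fst_sum]
    · simp [Prod.fst_sum, Prod.snd_sum]
    · ext j
      simp [Prod.snd_sum, Finset.sum_apply, Pi.single_apply]
  rw [e, map_add, map_add, map_sum]
  simp only [map_smul, smul_eq_mul, mul_comm]

theorem exists_multipliers_of_functional [IsProbabilityMeasure Q] {R : ℝ → ℝ → Prop}
    (hR : RelaxRel R) (F : ℝ × ℝ × (ι → ℝ) →ₗ[ℝ] ℝ) {v : ℝ}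
    (hF : ∀ z ∈ relaxSet φ Q I k G b m δ R, v ≤ F z) :
    0 ≤ F (1, 0, 0) ∧ 0 ≤ F (0, 1, 0) ∧ MulNonneg I (fun i => F (0, 0, Pi.single i 1)) ∧
      ∀ f, Adm φ Q f → v ≤ lagr φ Q k G b m δ (F (1, 0, 0)) (F (0, 1, 0))
        (fun i => F (0, 0, Pi.single i 1)) f := by
  have key : ∀ f, Adm φ Q f → ∀ x y : ℝ, 0 < x → 0 < y → ∀ w : ι → ℝ, (∀ i, 0 ≤ w i) →
      (∀ i, ¬ I i → w i = 0) →
      v ≤ lagr φ Q k G b m δ (F (1, 0, 0)) (F (0, 1, 0)) (fun i => F (0, 0, Pi.single i 1)) f +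
        (F (1, 0, 0) * x + F (0, 1, 0) * y + ∑ i, F (0, 0, Pi.single i 1) * w i) := by
    intro f hf x y hx hy w hw hw'
    have h1 := hF (∫ u, f u * k u ∂Q - m + x, ∫ u, φ (f u) ∂Q - δ + y,
      fun i => ∫ u, f u * G i u ∂Q - b i + w i) ⟨f, hf, hR.of_lt (by simpa using hx),
        hR.of_lt (by simpa using hy), fun i => ⟨by simpa using hw i, fun hi => by
          simp [hw' i hi]⟩⟩
    rw [linear_apply_prod] at h1
    refine h1.trans (le_of_eq ?_)
    simp only [lagr, mul_add, Finset.sum_add_distrib]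
    ring
  have scale : ∀ (s p : ℝ), (∀ t : ℝ, 1 ≤ t → v ≤ p + s * t) → 0 ≤ s := by
    intro s p hs
    by_contra! hneg
    have h1 := hs (max 1 ((v - p - 1) / s)) (le_max_left _ _)
    have h2 : s * max 1 ((v - p - 1) / s) ≤ s * ((v - p - 1) / s) :=
      mul_le_mul_of_nonpos_left (le_max_right _ _) hneg.le
    rw [mul_div_cancel₀ _ hneg.ne] at h2
    linarith
  have h1 : Adm φ Q fun _ => (1:ℝ) := Adm.const zero_le_one
  refine ⟨?_, ?_, ?_, ?_⟩
  · refine scale _ (lagr φ Q k G b m δ (F (1, 0, 0)) (F (0, 1, 0))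
      (fun i => F (0, 0, Pi.single i 1)) (fun _ => 1) + F (0, 1, 0)) fun t ht => ?_
    have := key _ h1 t 1 (by linarith) one_pos 0 (by simp) (by simp)
    simp only [Pi.zero_apply, mul_zero, Finset.sum_const_zero] at this
    linarith
  · refine scale _ (lagr φ Q k G b m δ (F (1, 0, 0)) (F (0, 1, 0))
      (fun i => F (0, 0, Pi.single i 1)) (fun _ => 1) + F (1, 0, 0)) fun t ht => ?_
    have := key _ h1 1 t one_pos (by linarith) 0 (by simp) (by simp)
    simp only [Pi.zero_apply, mul_zero, Finset.sum_const_zero] at this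
    linarith
  · intro j hj
    refine scale _ (lagr φ Q k G b m δ (F (1, 0, 0)) (F (0, 1, 0))
      (fun i => F (0, 0, Pi.single i 1)) (fun _ => 1) + F (1, 0, 0) + F (0, 1, 0)) fun t ht => ?_
    have := key _ h1 1 1 one_pos one_pos (Pi.single j t)
      (fun i => by
        by_cases hij : i = j
        · subst hij; simp; linarith
        · simp [hij])
      (fun i hi => by
        have : i ≠ j := fun h => hi (h ▸ hj)
        simp [this])
    simp only [Pi.single_apply, mul_ite, mul_zero, Finset.sum_ite_eq', Finset.mem_univ,
      if_true] at this
    show v ≤ _ + F (0, 0, Pi.single j 1) * t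
    linarith
  · intro f hf
    refine le_of_forall_pos_le_add fun ε hε => ?_
    set s := F (1, 0, 0) + F (0, 1, 0) with hs
    have h2 := key f hf (ε / (|s| + 1)) (ε / (|s| + 1)) (by positivity) (by positivity) 0
      (by simp) (by simp)
    simp only [Pi.zero_apply, mul_zero, Finset.sum_const_zero, add_zero] at h2
    refine h2.trans (add_le_add le_rfl ?_)
    rw [← add_mul, ← hs, mul_div_assoc', div_le_iff₀ (by positivity)]
    nlinarith [le_abs_self s]

/-- If the strict problem is infeasible, there are normalized supporting multipliers. -/
theorem exists_multipliers [IsProbabilityMeasure Q] (h : PhiOne φ) (hk : OHeart φ Q k)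
    (hG : ∀ i, OHeart φ Q (G i))
    (hno : ¬ ∃ f, Adm φ Q f ∧ ∫ u, f u * k u ∂Q < m ∧ ∫ u, φ (f u) ∂Q < δ ∧ Con Q I G b f) :
    ∃ L : ℝ × ℝ × (ι → ℝ), ‖L‖ = 1 ∧ 0 ≤ L.1 ∧ 0 ≤ L.2.1 ∧ MulNonneg I L.2.2 ∧
      ∀ f, Adm φ Q f → 0 ≤ lagr φ Q k G b m δ L.1 L.2.1 L.2.2 f := by
  have h0 : (0 : ℝ × ℝ × (ι → ℝ)) ∉ relaxSet φ Q I k G b m δ (· < ·) := by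
    rintro ⟨f, hf, h1, h2, h3⟩
    refine hno ⟨f, hf, sub_neg.1 h1, sub_neg.1 h2, fun i => ⟨sub_nonpos.1 (h3 i).1, fun hi =>
      sub_eq_zero.1 ((h3 i).2 hi)⟩⟩
  have hne : (relaxSet φ Q I k G b m δ (· < ·)).Nonempty :=
    ⟨(∫ u, 1 * k u ∂Q - m + 1, ∫ _, φ 1 ∂Q - δ + 1, fun i => ∫ u, 1 * G i u ∂Q - b i),
      fun _ => 1, Adm.const zero_le_one, by simp, by simp, fun i => ⟨le_rfl, fun _ => rfl⟩⟩
  obtain ⟨F, hF, hFz⟩ := exists_nonneg_functional (relaxSet_convex h hk hG relaxRel_lt) hne h0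
  obtain ⟨ha, hη, hl, hf⟩ := exists_multipliers_of_functional relaxRel_lt F hFz
  set L : ℝ × ℝ × (ι → ℝ) := (F (1, 0, 0), F (0, 1, 0), fun i => F (0, 0, Pi.single i 1)) with hL
  have hL0 : L ≠ 0 := by
    intro hz
    apply hF
    refine LinearMap.ext fun z => ?_
    obtain ⟨x, y, w⟩ := z
    rw [linear_apply_prod]
    have e1 : F (1, 0, 0) = 0 := congrArg Prod.fst hz
    have e2 : F (0, 1, 0) = 0 := congrArg (fun z => z.2.1) hz
    have e3 : ∀ i, F (0, 0, Pi.single i 1) = 0 := fun i => congrFun (congrArg (fun z => z.2.2) hz) i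
    simp [e1, e2, e3]
  have hn : 0 < ‖L‖⁻¹ := inv_pos.2 (norm_pos_iff.2 hL0)
  refine ⟨‖L‖⁻¹ • L, ?_, mul_nonneg hn.le ha, mul_nonneg hn.le hη, fun i hi =>
    mul_nonneg hn.le (hl i hi), fun f hfA => ?_⟩
  · rw [norm_smul, norm_inv, norm_norm, inv_mul_cancel₀ (norm_ne_zero_iff.2 hL0)]
  · have := mul_nonneg hn.le (hf f hfA)
    refine this.trans (le_of_eq ?_)
    simp only [lagr, hL, Prod.smul_mk, smul_eq_mul, Pi.smul_apply, mul_add, Finset.mul_sum,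
      mul_assoc]

/-- Either the problem is approximately feasible, or it is strictly separated. -/
theorem exists_multipliers_of_not_approx [IsProbabilityMeasure Q] (h : PhiOne φ)
    (hk : OHeart φ Q k) (hG : ∀ i, OHeart φ Q (G i)) {ε : ℝ} (hε : 0 < ε)
    (hno : ¬ ∃ f, Adm φ Q f ∧ ∫ u, f u * k u ∂Q < m + ε ∧ ∫ u, φ (f u) ∂Q < δ + ε ∧
      ∀ i, ∫ u, f u * G i u ∂Q < b i + ε ∧ (¬ I i → b i - ε < ∫ u, f u * G i u ∂Q)) :
    ∃ (a η : ℝ) (l : ι → ℝ) (v : ℝ), 0 < v ∧ 0 ≤ a ∧ 0 ≤ η ∧ MulNonneg I l ∧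
      ∀ f, Adm φ Q f → v ≤ lagr φ Q k G b m δ a η l f := by
  have h0 : (0 : ℝ × ℝ × (ι → ℝ)) ∉ closure (relaxSet φ Q I k G b m δ (· ≤ ·)) := by
    intro hmem
    obtain ⟨⟨x, y, w⟩, ⟨f, hf, h1, h2, h3⟩, hd⟩ := Metric.mem_closure_iff.1 hmem ε hε
    rw [dist_zero_left] at hd
    have hx : |x| < ε := (norm_fst_le (x, y, w)).trans_lt hd
    have hyw := (norm_snd_le (x, y, w)).trans_lt hd
    have hy : |y| < ε := (norm_fst_le (y, w)).trans_lt hyw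
    have hw : ∀ i, |w i| < ε := fun i =>
      (norm_le_pi_norm w i).trans_lt ((norm_snd_le (y, w)).trans_lt hyw)
    refine hno ⟨f, hf, ?_, ?_, fun i => ⟨?_, fun hi => ?_⟩⟩
    · have := (abs_lt.1 hx).2
      simp only at h1; linarith
    · have := (abs_lt.1 hy).2
      simp only at h2; linarith
    · have := (abs_lt.1 (hw i)).2
      have := (h3 i).1
      simp only at this; linarith
    · have := (abs_lt.1 (hw i)).1
      have := (h3 i).2 hi
      simp only at this; linarith
  obtain ⟨F, v, hv, hF⟩ := geometric_hahn_banach_point_closed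
    (relaxSet_convex h hk hG relaxRel_le).closure isClosed_closure h0
  rw [map_zero] at hv
  obtain ⟨ha, hη, hl, hf⟩ := exists_multipliers_of_functional relaxRel_le (F : _ →ₗ[ℝ] ℝ) (v := v)
    fun z hz => (hF z (subset_closure hz)).le
  exact ⟨_, _, _, v, hv, ha, hη, hl, hf⟩

theorem le_dVal [IsProbabilityMeasure Q] (h : PhiOne φ) (hk : OHeart φ Q k)
    (hG : ∀ i, OHeart φ Q (G i)) {η : ℝ} (hη : 0 < η) {l : ι → ℝ} {v : ℝ}
    (hv : ∀ f, Adm φ Q f → v ≤ lagr φ Q k G b 0 δ 1 η l f) : v ≤ dVal φ Q k G b δ η l := by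
  have hS : OHeart φ Q fun u => (1 / η) * (k u + ∑ i, l i * G i u) :=
    (hk.add h (OHeart.sum h _ fun i => (hG i).const_mul (l i))).const_mul _
  have := le_neg_integral_pStar h hS (v := (v + η * δ + ∑ i, l i * b i) / η) fun f hf => by
    have h1 := hv f hf
    have e : ∫ u, f u * ((1 / η) * (k u + ∑ i, l i * G i u)) ∂Q =
        (1 / η) * (∫ u, f u * k u ∂Q + ∑ i, l i * ∫ u, f u * G i u ∂Q) := by
      simp_rw [← integral_const_mul]
      rw [← integral_finsetSum _ fun i _ => (hf.integrable_mul h (hG i)).const_mul (l i),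
        ← integral_add (hf.integrable_mul h hk) (integrable_finsetSum _ fun i _ =>
          (hf.integrable_mul h (hG i)).const_mul (l i)), ← integral_const_mul]
      refine integral_congr_ae (ae_of_all _ fun u => ?_)
      simp only [mul_add, Finset.mul_sum]
      congr 1
      · ring
      · exact Finset.sum_congr rfl fun i _ => by ring
    rw [e, div_le_iff₀ hη]
    simp only [lagr, mul_sub, Finset.sum_sub_distrib] at h1
    field_simp
    linarith
  have e2 : ∀ u, -((1 / η) * (k u + ∑ i, l i * G i u)) = (-k u - ∑ i, l i * G i u) / η := fun u => by
    field_simp; ring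
  simp only [e2] at this
  rw [div_le_iff₀ hη] at this
  unfold dVal
  linarith

theorem dVal_le [IsProbabilityMeasure Q] (h : PhiOne φ) (hk : OHeart φ Q k)
    (hG : ∀ i, OHeart φ Q (G i)) {η : ℝ} (hη : 0 < η) (l : ι → ℝ) {f : U → ℝ} (hf : Adm φ Q f) :
    dVal φ Q k G b δ η l ≤ lagr φ Q k G b 0 δ 1 η l f := by
  have hS : OHeart φ Q fun u => (1 / η) * (-k u - ∑ i, l i * G i u) :=
    (hk.neg.sub h (OHeart.sum h _ fun i => (hG i).const_mul (l i))).const_mul _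
  have e : ∫ u, f u * ((1 / η) * (-k u - ∑ i, l i * G i u)) ∂Q =
      (1 / η) * (-(∫ u, f u * k u ∂Q) - ∑ i, l i * ∫ u, f u * G i u ∂Q) := by
    simp_rw [← integral_const_mul]
    have hneg : Integrable (fun u => -(f u * k u)) Q := (hf.integrable_mul h hk).neg
    rw [← integral_finsetSum _ fun i _ => (hf.integrable_mul h (hG i)).const_mul (l i),
      ← integral_neg, ← integral_sub hneg (integrable_finsetSum _ fun i _ =>
        (hf.integrable_mul h (hG i)).const_mul (l i)), ← integral_const_mul]
    refine integral_congr_ae (ae_of_all _ fun u => ?_)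
    simp only [mul_sub, Finset.mul_sum]
    congr 1
    · ring
    · exact Finset.sum_congr rfl fun i _ => by ring
  have hle : ∫ u, f u * ((1 / η) * (-k u - ∑ i, l i * G i u)) ∂Q - ∫ u, φ (f u) ∂Q ≤
      ∫ u, pStar φ ((1 / η) * (-k u - ∑ i, l i * G i u)) ∂Q := by
    rw [← integral_sub (hf.integrable_mul h hS) hf.2.2]
    exact integral_mono ((hf.integrable_mul h hS).sub hf.2.2) (hS.integrable_pStar h)
      fun u => h.young (hf.2.1 u) _
  rw [e] at hle
  have e2 : ∀ u, (1 / η) * (-k u - ∑ i, l i * G i u) = (-k u - ∑ i, l i * G i u) / η := fun u => by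
    ring
  simp only [e2] at hle
  have := mul_le_mul_of_nonneg_left hle hη.le
  rw [mul_sub, ← mul_assoc, mul_one_div_cancel hη.ne', one_mul] at this
  simp only [dVal, lagr, mul_sub, Finset.sum_sub_distrib]
  linarith

end MomentModel

section Duality

variable {U : Type*} [MeasurableSpace U] {φ : ℝ → ℝ} {Q : Measure U} {ι : Type*}
  {I : ι → Prop} {k : U → ℝ} {G : ι → U → ℝ} {b : ι → ℝ} {m δ : ℝ}

theorem MulNonneg.smul {l : ι → ℝ} (hl : MulNonneg I l) {c : ℝ} (hc : 0 ≤ c) :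
    MulNonneg I fun i => c * l i := fun i hi => mul_nonneg hc (hl i hi)

variable [Fintype ι]

theorem lagr_mul (c a η : ℝ) (l : ι → ℝ) (f : U → ℝ) :
    lagr φ Q k G b m δ (c * a) (c * η) (fun i => c * l i) f = c * lagr φ Q k G b m δ a η l f := by
  simp only [lagr, mul_add, Finset.mul_sum, mul_assoc]

/-- Nondegenerate problems without a strictly feasible density have a large minimal divergence. -/
theorem Nondegenerate.exists_le_dVal [IsProbabilityMeasure Q] (h : PhiOne φ)
    (hG : ∀ i, OHeart φ Q (G i)) (hnd : Nondegenerate φ Q I G b)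
    (hno : ¬ ∃ f, Adm φ Q f ∧ ∫ u, φ (f u) ∂Q < δ ∧ Con Q I G b f) :
    ∃ l, MulNonneg I l ∧ δ ≤ dVal φ Q (fun _ => 0) G b 0 1 l := by
  obtain ⟨⟨a, η, l⟩, hn, ha, hη, hl, hf⟩ := exists_multipliers (m := 1) (δ := δ) (I := I) (b := b)
    h (OHeart.const (φ := φ) (Q := Q) 0) hG fun ⟨f, h1, _, h3⟩ => hno ⟨f, h1, h3⟩
  simp only at ha hη hl hf
  rcases hη.eq_or_lt with rfl | hη
  · exfalso
    have hl0 : l = 0 := hnd l hl fun f hfA => by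
      have := hf f hfA
      simp only [lagr, mul_zero, integral_zero, zero_mul] at this
      linarith
    subst hl0
    have := hf _ (Adm.const zero_le_one)
    simp only [lagr, mul_zero, integral_zero, zero_mul, Pi.zero_apply,
      Finset.sum_const_zero] at this
    obtain rfl : a = 0 := by linarith
    have h0 : ((0 : ℝ), (0 : ℝ), (0 : ι → ℝ)) = 0 := rfl
    rw [h0, norm_zero] at hn
    exact zero_ne_one hn
  · refine ⟨fun i => η⁻¹ * l i, hl.smul (inv_nonneg.2 hη.le), ?_⟩
    refine le_dVal h (OHeart.const 0) hG one_pos fun f hfA => ?_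
    have h1 := mul_nonneg (inv_nonneg.2 hη.le) (hf f hfA)
    rw [← lagr_mul, inv_mul_cancel₀ hη.ne'] at h1
    have h2 : 0 ≤ η⁻¹ * a := mul_nonneg (inv_nonneg.2 hη.le) ha
    simp only [lagr, mul_zero, integral_zero] at h1 ⊢
    linarith

/-- Strong duality under nondegeneracy and strict feasibility. -/
theorem Nondegenerate.exists_lt_dVal [IsProbabilityMeasure Q] (h : PhiOne φ) (hk : OHeart φ Q k)
    (hG : ∀ i, OHeart φ Q (G i)) (hnd : Nondegenerate φ Q I G b) {f0 : U → ℝ} (h0 : Adm φ Q f0)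
    (h0δ : ∫ u, φ (f0 u) ∂Q < δ) (h0c : Con Q I G b f0) {m' : ℝ} (hm : m < m')
    (hle : ∀ f, Adm φ Q f → ∫ u, φ (f u) ∂Q < δ → Con Q I G b f → m' ≤ ∫ u, f u * k u ∂Q) :
    ∃ η l, 0 < η ∧ MulNonneg I l ∧ m < dVal φ Q k G b δ η l := by
  have hδ : 0 < δ := (h0.integral_nonneg h).trans_lt h0δ
  obtain ⟨⟨a, η, l⟩, hn, ha, hη, hl, hf⟩ := exists_multipliers (m := m') (δ := δ) (I := I) (b := b)
    h hk hG fun ⟨f, h1, h2, h3, h4⟩ => absurd (hle f h1 h3 h4) (not_le.2 h2)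
  simp only at ha hη hl hf
  rcases ha.eq_or_lt with rfl | ha
  · exfalso
    have h1 := hf f0 h0
    simp only [lagr, zero_mul] at h1
    have h2 := h0c.sum_nonpos hl
    have h3 : η = 0 := by nlinarith
    subst h3
    have hl0 : l = 0 := hnd l hl fun f hfA => by
      have := hf f hfA
      simp only [lagr, zero_mul] at this
      linarith
    subst hl0
    have h0 : ((0 : ℝ), (0 : ℝ), (0 : ι → ℝ)) = 0 := rfl
    rw [h0, norm_zero] at hn
    exact zero_ne_one hn
  · set ε := (m' - m) / (2 * δ) with hε
    have hε0 : 0 < ε := div_pos (sub_pos.2 hm) (by positivity)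
    have hεδ : ε * δ = (m' - m) / 2 := by rw [hε]; field_simp
    refine ⟨a⁻¹ * η + ε, fun i => a⁻¹ * l i, by positivity, hl.smul (inv_nonneg.2 ha.le), ?_⟩
    refine lt_of_lt_of_le (b := m' - ε * δ) (by linarith)
      (le_dVal h hk hG (by positivity) fun f hfA => ?_)
    have h1 := mul_nonneg (inv_nonneg.2 ha.le) (hf f hfA)
    rw [← lagr_mul, inv_mul_cancel₀ ha.ne'] at h1
    have h2 := mul_nonneg hε0.le (hfA.integral_nonneg h)
    simp only [lagr] at h1 ⊢
    linarith

/-- If the dual values do not exceed `m` and `δ`, the primal is approximately feasible. -/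
theorem exists_approx [IsProbabilityMeasure Q] (h : PhiOne φ) (hk : OHeart φ Q k)
    (hG : ∀ i, OHeart φ Q (G i)) (hδ : 0 < δ)
    (h1 : ∀ η l, 0 < η → MulNonneg I l → dVal φ Q k G b δ η l ≤ m)
    (h2 : ∀ l, MulNonneg I l → dVal φ Q (fun _ => 0) G b 0 1 l ≤ δ) {ε : ℝ} (hε : 0 < ε) :
    ∃ f, Adm φ Q f ∧ ∫ u, f u * k u ∂Q < m + ε ∧ ∫ u, φ (f u) ∂Q < δ + ε ∧
      ∀ i, ∫ u, f u * G i u ∂Q < b i + ε ∧ (¬ I i → b i - ε < ∫ u, f u * G i u ∂Q) := by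
  by_contra hno
  obtain ⟨a, η, l, v, hv, ha, hη, hl, hf⟩ := exists_multipliers_of_not_approx h hk hG hε hno
  rcases ha.eq_or_lt with rfl | ha
  · rcases hη.eq_or_lt with rfl | hη
    · refine absurd (h2 (fun i => (δ + 1) / v * l i) (hl.smul (by positivity)))
        (not_le.2 (lt_of_lt_of_le (b := δ + 1) (by linarith) (le_dVal h (OHeart.const 0) hG one_pos
          fun f hfA => ?_)))
      have h3 := mul_le_mul_of_nonneg_left (hf f hfA) (by positivity : 0 ≤ (δ + 1) / v)
      rw [← lagr_mul, div_mul_cancel₀ _ hv.ne'] at h3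
      have := hfA.integral_nonneg h
      simp only [lagr, mul_zero, integral_zero, zero_mul] at h3 ⊢
      linarith
    · refine absurd (h2 (fun i => η⁻¹ * l i) (hl.smul (by positivity)))
        (not_le.2 (lt_of_lt_of_le (b := δ + η⁻¹ * v) (by linarith [mul_pos (inv_pos.2 hη) hv])
          (le_dVal h (OHeart.const 0) hG one_pos fun f hfA => ?_)))
      have h3 := mul_le_mul_of_nonneg_left (hf f hfA) (inv_nonneg.2 hη.le)
      rw [← lagr_mul, inv_mul_cancel₀ hη.ne'] at h3
      simp only [lagr, mul_zero, integral_zero, zero_mul] at h3 ⊢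
      linarith
  · set e := a⁻¹ * v / (2 * δ) with he
    have he0 : 0 < e := by positivity
    have heδ : e * δ = a⁻¹ * v / 2 := by rw [he]; field_simp
    have hav : 0 < a⁻¹ * v := by positivity
    refine absurd (h1 (a⁻¹ * η + e) (fun i => a⁻¹ * l i) (by positivity) (hl.smul (by positivity)))
      (not_le.2 (lt_of_lt_of_le (b := m + a⁻¹ * v - e * δ) (by linarith)
        (le_dVal h hk hG (by positivity) fun f hfA => ?_)))
    have h3 := mul_le_mul_of_nonneg_left (hf f hfA) (inv_nonneg.2 ha.le)
    rw [← lagr_mul, inv_mul_cancel₀ ha.ne'] at h3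
    have h4 := mul_nonneg he0.le (hfA.integral_nonneg h)
    simp only [lagr] at h3 ⊢
    linarith

/-- Strict feasibility is stable under perturbations of nondegenerate problems. -/
theorem Nondegenerate.eventually_exists [IsProbabilityMeasure Q] (h : PhiOne φ) {α : Type*}
    {F : Filter α} [F.IsCountablyGenerated] {kk : α → U → ℝ} {GG : α → ι → U → ℝ} {bb : α → ι → ℝ}
    (hnd : Nondegenerate φ Q I G b)
    (hkk : ∀ a, OHeart φ Q (kk a)) (hGG : ∀ a i, OHeart φ Q (GG a i))
    (hklim : ∀ f, Adm φ Q f → Tendsto (fun a => ∫ u, f u * kk a u ∂Q) F (nhds (∫ u, f u * k u ∂Q)))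
    (hGlim : ∀ f, Adm φ Q f → ∀ i,
      Tendsto (fun a => ∫ u, f u * GG a i u ∂Q) F (nhds (∫ u, f u * G i u ∂Q)))
    (hblim : ∀ i, Tendsto (fun a => bb a i) F (nhds (b i)))
    {f0 : U → ℝ} (h0 : Adm φ Q f0) (h0m : ∫ u, f0 u * k u ∂Q < m) (h0δ : ∫ u, φ (f0 u) ∂Q < δ)
    (h0c : Con Q I G b f0) :
    ∀ᶠ a in F, ∃ f, Adm φ Q f ∧ ∫ u, f u * kk a u ∂Q < m ∧ ∫ u, φ (f u) ∂Q < δ ∧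
      Con Q I (GG a) (bb a) f := by
  by_contra hno
  obtain ⟨x, hx, hxn⟩ := exists_seq_forall_of_frequently (not_eventually.1 hno)
  choose L hn ha hη hl hf using fun n => exists_multipliers (m := m) (δ := δ) (I := I)
    (b := bb (x n)) h (hkk (x n)) (hGG (x n)) (hxn n)
  obtain ⟨M, hM, σ, hσ, hlim⟩ := (isCompact_sphere (0 : ℝ × ℝ × (ι → ℝ)) 1).tendsto_subseq
    (x := L) fun n => mem_sphere_zero_iff_norm.2 (hn n)
  have l1 : Tendsto (fun n => (L (σ n)).1) atTop (nhds M.1) := (continuous_fst.tendsto M).comp hlim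
  have l2 : Tendsto (fun n => (L (σ n)).2.1) atTop (nhds M.2.1) :=
    ((continuous_fst.comp continuous_snd).tendsto M).comp hlim
  have l3 : ∀ i, Tendsto (fun n => (L (σ n)).2.2 i) atTop (nhds (M.2.2 i)) := fun i =>
    (((continuous_apply i).comp (continuous_snd.comp continuous_snd)).tendsto M).comp hlim
  have hxσ := hx.comp hσ.tendsto_atTop
  have key : ∀ f, Adm φ Q f → 0 ≤ lagr φ Q k G b m δ M.1 M.2.1 M.2.2 f := fun f hfA => by
    refine ge_of_tendsto' (x := atTop) (f := fun n => lagr φ Q (kk (x (σ n))) (GG (x (σ n))) (bb (x (σ n))) m δ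
      (L (σ n)).1 (L (σ n)).2.1 (L (σ n)).2.2 f) ?_ fun n => hf (σ n) f hfA
    refine ((l1.mul (((hklim f hfA).comp hxσ).sub_const m)).add (l2.mul_const _)).add
      (tendsto_finsetSum _ fun i _ => (l3 i).mul (((hGlim f hfA i).comp hxσ).sub
        ((hblim i).comp hxσ)))
  have k1 : 0 ≤ M.1 := ge_of_tendsto' l1 fun n => ha _
  have k2 : 0 ≤ M.2.1 := ge_of_tendsto' l2 fun n => hη _
  have k3 : MulNonneg I M.2.2 := fun i hi => ge_of_tendsto' (l3 i) fun n => hl _ i hi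
  have h4 := key f0 h0
  have h5 := h0c.sum_nonpos k3
  have h6 : M.1 * (∫ u, f0 u * k u ∂Q - m) ≤ 0 :=
    mul_nonpos_of_nonneg_of_nonpos k1 (sub_neg.2 h0m).le
  have h7 : M.2.1 * (∫ u, φ (f0 u) ∂Q - δ) ≤ 0 :=
    mul_nonpos_of_nonneg_of_nonpos k2 (sub_neg.2 h0δ).le
  simp only [lagr] at h4
  have h8 : M.1 = 0 := (mul_eq_zero.1 (by linarith)).resolve_right (sub_neg.2 h0m).ne
  have h9 : M.2.1 = 0 := (mul_eq_zero.1 (by linarith)).resolve_right (sub_neg.2 h0δ).ne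
  have h10 : M.2.2 = 0 := hnd _ k3 fun f hfA => by
    have := key f hfA
    simp only [lagr, h8, h9, zero_mul] at this
    linarith
  have hz : M = 0 := Prod.ext h8 (Prod.ext h9 h10)
  rw [hz, mem_sphere_zero_iff_norm, norm_zero] at hM
  exact zero_ne_one hM

end Duality

section GapStability

variable {U : Type*} [MeasurableSpace U] {φ : ℝ → ℝ} {Q : Measure U}

theorem PhiOne.exists_le_mul (h : PhiOne φ) {ρ : ℝ} (hρ : 0 < ρ) :
    ∃ R : ℝ, ∀ x, R < x → 0 ≤ x → x ≤ ρ * φ x := by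
  obtain ⟨R, hR⟩ := (h.superlinear.eventually_ge_atTop ρ⁻¹).exists_forall_of_atTop
  refine ⟨max R 0, fun x hx _ => ?_⟩
  have hx0 : 0 < x := (le_max_right _ _).trans_lt hx
  have h1 := hR x ((le_max_left _ _).trans hx.le)
  rw [le_div_iff₀ hx0] at h1
  have h2 := mul_le_mul_of_nonneg_left h1 hρ.le
  rwa [← mul_assoc, mul_inv_cancel₀ hρ.ne', one_mul] at h2

theorem Adm.mid (h : PhiOne φ) {f g : U → ℝ} (hf : Adm φ Q f) (hg : Adm φ Q g) :
    Adm φ Q fun u => (f u + g u) / 2 := by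
  have := hf.convexComb h hg (a := 1 / 2) (b := 1 / 2) (by norm_num) (by norm_num) (by norm_num)
  convert this using 2
  ring

theorem Adm.integral_mid_mul (h : PhiOne φ) {f g k : U → ℝ} (hf : Adm φ Q f) (hg : Adm φ Q g)
    (hk : OHeart φ Q k) :
    ∫ u, (f u + g u) / 2 * k u ∂Q = (∫ u, f u * k u ∂Q + ∫ u, g u * k u ∂Q) / 2 := by
  have := hf.integral_convexComb_mul h hg hk (1 / 2) (1 / 2)
  have e : ∀ u, (f u + g u) / 2 * k u = (1 / 2 * f u + 1 / 2 * g u) * k u := fun u => by ring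
  simp only [e, this]
  ring

theorem Adm.integrable_gap (h : PhiOne φ) {f g : U → ℝ} (hf : Adm φ Q f) (hg : Adm φ Q g) :
    Integrable (fun u => gap φ (f u) (g u)) Q :=
  ((hf.2.2.add hg.2.2).div_const 2).sub (hf.mid h hg).2.2

theorem Adm.integral_gap (h : PhiOne φ) {f g : U → ℝ} (hf : Adm φ Q f) (hg : Adm φ Q g) :
    ∫ u, gap φ (f u) (g u) ∂Q =
      (∫ u, φ (f u) ∂Q + ∫ u, φ (g u) ∂Q) / 2 - ∫ u, φ ((f u + g u) / 2) ∂Q := by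
  have h1 : Integrable (fun u => (φ (f u) + φ (g u)) / 2) Q := (hf.2.2.add hg.2.2).div_const 2
  unfold gap
  rw [integral_sub h1 (hf.mid h hg).2.2, integral_div, integral_add hf.2.2 hg.2.2]

theorem PhiOne.abs_sub_mul_le (h : PhiOne φ) {c N ρ ε R C x y z : ℝ} (hc : 0 < c) (hN : 0 ≤ N)
    (hρ : 0 ≤ ρ) (hε : 0 ≤ ε) (hC : 0 ≤ C) (hR : ∀ x, R < x → 0 ≤ x → x ≤ ρ * φ x)
    (hCR : ∀ x y, 0 ≤ x → 0 ≤ y → x ≤ R → y ≤ R → |x - y| ≤ ε + C * gap φ x y)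
    (hx : 0 ≤ x) (hy : 0 ≤ y) :
    |x - y| * |z| ≤ 1 / c * (φ x + φ y) + 2 / c * (if N < pStar φ (c * |z|) then pStar φ (c * |z|)
      else 0) + N / c * (2 * ρ * (φ x + φ y) + (ε + C * gap φ x y)) := by
  have hφ : 0 ≤ φ x + φ y := add_nonneg (h.nonneg hx) (h.nonneg hy)
  have hg := h.gap_nonneg hx hy
  have hX := h.le_pStar (c * |z|)
  have hxy : |x - y| ≤ x + y := abs_sub_le_iff.2 ⟨by linarith, by linarith⟩
  have hA : 0 ≤ 1 / c * (φ x + φ y) := by positivity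
  have hD : 0 ≤ N / c * (2 * ρ * (φ x + φ y) + (ε + C * gap φ x y)) := by positivity
  split_ifs with hNX
  · have h1 := h.young hx (c * |z|)
    have h2 := h.young hy (c * |z|)
    have h3 : |x - y| * |z| ≤ 1 / c * (φ x + φ y) + 2 / c * pStar φ (c * |z|) := by
      have h4 : |x - y| * |z| ≤ (x + y) * |z| := mul_le_mul_of_nonneg_right hxy (abs_nonneg z)
      refine h4.trans ?_
      rw [div_mul_eq_mul_div, div_mul_eq_mul_div, ← add_div, le_div_iff₀ hc]
      linarith
    linarith
  · have hz : |z| ≤ N / c := by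
      rw [le_div_iff₀ hc]
      linarith
    have h5 : |x - y| ≤ 2 * ρ * (φ x + φ y) + (ε + C * gap φ x y) := by
      have hCg : 0 ≤ C * gap φ x y := by positivity
      have hρφ : 0 ≤ ρ * φ x := mul_nonneg hρ (h.nonneg hx)
      have hρφ' : 0 ≤ ρ * φ y := mul_nonneg hρ (h.nonneg hy)
      rcases le_or_gt x R with h6 | h6 <;> rcases le_or_gt y R with h7 | h7
      · have := hCR x y hx hy h6 h7
        nlinarith
      · have := hR y h7 hy
        linarith
      · have := hR x h6 hx
        linarith
      · have := hR x h6 hx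
        have := hR y h7 hy
        linarith
    have h8 : |x - y| * |z| ≤ (2 * ρ * (φ x + φ y) + (ε + C * gap φ x y)) * (N / c) :=
      mul_le_mul h5 hz (abs_nonneg z) ((abs_nonneg _).trans h5)
    linarith

/-- Vanishing midpoint convexity gaps force moments to merge. -/
theorem tendsto_sub_of_gap [IsProbabilityMeasure Q] (h : PhiOne φ) {k : U → ℝ} (hk : OHeart φ Q k)
    {f g : ℕ → U → ℝ} (hf : ∀ n, Adm φ Q (f n)) (hg : ∀ n, Adm φ Q (g n)) {B : ℝ}
    (hfB : ∀ n, ∫ u, φ (f n u) ∂Q ≤ B) (hgB : ∀ n, ∫ u, φ (g n u) ∂Q ≤ B)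
    (hgap : Tendsto (fun n => ∫ u, gap φ (f n u) (g n u) ∂Q) atTop (nhds 0)) :
    Tendsto (fun n => ∫ u, f n u * k u ∂Q - ∫ u, g n u * k u ∂Q) atTop (nhds 0) := by
  have hB : 0 ≤ B := ((hf 0).integral_nonneg h).trans (hfB 0)
  rw [Metric.tendsto_atTop]
  intro e he
  set c := 10 * (B + 1) / e with hc
  have hc0 : 0 < c := by positivity
  set X : U → ℝ := fun u => pStar φ (c * |k u|) with hX
  have hXi : Integrable X Q := hk.2 c hc0
  have hX0 : ∀ u, 0 ≤ X u := fun u =>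
    (mul_nonneg hc0.le (abs_nonneg _)).trans (h.le_pStar _)
  have hXm : Measurable X := h.measurable_pStar.comp (measurable_const.mul hk.1.abs)
  have hIm : ∀ N : ℝ, Measurable fun u => if N < X u then X u else 0 := fun N =>
    Measurable.ite (measurableSet_lt measurable_const hXm) hXm measurable_const
  have hIb : ∀ (N : ℝ) u, ‖if N < X u then X u else 0‖ ≤ X u := fun N u => by
    split_ifs
    · rw [Real.norm_of_nonneg (hX0 u)]
    · simpa using hX0 u
  have hIi : ∀ N : ℝ, Integrable (fun u => if N < X u then X u else 0) Q := fun N =>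
    hXi.mono' (hIm N).aestronglyMeasurable (ae_of_all _ (hIb N))
  have htail : Tendsto (fun N : ℕ => ∫ u, (if (N : ℝ) < X u then X u else 0) ∂Q) atTop
      (nhds (∫ _, (0 : ℝ) ∂Q)) := by
    refine tendsto_integral_of_dominated_convergence X
      (fun N => (hIm N).aestronglyMeasurable) hXi (fun N => ae_of_all _ (hIb N))
      (ae_of_all _ fun u => ?_)
    refine tendsto_const_nhds.congr' ?_
    obtain ⟨M, hM⟩ := exists_nat_ge (X u)
    filter_upwards [eventually_ge_atTop M] with N hN
    rw [if_neg (not_lt.2 (hM.trans (by exact_mod_cast hN)))]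
  rw [integral_zero] at htail
  obtain ⟨N, hN⟩ := (htail.eventually_lt_const (by positivity : (0:ℝ) < e * c / 10)).exists
  set ρ := e * c / (40 * (N + 1) * (B + 1)) with hρ
  have hρ0 : 0 < ρ := by positivity
  set ε := e * c / (10 * (N + 1)) with hε
  have hε0 : 0 < ε := by positivity
  obtain ⟨R, hR⟩ := h.exists_le_mul hρ0
  obtain ⟨C, hC, hCR⟩ := h.exists_gap_modulus R hε0
  have hgap' := hgap.const_mul C
  rw [mul_zero] at hgap'
  obtain ⟨n0, hn0⟩ := (hgap'.eventually_lt_const hε0).exists_forall_of_atTop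
  refine ⟨n0, fun n hn => ?_⟩
  have hgn := hn0 n hn
  rw [Real.dist_eq, sub_zero, ← integral_sub ((hf n).integrable_mul h hk)
    ((hg n).integrable_mul h hk)]
  have i1 : Integrable (fun u => φ (f n u) + φ (g n u)) Q := (hf n).2.2.add (hg n).2.2
  have i2 := (hf n).integrable_gap h (hg n)
  have i3 : Integrable (fun u => 1 / c * (φ (f n u) + φ (g n u)) +
      2 / c * (if (N : ℝ) < X u then X u else 0)) Q :=
    (i1.const_mul _).add ((hIi N).const_mul _)
  have i4 : Integrable (fun u => ε + C * gap φ (f n u) (g n u)) Q :=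
    (integrable_const ε).add (i2.const_mul C)
  have i5 : Integrable (fun u => 2 * ρ * (φ (f n u) + φ (g n u)) +
      (ε + C * gap φ (f n u) (g n u))) Q := (i1.const_mul _).add i4
  have hle : |∫ u, (f n u * k u - g n u * k u) ∂Q| ≤ ∫ u, (1 / c * (φ (f n u) + φ (g n u)) +
      2 / c * (if (N : ℝ) < X u then X u else 0) +
      N / c * (2 * ρ * (φ (f n u) + φ (g n u)) + (ε + C * gap φ (f n u) (g n u)))) ∂Q := by
    rw [← Real.norm_eq_abs]
    refine norm_integral_le_of_norm_le (i3.add (i5.const_mul _)) (ae_of_all _ fun u => ?_)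
    rw [← sub_mul, norm_mul, Real.norm_eq_abs, Real.norm_eq_abs]
    exact h.abs_sub_mul_le hc0 (Nat.cast_nonneg N) hρ0.le hε0.le hC hR hCR ((hf n).2.1 u)
      ((hg n).2.1 u)
  rw [integral_add i3 (i5.const_mul _), integral_add (i1.const_mul _) ((hIi N).const_mul _),
    integral_const_mul, integral_const_mul, integral_const_mul, integral_add (i1.const_mul _) i4,
    integral_const_mul, integral_add (integrable_const ε) (i2.const_mul C), integral_const_mul,
    integral_add (hf n).2.2 (hg n).2.2] at hle
  simp only [integral_const, probReal_univ, smul_eq_mul, one_mul] at hle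
  refine hle.trans_lt ?_
  have hs : ∫ u, φ (f n u) ∂Q + ∫ u, φ (g n u) ∂Q ≤ 2 * B := by linarith [hfB n, hgB n]
  set S := ∫ u, φ (f n u) ∂Q + ∫ u, φ (g n u) ∂Q with hSdef
  have hS2 : S ≤ 2 * (B + 1) := by linarith
  have t1 : 1 / c * S ≤ e / 5 := by
    rw [div_mul_eq_mul_div, div_le_iff₀ hc0, hc]
    field_simp
    linarith
  have t2 : 2 / c * ∫ u, (if (N : ℝ) < X u then X u else 0) ∂Q ≤ e / 5 := by
    rw [div_mul_eq_mul_div, div_le_iff₀ hc0]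
    linarith
  have t3 : N / c * (2 * ρ * S + (ε + C * ∫ u, gap φ (f n u) (g n u) ∂Q)) ≤ 3 / 10 * e := by
    have h1 : 2 * ρ * S ≤ ε := by
      have : 2 * ρ * S ≤ 2 * ρ * (2 * (B + 1)) := by gcongr
      refine this.trans (le_of_eq ?_)
      rw [hρ, hε]
      field_simp
      norm_num
    have h2 : 2 * ρ * S + (ε + C * ∫ u, gap φ (f n u) (g n u) ∂Q) ≤ 3 * ε := by linarith
    have h3 : (N : ℝ) / c * (2 * ρ * S + (ε + C * ∫ u, gap φ (f n u) (g n u) ∂Q)) ≤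
        (N + 1) / c * (3 * ε) := by
      refine (mul_le_mul_of_nonneg_left h2 (by positivity)).trans
        (mul_le_mul_of_nonneg_right ?_ (by positivity))
      gcongr
      linarith
    refine h3.trans (le_of_eq ?_)
    rw [hε]
    field_simp
  linarith

variable {ι : Type*} {I : ι → Prop} {k : U → ℝ} {G : ι → U → ℝ} {b : ι → ℝ} {δ : ℝ}

/-- Approximate feasibility: constraints and divergence bound hold up to `e`. -/
def Approx (φ : ℝ → ℝ) (Q : Measure U) (I : ι → Prop) (G : ι → U → ℝ) (b : ι → ℝ) (δ e : ℝ)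
    (f : U → ℝ) : Prop :=
  Adm φ Q f ∧ ∫ u, φ (f u) ∂Q ≤ δ + e ∧
    ∀ i, ∫ u, f u * G i u ∂Q ≤ b i + e ∧ (¬ I i → b i - e ≤ ∫ u, f u * G i u ∂Q)

theorem Approx.mid (h : PhiOne φ) (hG : ∀ i, OHeart φ Q (G i)) {e : ℝ} {f g : U → ℝ}
    (hf : Approx φ Q I G b δ e f) (hg : Approx φ Q I G b δ e g) :
    Approx φ Q I G b δ e fun u => (f u + g u) / 2 := by
  refine ⟨hf.1.mid h hg.1, ?_, fun i => ?_⟩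
  · have h1 := hf.1.integral_gap h hg.1
    have h2 : 0 ≤ ∫ u, gap φ (f u) (g u) ∂Q :=
      integral_nonneg fun u => h.gap_nonneg (hf.1.2.1 u) (hg.1.2.1 u)
    have := hf.2.1
    have := hg.2.1
    linarith
  · rw [hf.1.integral_mid_mul h hg.1 (hG i)]
    have h1 := hf.2.2 i
    have h2 := hg.2.2 i
    exact ⟨by linarith, fun hi => by linarith [h1.2 hi, h2.2 hi]⟩

variable [Fintype ι]

theorem Approx.sum_le {e : ℝ} {f : U → ℝ} (hf : Approx φ Q I G b δ e f) {l : ι → ℝ}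
    (hl : MulNonneg I l) :
    ∑ i, l i * (∫ u, f u * G i u ∂Q - b i) ≤ (∑ i, |l i|) * e := by
  rw [Finset.sum_mul]
  refine Finset.sum_le_sum fun i _ => ?_
  have h1 := (hf.2.2 i).1
  by_cases hi : I i
  · rw [abs_of_nonneg (hl i hi)]
    exact mul_le_mul_of_nonneg_left (by linarith) (hl i hi)
  · have h2 := (hf.2.2 i).2 hi
    refine (le_abs_self _).trans ?_
    rw [abs_mul]
    exact mul_le_mul_of_nonneg_left (abs_le.2 ⟨by linarith, by linarith⟩) (abs_nonneg _)

/-- When `δ` is the minimal divergence, approximately feasible sequences have merging moments. -/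
theorem tendsto_sub_of_approx [IsProbabilityMeasure Q] (h : PhiOne φ) (hk : OHeart φ Q k)
    (hG : ∀ i, OHeart φ Q (G i))
    (hδ : ∀ ε : ℝ, 0 < ε → ∃ l, MulNonneg I l ∧ δ - ε < dVal φ Q (fun _ => 0) G b 0 1 l)
    {e : ℕ → ℝ} (he : Tendsto e atTop (nhds 0)) {f g : ℕ → U → ℝ}
    (hf : ∀ n, Approx φ Q I G b δ (e n) (f n)) (hg : ∀ n, Approx φ Q I G b δ (e n) (g n)) :
    Tendsto (fun n => ∫ u, f n u * k u ∂Q - ∫ u, g n u * k u ∂Q) atTop (nhds 0) := by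
  obtain ⟨E, hE⟩ := he.bddAbove_range
  have hE' : ∀ n, e n ≤ E := fun n => hE (mem_range_self n)
  refine tendsto_sub_of_gap h hk (fun n => (hf n).1) (fun n => (hg n).1) (B := δ + E)
    (fun n => (hf n).2.1.trans (by linarith [hE' n]))
    (fun n => (hg n).2.1.trans (by linarith [hE' n])) ?_
  rw [Metric.tendsto_atTop]
  intro ε hε
  obtain ⟨l, hl, hlδ⟩ := hδ (ε / 2) (by positivity)
  have h1 : Tendsto (fun n => e n + (∑ i, |l i|) * e n) atTop (nhds 0) := by
    simpa using he.add (he.const_mul (∑ i, |l i|))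
  obtain ⟨n0, hn0⟩ := (h1.eventually_lt_const (half_pos hε)).exists_forall_of_atTop
  refine ⟨n0, fun n hn => ?_⟩
  have h2 : 0 ≤ ∫ u, gap φ (f n u) (g n u) ∂Q :=
    integral_nonneg fun u => h.gap_nonneg ((hf n).1.2.1 u) ((hg n).1.2.1 u)
  rw [Real.dist_eq, sub_zero, abs_of_nonneg h2, (hf n).1.integral_gap h (hg n).1]
  have hm := (hf n).mid h hG (hg n)
  have h3 := dVal_le (δ := 0) (b := b) h (OHeart.const (φ := φ) (Q := Q) 0) hG one_pos l hm.1
  have h4 := hm.sum_le hl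
  simp only [lagr, mul_zero, integral_zero] at h3
  have := (hf n).2.1
  have := (hg n).2.1
  have := hn0 n hn
  linarith

end GapStability

section Density

variable {U : Type*} [MeasurableSpace U] {φ : ℝ → ℝ} {Q : Measure U}

/-- `f` is a density of the probability measure `F`, of finite divergence. -/
structure IsDens (φ : ℝ → ℝ) (Q F : Measure U) (f : U → ℝ) : Prop where
  prob : IsProbabilityMeasure F
  adm : Adm φ Q f
  dphi : Dphi φ Q F = ENNReal.ofReal (∫ u, φ (f u) ∂Q)
  integrable : ∀ k, OHeart φ Q k → Integrable k F
  integral : ∀ k, OHeart φ Q k → ∫ u, k u ∂F = ∫ u, f u * k u ∂Q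

theorem exists_isDens [IsProbabilityMeasure Q] (h : PhiOne φ) {F : Measure U}
    [IsProbabilityMeasure F] (hF : Dphi φ Q F < ⊤) : ∃ f, IsDens φ Q F f := by
  have hac : F ≪ Q := by
    by_contra hac
    rw [Dphi, if_neg hac] at hF
    exact lt_irrefl _ hF
  rw [Dphi, if_pos hac] at hF
  have hm : Measurable fun u => (F.rnDeriv Q u).toReal := (F.measurable_rnDeriv Q).ennreal_toReal
  have h0 : ∀ u, 0 ≤ (F.rnDeriv Q u).toReal := fun u => ENNReal.toReal_nonneg
  have hφm := h.measurable_comp hm h0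
  have hφi : Integrable (fun u => φ (F.rnDeriv Q u).toReal) Q :=
    (lintegral_ofReal_ne_top_iff_integrable hφm.aestronglyMeasurable
      (ae_of_all _ fun u => h.nonneg (h0 u))).1 hF.ne
  have hadm : Adm φ Q fun u => (F.rnDeriv Q u).toReal := ⟨hm, h0, hφi⟩
  refine ⟨_, inferInstance, hadm, ?_, fun k hk => ?_, fun k hk => ?_⟩
  · rw [Dphi, if_pos hac, ofReal_integral_eq_lintegral_ofReal hφi
      (ae_of_all _ fun u => h.nonneg (h0 u))]
  · rw [← integrable_rnDeriv_smul_iff hac]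
    exact hadm.integrable_mul h hk
  · rw [← integral_rnDeriv_smul hac]
    rfl

theorem Adm.exists_isDens [IsProbabilityMeasure Q] (h : PhiOne φ) {f : U → ℝ} (hf : Adm φ Q f)
    (h1 : ∫ u, f u ∂Q = 1) : ∃ F, IsDens φ Q F f := by
  have hm : Measurable fun u => ENNReal.ofReal (f u) := hf.1.ennreal_ofReal
  have hac : Q.withDensity (fun u => ENNReal.ofReal (f u)) ≪ Q := withDensity_absolutelyContinuous _ _
  have hp : IsProbabilityMeasure (Q.withDensity fun u => ENNReal.ofReal (f u)) := by
    refine ⟨?_⟩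
    rw [withDensity_apply _ MeasurableSet.univ, Measure.restrict_univ,
      ← ofReal_integral_eq_lintegral_ofReal (hf.integrable h) (ae_of_all _ hf.2.1), h1,
      ENNReal.ofReal_one]
  refine ⟨Q.withDensity fun u => ENNReal.ofReal (f u), hp, hf, ?_, fun k hk => ?_, fun k hk => ?_⟩
  · rw [Dphi, if_pos hac, ofReal_integral_eq_lintegral_ofReal hf.2.2
      (ae_of_all _ fun u => h.nonneg (hf.2.1 u))]
    refine lintegral_congr_ae ?_
    filter_upwards [Measure.rnDeriv_withDensity Q hm] with u hu
    rw [hu, ENNReal.toReal_ofReal (hf.2.1 u)]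
  · rw [integrable_withDensity_iff_integrable_smul' hm (ae_of_all _ fun _ => ENNReal.ofReal_lt_top)]
    simp only [ENNReal.toReal_ofReal (hf.2.1 _), smul_eq_mul]
    exact hf.integrable_mul h hk
  · rw [integral_withDensity_eq_integral_toReal_smul hm (ae_of_all _ fun _ => ENNReal.ofReal_lt_top)]
    simp only [ENNReal.toReal_ofReal (hf.2.1 _), smul_eq_mul]

theorem IsDens.integral_eq_one [IsProbabilityMeasure Q] {F : Measure U} {f : U → ℝ}
    (hf : IsDens φ Q F f) : ∫ u, f u ∂Q = 1 := by
  have := hf.prob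
  have h1 := hf.integral (fun _ => 1) (OHeart.const 1)
  simpa using h1.symm

end Density

section Index

variable {U : Type*} {dθ d1 d2 d3 d4 : ℕ} {Γ : Type*}

/-- Index set of the moments, `none` standing for total mass. -/
abbrev Idx (d1 d2 d3 d4 : ℕ) := Option (Fin d1 ⊕ Fin d2 ⊕ Fin d3 ⊕ Fin d4)

/-- Stacked vector preceded by a number. -/
def stack (c : ℝ) (v : Vec4 d1 d2 d3 d4) : Idx d1 d2 d3 d4 → ℝ
  | none => c
  | some (Sum.inl i) => v.1 i
  | some (Sum.inr (Sum.inl i)) => v.2.1 i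
  | some (Sum.inr (Sum.inr (Sum.inl i))) => v.2.2.1 i
  | some (Sum.inr (Sum.inr (Sum.inr i))) => v.2.2.2 i

/-- The inequality constraints. -/
def isIneq : Idx d1 d2 d3 d4 → Prop
  | none => False
  | some (Sum.inl _) => True
  | some (Sum.inr (Sum.inl _)) => False
  | some (Sum.inr (Sum.inr (Sum.inl _))) => True
  | some (Sum.inr (Sum.inr (Sum.inr _))) => False

/-- Moment functions including total mass. -/
def mom (g : U → (Fin dθ → ℝ) → Γ → Vec4 d1 d2 d3 d4) (θ : Fin dθ → ℝ) (γ : Γ)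
    (i : Idx d1 d2 d3 d4) (u : U) : ℝ := stack 1 (g u θ γ) i

/-- Right-hand sides of the moment constraints. -/
def rhs (d3 d4 : ℕ) (P : Vec12 d1 d2) : Idx d1 d2 d3 d4 → ℝ := stack 1 (P.1, P.2, 0, 0)

theorem sum_stack (a c : ℝ) (l v : Vec4 d1 d2 d3 d4) :
    ∑ i, stack a l i * stack c v i = a * c + dot4 l v := by
  simp [Fintype.sum_option, Fintype.sum_sum_type, dot4, dot, stack, add_assoc]

theorem sum_stack_mom (g : U → (Fin dθ → ℝ) → Γ → Vec4 d1 d2 d3 d4) (θ : Fin dθ → ℝ) (γ : Γ)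
    (ζ : ℝ) (l : Vec4 d1 d2 d3 d4) (u : U) :
    ∑ i, stack ζ l i * mom g θ γ i u = ζ + dot4 l (g u θ γ) := by
  simp only [mom, sum_stack, mul_one]

theorem sum_stack_rhs (ζ : ℝ) (l : Vec4 d1 d2 d3 d4) (P : Vec12 d1 d2) :
    ∑ i, stack ζ l i * rhs d3 d4 P i = ζ + dotP l P := by
  simp only [rhs, sum_stack]
  simp [dot4, dotP, dot]

theorem exists_stack (x : Idx d1 d2 d3 d4 → ℝ) : ∃ ζ l, x = stack ζ l := by
  refine ⟨x none, (fun i => x (some (Sum.inl i)), fun i => x (some (Sum.inr (Sum.inl i))),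
    fun i => x (some (Sum.inr (Sum.inr (Sum.inl i)))),
    fun i => x (some (Sum.inr (Sum.inr (Sum.inr i))))), ?_⟩
  funext i
  rcases i with _ | i | i | i | i <;> rfl

theorem forall_idx {p : Idx d1 d2 d3 d4 → Prop} : (∀ i, p i) ↔ p none ∧
    (∀ i, p (some (Sum.inl i))) ∧ (∀ i, p (some (Sum.inr (Sum.inl i)))) ∧
    (∀ i, p (some (Sum.inr (Sum.inr (Sum.inl i))))) ∧
    (∀ i, p (some (Sum.inr (Sum.inr (Sum.inr i))))) := by
  simp only [Option.forall, Sum.forall]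

theorem mulNonneg_stack {ζ : ℝ} {l : Vec4 d1 d2 d3 d4} :
    MulNonneg isIneq (stack ζ l) ↔ inLambda l := by
  simp [MulNonneg, forall_idx, isIneq, stack, inLambda]

variable [MeasurableSpace U] {φ : ℝ → ℝ} {Q : Measure U} {g : U → (Fin dθ → ℝ) → Γ → Vec4 d1 d2 d3 d4}
  {k : U → (Fin dθ → ℝ) → Γ → ℝ} {θ : Fin dθ → ℝ} {γ : Γ} {P : Vec12 d1 d2} {δ : ℝ}

theorem PhiTwo.oHeart_k [IsProbabilityMeasure Q] (h : PhiOne φ) (h2 : PhiTwo φ Q g k)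
    (θ : Fin dθ → ℝ) (γ : Γ) : OHeart φ Q fun u => k u θ γ := (h2 θ γ).1.oHeart h

theorem PhiTwo.oHeart_mom [IsProbabilityMeasure Q] (h : PhiOne φ) (h2 : PhiTwo φ Q g k)
    (θ : Fin dθ → ℝ) (γ : Γ) : ∀ i, OHeart φ Q (mom g θ γ i) :=
  forall_idx.2 ⟨OHeart.const 1, fun i => ((h2 θ γ).2.1 i).oHeart h,
    fun i => ((h2 θ γ).2.2.1 i).oHeart h, fun i => ((h2 θ γ).2.2.2.1 i).oHeart h,
    fun i => ((h2 θ γ).2.2.2.2 i).oHeart h⟩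

theorem IsDens.gIntegrable {F : Measure U} {f : U → ℝ} (hf : IsDens φ Q F f)
    (hg : ∀ i, OHeart φ Q (mom g θ γ i)) : GIntegrable g θ γ F := by
  have := forall_idx.1 fun i => hf.integrable _ (hg i)
  exact this.2

theorem IsDens.constraintsHold_iff [IsProbabilityMeasure Q] {F : Measure U} {f : U → ℝ}
    (hf : IsDens φ Q F f) (hg : ∀ i, OHeart φ Q (mom g θ γ i)) :
    ConstraintsHold g θ γ P F ↔ Con Q isIneq (mom g θ γ) (rhs d3 d4 P) f := by
  have h1 := hf.integral_eq_one
  simp only [ConstraintsHold, hf.gIntegrable hg, true_and, Con, ← hf.integral _ (hg _), forall_idx,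
    isIneq, not_true, not_false_eq_true, false_imp_iff, forall_true_left, and_true]
  have h2 : ∫ _, (1 : ℝ) ∂F = 1 := by
    rw [hf.integral _ (OHeart.const 1)]
    simpa using h1
  simp only [mom, rhs, stack, Pi.zero_apply]
  constructor
  · rintro ⟨a, b, c, d⟩
    exact ⟨⟨h2.le, h2⟩, a, fun i => ⟨(b i).le, b i⟩, c, fun i => ⟨(d i).le, d i⟩⟩
  · rintro ⟨-, a, b, c, d⟩
    exact ⟨a, fun i => (b i).2, c, fun i => (d i).2⟩

theorem Con.integral_eq_one {f : U → ℝ} (hf : Con Q isIneq (mom g θ γ) (rhs d3 d4 P) f) :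
    ∫ u, f u ∂Q = 1 := by
  have := (hf none).2 id
  simpa [mom, rhs, stack] using this

/-- Densities that are feasible for the primal problem. -/
def FeasDens (φ : ℝ → ℝ) (Q : Measure U) (g : U → (Fin dθ → ℝ) → Γ → Vec4 d1 d2 d3 d4) (δ : ℝ)
    (θ : Fin dθ → ℝ) (γ : Γ) (P : Vec12 d1 d2) (f : U → ℝ) : Prop :=
  Adm φ Q f ∧ ∫ u, φ (f u) ∂Q ≤ δ ∧ Con Q isIneq (mom g θ γ) (rhs d3 d4 P) f

theorem FeasDens.kappaLow_le [IsProbabilityMeasure Q] (h : PhiOne φ) (h2 : PhiTwo φ Q g k)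
    {f : U → ℝ} (hf : FeasDens φ Q g δ θ γ P f) :
    kappaLow φ Q g k δ θ γ P ≤ ((∫ u, f u * k u θ γ ∂Q : ℝ) : EReal) := by
  obtain ⟨F, hF⟩ := hf.1.exists_isDens h hf.2.2.integral_eq_one
  have hk := h2.oHeart_k h θ γ
  refine sInf_le ⟨F, ⟨hF.prob, ?_, (hF.constraintsHold_iff (h2.oHeart_mom h θ γ)).2 hf.2.2⟩,
    hF.integrable _ hk, by rw [hF.integral _ hk]⟩
  rw [hF.dphi]
  exact ENNReal.ofReal_le_ofReal hf.2.1

theorem le_kappaLow [IsProbabilityMeasure Q] (h : PhiOne φ) (h2 : PhiTwo φ Q g k) (hδ : 0 ≤ δ)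
    {x : EReal} (hx : ∀ f, FeasDens φ Q g δ θ γ P f → x ≤ ((∫ u, f u * k u θ γ ∂Q : ℝ) : EReal)) :
    x ≤ kappaLow φ Q g k δ θ γ P := by
  refine le_sInf ?_
  rintro _ ⟨F, ⟨hp, hd, hc⟩, -, rfl⟩
  obtain ⟨f, hf⟩ := exists_isDens h (hd.trans_lt ENNReal.ofReal_lt_top)
  rw [hf.integral _ (h2.oHeart_k h θ γ)]
  refine hx f ⟨hf.adm, ?_, (hf.constraintsHold_iff (h2.oHeart_mom h θ γ)).1 hc⟩
  rw [hf.dphi] at hd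
  exact (ENNReal.ofReal_le_ofReal_iff hδ).1 hd

theorem dVal_stack (ζ : ℝ) (l : Vec4 d1 d2 d3 d4) (κ : U → ℝ) (η : ℝ) :
    dVal φ Q κ (mom g θ γ) (rhs d3 d4 P) δ η (stack ζ l) =
      -(∫ u, η * pStar φ ((-κ u - ζ - dot4 l (g u θ γ)) / η) ∂Q) - η * δ - ζ - dotP l P := by
  simp only [dVal, sum_stack_mom, sum_stack_rhs, integral_const_mul, sub_add_eq_sub_sub]

theorem dVal_zero_stack (ζ : ℝ) (l : Vec4 d1 d2 d3 d4) :
    dVal φ Q (fun _ => 0) (mom g θ γ) (rhs d3 d4 P) 0 1 (stack ζ l) =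
      -(∫ u, pStar φ (-ζ - dot4 l (g u θ γ)) ∂Q) - ζ - dotP l P := by
  rw [dVal_stack]
  simp

theorem oHeart_arg [IsProbabilityMeasure Q] (h : PhiOne φ) {κ : U → ℝ} (hκ : OHeart φ Q κ)
    (hg : ∀ i, OHeart φ Q (mom g θ γ i)) (a ζ : ℝ) (l : Vec4 d1 d2 d3 d4) :
    OHeart φ Q fun u => a * κ u - ζ - dot4 l (g u θ γ) := by
  have := (hκ.const_mul a).sub h (OHeart.sum h Finset.univ fun i => (hg i).const_mul (stack ζ l i))
  simpa only [sum_stack_mom, sub_add_eq_sub_sub] using this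

theorem dVal_le_deltaStar [IsProbabilityMeasure Q] (h : PhiOne φ) (h2 : PhiTwo φ Q g k)
    {l : Idx d1 d2 d3 d4 → ℝ} (hl : MulNonneg isIneq l) :
    ((dVal φ Q (fun _ => 0) (mom g θ γ) (rhs d3 d4 P) 0 1 l : ℝ) : EReal) ≤
      deltaStar φ Q g θ γ P := by
  obtain ⟨ζ, l, rfl⟩ := exists_stack l
  refine le_sSup ⟨ζ, l, mulNonneg_stack.1 hl, fun u => pStar φ (-ζ - dot4 l (g u θ γ)), ?_,
    ae_of_all _ fun u => h.coe_pStar _, by rw [dVal_zero_stack]⟩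
  have := (oHeart_arg h (OHeart.const 0) (h2.oHeart_mom h θ γ) 0 ζ l).integrable_pStar h
  simpa using this

theorem deltaStar_le (h : PhiOne φ) {x : EReal} (hx : ∀ l, MulNonneg isIneq l →
    ((dVal φ Q (fun _ => 0) (mom g θ γ) (rhs d3 d4 P) 0 1 l : ℝ) : EReal) ≤ x) :
    deltaStar φ Q g θ γ P ≤ x := by
  refine sSup_le ?_
  rintro _ ⟨ζ, l, hl, w, -, hw, rfl⟩
  have := hx (stack ζ l) (mulNonneg_stack.2 hl)
  rw [dVal_zero_stack] at this
  have e : ∫ u, w u ∂Q = ∫ u, pStar φ (-ζ - dot4 l (g u θ γ)) ∂Q :=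
    integral_congr_ae (hw.mono fun u hu => by
      rw [← h.coe_pStar] at hu
      exact EReal.coe_injective hu)
  rwa [e]

theorem dVal_le_kappaLowDual [IsProbabilityMeasure Q] (h : PhiOne φ) (h2 : PhiTwo φ Q g k)
    {l : Idx d1 d2 d3 d4 → ℝ} (hl : MulNonneg isIneq l) {η : ℝ} (hη : 0 < η) :
    ((dVal φ Q (fun u => k u θ γ) (mom g θ γ) (rhs d3 d4 P) δ η l : ℝ) : EReal) ≤
      kappaLowDual φ Q g k δ θ γ P := by
  obtain ⟨ζ, l, rfl⟩ := exists_stack l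
  refine le_sSup ⟨η, hη.le, ζ, l, mulNonneg_stack.1 hl,
    fun u => η * pStar φ ((-(k u θ γ) - ζ - dot4 l (g u θ γ)) / η), ?_,
    ae_of_all _ fun u => (h.coe_etaPhiStar hη _).symm, by rw [dVal_stack]⟩
  have := ((oHeart_arg h (h2.oHeart_k h θ γ) (h2.oHeart_mom h θ γ) (-1) ζ l).const_mul
    η⁻¹).integrable_pStar h
  refine Integrable.const_mul ?_ η
  convert this using 3
  ring

theorem FeasDens.sum_le {f : U → ℝ} (hf : FeasDens φ Q g δ θ γ P f) {l : Idx d1 d2 d3 d4 → ℝ}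
    (hl : MulNonneg isIneq l) :
    ∑ i, l i * ∫ u, f u * mom g θ γ i u ∂Q ≤ ∑ i, l i * rhs d3 d4 P i := by
  have := hf.2.2.sum_nonpos hl
  simp only [mul_sub, Finset.sum_sub_distrib] at this
  linarith

theorem FeasDens.kappaLowDual_le [IsProbabilityMeasure Q] (h : PhiOne φ) (h2 : PhiTwo φ Q g k)
    {f : U → ℝ} (hf : FeasDens φ Q g δ θ γ P f) :
    kappaLowDual φ Q g k δ θ γ P ≤ ((∫ u, f u * k u θ γ ∂Q : ℝ) : EReal) := by
  have hk := h2.oHeart_k h θ γ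
  have hg := h2.oHeart_mom h θ γ
  refine sSup_le ?_
  rintro _ ⟨η, hη, ζ, l, hl, w, hwi, hw, rfl⟩
  rw [EReal.coe_le_coe_iff]
  have hs := hf.sum_le (mulNonneg_stack (ζ := ζ).2 hl)
  rw [sum_stack_rhs] at hs
  have hle : ∫ u, (f u * (-(k u θ γ) - ζ - dot4 l (g u θ γ)) - η * φ (f u)) ∂Q ≤ ∫ u, w u ∂Q := by
    have hi := hf.1.integrable_mul h (oHeart_arg h hk hg (-1) ζ l)
    simp only [neg_mul, one_mul] at hi
    refine integral_mono_ae (hi.sub (hf.1.2.2.const_mul η)) hwi (hw.mono fun u hu => ?_)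
    rw [← EReal.coe_le_coe_iff, hu]
    exact le_iSup₂ (f := fun t (_ : t ∈ Ici (0:ℝ)) =>
      ((t * (-(k u θ γ) - ζ - dot4 l (g u θ γ)) - η * φ t : ℝ) : EReal)) (f u) (hf.1.2.1 u)
  have e : ∫ u, (f u * (-(k u θ γ) - ζ - dot4 l (g u θ γ)) - η * φ (f u)) ∂Q =
      -(∫ u, f u * k u θ γ ∂Q) - ∑ i, stack ζ l i * ∫ u, f u * mom g θ γ i u ∂Q -
        η * ∫ u, φ (f u) ∂Q := by
    simp_rw [← integral_const_mul]
    have i1 : Integrable (fun u => -(f u * k u θ γ)) Q := (hf.1.integrable_mul h hk).neg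
    have i2 : ∀ i ∈ (Finset.univ : Finset (Idx d1 d2 d3 d4)),
        Integrable (fun u => stack ζ l i * (f u * mom g θ γ i u)) Q := fun i _ =>
      (hf.1.integrable_mul h (hg i)).const_mul _
    have i3 : Integrable (fun u => -(f u * k u θ γ) -
        ∑ i, stack ζ l i * (f u * mom g θ γ i u)) Q := i1.sub (integrable_finsetSum _ i2)
    rw [← integral_finsetSum _ i2, ← integral_neg, ← integral_sub i1 (integrable_finsetSum _ i2),
      ← integral_sub i3 (hf.1.2.2.const_mul η)]
    refine integral_congr_ae (ae_of_all _ fun u => ?_)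
    have : ∑ i, stack ζ l i * (f u * mom g θ γ i u) = f u * (ζ + dot4 l (g u θ γ)) := by
      rw [← sum_stack_mom, Finset.mul_sum]
      exact Finset.sum_congr rfl fun i _ => by ring
    simp only [this]
    ring
  have := mul_le_mul_of_nonneg_left hf.2.1 hη
  linarith

theorem FeasDens.deltaStar_le [IsProbabilityMeasure Q] (h : PhiOne φ) (h2 : PhiTwo φ Q g k)
    {f : U → ℝ} (hf : FeasDens φ Q g δ θ γ P f) :
    deltaStar φ Q g θ γ P ≤ ((∫ u, φ (f u) ∂Q : ℝ) : EReal) := by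
  refine CFSens.deltaStar_le h fun l hl => EReal.coe_le_coe_iff.2 ?_
  have h1 := dVal_le (δ := 0) (b := rhs d3 d4 P) h (OHeart.const (φ := φ) (Q := Q) 0)
    (h2.oHeart_mom h θ γ) one_pos l hf.1
  have h3 := hf.2.2.sum_nonpos hl
  simp only [lagr, mul_zero, integral_zero] at h1
  linarith

/-- Condition S rules out degenerate multipliers. -/
theorem ConditionS.nondegenerate [IsProbabilityMeasure Q] (h : PhiOne φ) (h2 : PhiTwo φ Q g k)
    (hS : ConditionS φ Q g θ γ P) :
    Nondegenerate φ Q isIneq (mom g θ γ) (rhs d3 d4 P) := by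
  intro l hl hf
  obtain ⟨ζ, l, rfl⟩ := exists_stack l
  have hl' := mulNonneg_stack.1 hl
  have hg := h2.oHeart_mom h θ γ
  simp only [mul_sub, Finset.sum_sub_distrib, sum_stack_rhs] at hf
  have hmem : ∀ v ∈ momentSet φ Q g θ γ + coneC, dotP l P ≤ dot4 l v := by
    rintro _ ⟨v, ⟨F, hp, hd, -, rfl⟩, c, hc, rfl⟩
    obtain ⟨f, hfd⟩ := exists_isDens h hd
    have h1 := hf f hfd.adm
    simp only [← hfd.integral _ (hg _)] at h1
    have h3 : (fun i => ∫ u, mom g θ γ i u ∂F) = stack 1 ((fun i => ∫ u, (g u θ γ).1 i ∂F),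
        (fun i => ∫ u, (g u θ γ).2.1 i ∂F), (fun i => ∫ u, (g u θ γ).2.2.1 i ∂F),
         (fun i => ∫ u, (g u θ γ).2.2.2 i ∂F)) := by
      funext i
      rcases i with _ | i | i | i | i
      · simp [mom, stack]
      all_goals rfl
    simp only [funext_iff] at h3
    simp only [h3, sum_stack] at h1
    have h4 : 0 ≤ dot4 l c := by
      obtain ⟨c1, c2, c3, c4⟩ := hc
      have e1 : 0 ≤ dot l.1 c.1 := Finset.sum_nonneg fun i _ => mul_nonneg (hl'.1 i) (c1 i)
      have e2 : 0 ≤ dot l.2.2.1 c.2.2.1 := Finset.sum_nonneg fun i _ => mul_nonneg (hl'.2 i) (c3 i)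
      have e3 : dot l.2.1 c.2.1 = 0 := by simp [c2, dot]
      have e4 : dot l.2.2.2 c.2.2.2 = 0 := by simp [c4, dot]
      unfold dot4
      linarith
    have h5 : ∀ v w, dot4 l (v + w) = dot4 l v + dot4 l w := fun v w => by
      simp only [dot4, dot, Prod.fst_add, Prod.snd_add, Pi.add_apply, mul_add,
        Finset.sum_add_distrib]
      ring
    simp only [h5]
    linarith
  have hl0 : l = 0 := by
    have ht : Tendsto (fun t : ℝ => ((P.1, P.2, 0, 0) : Vec4 d1 d2 d3 d4) - t • l)
        (nhdsWithin 0 (Ioi 0)) (nhds ((P.1, P.2, 0, 0) : Vec4 d1 d2 d3 d4)) := by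
      have : Continuous fun t : ℝ => ((P.1, P.2, 0, 0) : Vec4 d1 d2 d3 d4) - t • l := by fun_prop
      simpa using (this.tendsto 0).mono_left nhdsWithin_le_nhds
    have hev := ht.eventually (mem_interior_iff_mem_nhds.1 hS)
    obtain ⟨t, ht, ht0⟩ := (hev.and self_mem_nhdsWithin).exists
    have h6 := hmem _ ht
    have h7 : dot4 l (((P.1, P.2, 0, 0) : Vec4 d1 d2 d3 d4) - t • l) = dotP l P - t * dot4 l l := by
      simp only [dot4, dotP, dot, Prod.fst_sub, Prod.snd_sub, Prod.smul_fst, Prod.smul_snd,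
        Pi.sub_apply, Pi.smul_apply, smul_eq_mul, mul_sub, Finset.sum_sub_distrib, mul_add,
        Finset.mul_sum, Pi.zero_apply, mul_zero, Finset.sum_const_zero, mul_left_comm t]
      ring
    rw [h7] at h6
    have h8 : dot4 l l ≤ 0 := by
      have : (0 : ℝ) < t := ht0
      nlinarith
    have hd : ∀ {n : ℕ} (a : Fin n → ℝ), 0 ≤ dot a a := fun a =>
      Finset.sum_nonneg fun i _ => mul_self_nonneg _
    have hd0 : ∀ {n : ℕ} (a : Fin n → ℝ), dot a a ≤ 0 → a = 0 := fun a ha => by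
      have := (Finset.sum_eq_zero_iff_of_nonneg fun i _ => mul_self_nonneg (a i)).1
        (le_antisymm ha (hd a))
      funext i
      exact mul_self_eq_zero.1 (this i (Finset.mem_univ i))
    unfold dot4 at h8
    have b1 := hd l.1
    have b2 := hd l.2.1
    have b3 := hd l.2.2.1
    have b4 := hd l.2.2.2
    exact Prod.ext (hd0 _ (by linarith)) (Prod.ext (hd0 _ (by linarith))
      (Prod.ext (hd0 _ (by linarith)) (hd0 _ (by linarith))))
  subst hl0
  have hP : dotP (0 : Vec4 d1 d2 d3 d4) P = 0 := by simp [dotP, dot]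
  have hc : ∀ c : ℝ, 0 ≤ c → 0 ≤ ζ * c - ζ := fun c hc => by
    have h1 := hf _ (Adm.const hc)
    rw [hP] at h1
    have h2 : ∑ i, stack ζ (0 : Vec4 d1 d2 d3 d4) i * ∫ u, c * mom g θ γ i u ∂Q = ζ * c := by
      simp [Fintype.sum_option, Fintype.sum_sum_type, stack, mom]
    linarith
  have e1 := hc 0 le_rfl
  have e2 := hc 2 zero_le_two
  obtain rfl : ζ = 0 := by linarith
  funext i
  rcases i with _ | i | i | i | i <;> rfl

theorem kappaLowDual_le_kappaLow [IsProbabilityMeasure Q] (h : PhiOne φ) (h2 : PhiTwo φ Q g k)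
    (hδ : 0 ≤ δ)
    (θ : Fin dθ → ℝ) (γ : Γ) (P : Vec12 d1 d2) :
    kappaLowDual φ Q g k δ θ γ P ≤ kappaLow φ Q g k δ θ γ P :=
  le_kappaLow h h2 hδ fun _ hf => hf.kappaLowDual_le h h2

theorem kappaLow_eq_top [IsProbabilityMeasure Q] (h : PhiOne φ) (h2 : PhiTwo φ Q g k)
    (hδ : 0 ≤ δ) {θ : Fin dθ → ℝ} {γ : Γ}
    {P : Vec12 d1 d2} (hlt : (δ : EReal) < deltaStar φ Q g θ γ P) :
    kappaLow φ Q g k δ θ γ P = ⊤ :=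
  top_le_iff.1 <| le_kappaLow h h2 hδ fun _ hf => absurd
    (hlt.trans_le ((hf.deltaStar_le h h2).trans (EReal.coe_le_coe_iff.2 hf.2.1))) (lt_irrefl _)

theorem kappaLowDual_le_KLowCrit [IsProbabilityMeasure Q] (h : PhiOne φ) (h2 : PhiTwo φ Q g k)
    (hδ : 0 ≤ δ)
    (θ : Fin dθ → ℝ) (γ : Γ) (P : Vec12 d1 d2) :
    kappaLowDual φ Q g k δ θ γ P ≤ KLowCrit φ Q g k δ θ γ P := by
  unfold KLowCrit
  split_ifs
  · exact le_rfl
  · exact kappaLowDual_le_kappaLow h h2 hδ θ γ P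
  · exact le_top

theorem exists_lt_dVal_of_lt_deltaStar (h : PhiOne φ) {x : EReal} {θ : Fin dθ → ℝ} {γ : Γ}
    {P : Vec12 d1 d2} (hx : x < deltaStar φ Q g θ γ P) :
    ∃ l, MulNonneg isIneq l ∧
      x < ((dVal φ Q (fun _ => 0) (mom g θ γ) (rhs d3 d4 P) 0 1 l : ℝ) : EReal) := by
  by_contra! hno
  exact absurd (deltaStar_le h hno) (not_le.2 hx)

end Index

section Limits

variable {U : Type*} [MeasurableSpace U] {dθ d1 d2 d3 d4 : ℕ} {Γ : Type*} [MetricSpace Γ]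
  {φ : ℝ → ℝ} {Q : Measure U} [IsProbabilityMeasure Q]
  {g : U → (Fin dθ → ℝ) → Γ → Vec4 d1 d2 d3 d4} {k : U → (Fin dθ → ℝ) → Γ → ℝ}
  {Θ : Set (Fin dθ → ℝ)} {θ0 : Fin dθ → ℝ} {γ0 : Γ} {P0 : Vec12 d1 d2} {δ : ℝ}

theorem eExp_phiStar (h : PhiOne φ) {s : U → ℝ} (hs : Integrable (fun u => pStar φ (s u)) Q) :
    eExp Q (φ 0) (fun u => phiStar φ (s u)) = ((∫ u, pStar φ (s u) ∂Q : ℝ) : EReal) := by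
  have h0 : ∀ u, 0 ≤ pStar φ (s u) + φ 0 := fun u => by linarith [h.neg_le_pStar (s u)]
  have e : ∀ u, erealToENNReal (phiStar φ (s u) + (φ 0 : EReal)) =
      ENNReal.ofReal (pStar φ (s u) + φ 0) := fun u => by
    rw [← h.coe_pStar, ← EReal.coe_add, erealToENNReal, if_neg (EReal.coe_ne_top _),
      EReal.toReal_coe]
  have hi : Integrable (fun u => pStar φ (s u) + φ 0) Q := hs.add (integrable_const _)
  simp only [eExp, e]
  rw [← ofReal_integral_eq_lintegral_ofReal hi (ae_of_all _ h0), EReal.coe_ennreal_ofReal,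
    max_eq_left (integral_nonneg h0), integral_add hs (integrable_const _), ← EReal.coe_sub]
  simp

theorem MFive.tendsto_integral (h : PhiOne φ) (h2 : PhiTwo φ Q g k) (h5 : MFive φ Q g k Θ)
    (hθ0 : θ0 ∈ Θ) (c1 c2 : ℝ) (c3 : Vec4 d1 d2 d3 d4) :
    Tendsto (fun p : (Fin dθ → ℝ) × Γ =>
      ∫ u, pStar φ (c1 + c2 * k u p.1 p.2 + dot4 c3 (g u p.1 p.2)) ∂Q)
      (nhdsWithin (θ0, γ0) (Θ ×ˢ univ))
      (nhds (∫ u, pStar φ (c1 + c2 * k u θ0 γ0 + dot4 c3 (g u θ0 γ0)) ∂Q)) := by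
  have hi : ∀ p : (Fin dθ → ℝ) × Γ, Integrable (fun u =>
      pStar φ (c1 + c2 * k u p.1 p.2 + dot4 c3 (g u p.1 p.2))) Q := fun p => by
    have := (oHeart_arg h (h2.oHeart_k h p.1 p.2) (h2.oHeart_mom h p.1 p.2) c2 (-c1)
      (-c3)).integrable_pStar h
    have e : ∀ v, dot4 (-c3) v = -dot4 c3 v := fun v => by
      simp only [dot4, dot, Prod.fst_neg, Prod.snd_neg, Pi.neg_apply, neg_mul,
        Finset.sum_neg_distrib]
      ring
    convert this using 3
    rw [e]
    ring
  have := h5 c1 c2 c3 (θ0, γ0) ⟨hθ0, mem_univ _⟩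
  have e0 := eExp_phiStar h (hi (θ0, γ0))
  simp only at e0
  simp only [ContinuousWithinAt, eExp_phiStar h (hi _)] at this
  rw [e0] at this
  exact EReal.tendsto_coe.1 this

theorem MFive.tendsto_dVal (h : PhiOne φ) (h2 : PhiTwo φ Q g k) (h5 : MFive φ Q g k Θ)
    (hθ0 : θ0 ∈ Θ) (s δ η : ℝ) (l : Idx d1 d2 d3 d4 → ℝ) :
    Tendsto (fun p : ((Fin dθ → ℝ) × Γ) × Vec12 d1 d2 =>
      dVal φ Q (fun u => s * k u p.1.1 p.1.2) (mom g p.1.1 p.1.2) (rhs d3 d4 p.2) δ η l)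
      (nhdsWithin (θ0, γ0) (Θ ×ˢ univ) ×ˢ nhds P0)
      (nhds (dVal φ Q (fun u => s * k u θ0 γ0) (mom g θ0 γ0) (rhs d3 d4 P0) δ η l)) := by
  obtain ⟨ζ, l, rfl⟩ := exists_stack l
  simp only [dVal_stack]
  have e : ∀ (x : ℝ) (v : Vec4 d1 d2 d3 d4), (-(s * x) - ζ - dot4 l v) / η =
      -ζ / η + (-s / η) * x + dot4 ((-1 / η) • l) v := fun x v => by
    simp only [dot4, dot, Prod.smul_fst, Prod.smul_snd, Pi.smul_apply, smul_eq_mul, mul_assoc,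
      ← Finset.mul_sum]
    ring
  simp only [e, integral_const_mul]
  have hP : Continuous fun P : Vec12 d1 d2 => dotP l P := by
    unfold dotP dot
    fun_prop
  exact ((((((h5.tendsto_integral h h2 hθ0 _ _ _).comp tendsto_fst).const_mul η).neg).sub_const
    _).sub_const _).sub ((hP.tendsto P0).comp tendsto_snd)

theorem EContinuousIn.tendsto_sub (h : PhiOne φ) {κ : U → (Fin dθ → ℝ) → Γ → ℝ}
    (hc : EContinuousIn φ Q Θ κ) (hκ : ∀ θ γ, OHeart φ Q fun u => κ u θ γ) (hθ0 : θ0 ∈ Θ)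
    {α : Type*} {F : Filter α} {p : α → (Fin dθ → ℝ) × Γ}
    (hp : Tendsto p F (nhdsWithin (θ0, γ0) (Θ ×ˢ univ))) {f : α → U → ℝ}
    (hf : ∀ a, Adm φ Q (f a)) {B : ℝ} (hB : ∀ a, ∫ u, φ (f a u) ∂Q ≤ B) :
    Tendsto (fun a => ∫ u, f a u * κ u (p a).1 (p a).2 ∂Q - ∫ u, f a u * κ u θ0 γ0 ∂Q) F
      (nhds 0) := by
  refine (tendsto_integral_of_psiNorm h hf (fun a => (hκ (p a).1 (p a).2).sub h (hκ θ0 γ0)) hB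
    ((hc θ0 hθ0 γ0).comp hp)).congr fun a => ?_
  simp only [mul_sub]
  exact integral_sub ((hf a).integrable_mul h (hκ _ _)) ((hf a).integrable_mul h (hκ _ _))

theorem MOneG.tendsto_sub (h : PhiOne φ) (h2 : PhiTwo φ Q g k) (hc : MOneG φ Q g Θ)
    (hθ0 : θ0 ∈ Θ) {α : Type*} {F : Filter α} {p : α → (Fin dθ → ℝ) × Γ}
    (hp : Tendsto p F (nhdsWithin (θ0, γ0) (Θ ×ˢ univ))) {f : α → U → ℝ}
    (hf : ∀ a, Adm φ Q (f a)) {B : ℝ} (hB : ∀ a, ∫ u, φ (f a u) ∂Q ≤ B) :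
    ∀ i, Tendsto (fun a => ∫ u, f a u * mom g (p a).1 (p a).2 i u ∂Q -
      ∫ u, f a u * mom g θ0 γ0 i u ∂Q) F (nhds 0) := by
  refine forall_idx.2 ⟨?_, fun i => ?_, fun i => ?_, fun i => ?_, fun i => ?_⟩
  · simp only [mom, stack, sub_self]
    exact tendsto_const_nhds
  · exact (hc.1 i).tendsto_sub h (fun θ γ => h2.oHeart_mom h θ γ (some (Sum.inl i))) hθ0 hp hf hB
  · exact (hc.2.1 i).tendsto_sub h
      (fun θ γ => h2.oHeart_mom h θ γ (some (Sum.inr (Sum.inl i)))) hθ0 hp hf hB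
  · exact (hc.2.2.1 i).tendsto_sub h
      (fun θ γ => h2.oHeart_mom h θ γ (some (Sum.inr (Sum.inr (Sum.inl i))))) hθ0 hp hf hB
  · exact (hc.2.2.2 i).tendsto_sub h
      (fun θ γ => h2.oHeart_mom h θ γ (some (Sum.inr (Sum.inr (Sum.inr i))))) hθ0 hp hf hB

end Limits

/-- The standing assumptions of the consistency theorem. -/
structure StandingAssumptions {U : Type*} [MeasurableSpace U] {dθ d1 d2 d3 d4 : ℕ} {Γ : Type*}
    [MetricSpace Γ] (φ : ℝ → ℝ) (Q : Measure U) (g : U → (Fin dθ → ℝ) → Γ → Vec4 d1 d2 d3 d4)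
    (k : U → (Fin dθ → ℝ) → Γ → ℝ) (Θ : Set (Fin dθ → ℝ)) (γ0 : Γ) (P0 : Vec12 d1 d2)
    (δ : ℝ) : Prop where
  pos : 0 < δ
  phiOne : PhiOne φ
  phiTwo : PhiTwo φ Q g k
  continuous_k : EContinuousIn φ Q Θ k
  continuous_g : MOneG φ Q g Θ
  conditionS : ∀ θ ∈ ThetaDelta φ Q g Θ γ0 P0 δ, ConditionS φ Q g θ γ0 P0
  subset_closure : {θ ∈ Θ | deltaStar φ Q g θ γ0 P0 ≤ ((δ : ℝ) : EReal)} ⊆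
    closure (ThetaDelta φ Q g Θ γ0 P0 δ)
  isCompact : IsCompact Θ
  continuous_conj : MFive φ Q g k Θ

namespace StandingAssumptions

variable {U : Type*} [MeasurableSpace U] {dθ d1 d2 d3 d4 : ℕ} {Γ : Type*} [MetricSpace Γ]
  {φ : ℝ → ℝ} {Q : Measure U} [IsProbabilityMeasure Q]
  {g : U → (Fin dθ → ℝ) → Γ → Vec4 d1 d2 d3 d4} {k : U → (Fin dθ → ℝ) → Γ → ℝ}
  {Θ : Set (Fin dθ → ℝ)} {γ0 : Γ} {P0 : Vec12 d1 d2} {δ : ℝ}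

theorem nondegenerate (A : StandingAssumptions φ Q g k Θ γ0 P0 δ) {θ : Fin dθ → ℝ}
    (hθ : θ ∈ ThetaDelta φ Q g Θ γ0 P0 δ) :
    Nondegenerate φ Q isIneq (mom g θ γ0) (rhs d3 d4 P0) :=
  (A.conditionS θ hθ).nondegenerate A.phiOne A.phiTwo

theorem exists_slater (A : StandingAssumptions φ Q g k Θ γ0 P0 δ) {θ : Fin dθ → ℝ}
    (hθ : θ ∈ ThetaDelta φ Q g Θ γ0 P0 δ) :
    ∃ f, Adm φ Q f ∧ ∫ u, φ (f u) ∂Q < δ ∧ Con Q isIneq (mom g θ γ0) (rhs d3 d4 P0) f := by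
  by_contra hno
  obtain ⟨l, hl, hle⟩ := (A.nondegenerate hθ).exists_le_dVal A.phiOne
    (A.phiTwo.oHeart_mom A.phiOne θ γ0) hno
  exact absurd hθ.2 (not_lt.2 ((EReal.coe_le_coe_iff.2 hle).trans
    (dVal_le_deltaStar A.phiOne A.phiTwo hl)))

/-- On the feasible region, the dual value is at least the infimum of the primal over `Θ_δ`. -/
theorem exists_lt_dVal (A : StandingAssumptions φ Q g k Θ γ0 P0 δ) {θ : Fin dθ → ℝ} (hθ : θ ∈ Θ)
    (hδ : deltaStar φ Q g θ γ0 P0 ≤ (δ : EReal)) {m : ℝ}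
    (hm : (m : EReal) < ⨅ θ ∈ ThetaDelta φ Q g Θ γ0 P0 δ, kappaLow φ Q g k δ θ γ0 P0) :
    ∃ η l, 0 < η ∧ MulNonneg isIneq l ∧
      m < dVal φ Q (fun u => k u θ γ0) (mom g θ γ0) (rhs d3 d4 P0) δ η l := by
  have h := A.phiOne
  have h2 := A.phiTwo
  have hk := h2.oHeart_k h θ γ0
  have hg := h2.oHeart_mom h θ γ0
  obtain ⟨m', hmm', hm'⟩ := EReal.lt_iff_exists_real_btwn.1 hm
  rw [EReal.coe_lt_coe_iff] at hmm'
  have hle : ∀ θ ∈ ThetaDelta φ Q g Θ γ0 P0 δ, ∀ f, FeasDens φ Q g δ θ γ0 P0 f →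
      m' ≤ ∫ u, f u * k u θ γ0 ∂Q := fun θ hθ f hf =>
    EReal.coe_le_coe_iff.1 ((hm'.le.trans (iInf₂_le θ hθ)).trans (hf.kappaLow_le h h2))
  rcases hδ.lt_or_eq with hlt | heq
  · obtain ⟨f0, h0, h0δ, h0c⟩ := A.exists_slater ⟨hθ, hlt⟩
    exact (A.nondegenerate ⟨hθ, hlt⟩).exists_lt_dVal h hk hg h0 h0δ h0c hmm'
      fun f hf hfδ hfc => hle θ ⟨hθ, hlt⟩ f ⟨hf, hfδ.le, hfc⟩
  by_contra! hno
  have happ := fun n : ℕ => exists_approx h hk hg A.pos hno (fun l hl => EReal.coe_le_coe_iff.1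
    ((dVal_le_deltaStar h h2 hl).trans hδ)) (Nat.one_div_pos_of_nat (α := ℝ) (n := n))
  choose f hf hfk hfδ hfc using happ
  obtain ⟨t, ht, htlim⟩ := mem_closure_iff_seq_limit.1 (A.subset_closure ⟨hθ, hδ⟩)
  choose s hs hsδ hsc using fun n => A.exists_slater (ht n)
  have hp : Tendsto (fun n => (t n, γ0)) atTop (nhdsWithin (θ, γ0) (Θ ×ˢ (univ : Set Γ))) :=
    tendsto_nhdsWithin_iff.2 ⟨htlim.prodMk_nhds tendsto_const_nhds,
      Eventually.of_forall fun n => ⟨(ht n).1, mem_univ _⟩⟩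
  have hsk := A.continuous_k.tendsto_sub h (h2.oHeart_k h) hθ hp hs fun n => (hsδ n).le
  have hsg := A.continuous_g.tendsto_sub h h2 hθ hp hs fun n => (hsδ n).le
  simp only at hsk hsg
  have hlim1 : Tendsto (fun n : ℕ => 1 / ((n : ℝ) + 1)) atTop (nhds 0) :=
    tendsto_one_div_add_atTop_nhds_zero_nat
  have hsum : Tendsto (fun n => ∑ i, |∫ u, s n u * mom g (t n) γ0 i u ∂Q -
      ∫ u, s n u * mom g θ γ0 i u ∂Q|) atTop (nhds 0) := by
    simpa using tendsto_finsetSum Finset.univ fun i _ => (hsg i).abs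
  set r : ℕ → ℝ := fun n => ∑ i, |∫ u, s n u * mom g (t n) γ0 i u ∂Q -
      ∫ u, s n u * mom g θ γ0 i u ∂Q| with hr
  have hr0 : ∀ n, 0 ≤ r n := fun n => Finset.sum_nonneg fun i _ => abs_nonneg _
  have hri : ∀ n i, |∫ u, s n u * mom g (t n) γ0 i u ∂Q -
      ∫ u, s n u * mom g θ γ0 i u ∂Q| ≤ r n := fun n i =>
    Finset.single_le_sum (f := fun i => |∫ u, s n u * mom g (t n) γ0 i u ∂Q -
      ∫ u, s n u * mom g θ γ0 i u ∂Q|) (fun i _ => abs_nonneg _) (Finset.mem_univ i)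
  have he : Tendsto (fun n : ℕ => 1 / ((n : ℝ) + 1) + r n) atTop (nhds 0) := by
    simpa using hlim1.add hsum
  have hn0 : ∀ n : ℕ, 0 < 1 / ((n : ℝ) + 1) := fun n => Nat.one_div_pos_of_nat
  have hmerge := tendsto_sub_of_approx (I := isIneq) (b := rhs d3 d4 P0) (δ := δ) h hk hg
    (fun ε hε => by
      obtain ⟨l, hl, hlt⟩ := exists_lt_dVal_of_lt_deltaStar (x := ((δ - ε : ℝ) : EReal)) h
        (by rw [heq]; exact EReal.coe_lt_coe_iff.2 (by linarith))
      exact ⟨l, hl, EReal.coe_lt_coe_iff.1 hlt⟩) he (f := f) (g := s)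
    (fun n => ⟨hf n, by linarith [hfδ n, hr0 n], fun i => ⟨by linarith [(hfc n i).1, hr0 n],
      fun hi => by linarith [(hfc n i).2 hi, hr0 n]⟩⟩)
    (fun n => ⟨hs n, by linarith [hsδ n, hr0 n, hn0 n], fun i => ⟨by
      linarith [(hsc n i).1, (abs_le.1 (hri n i)).1, hn0 n], fun hi => by
      linarith [(hsc n i).2 hi, (abs_le.1 (hri n i)).2, hn0 n]⟩⟩)
  have hlast : Tendsto (fun n : ℕ => m + 1 / ((n : ℝ) + 1) +
      (∫ u, s n u * k u (t n) γ0 ∂Q - ∫ u, s n u * k u θ γ0 ∂Q) -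
      (∫ u, f n u * k u θ γ0 ∂Q - ∫ u, s n u * k u θ γ0 ∂Q)) atTop (nhds (m + 0 + 0 - 0)) :=
    ((hlim1.const_add m).add hsk).sub hmerge
  have := ge_of_tendsto' (b := m') hlast fun n => by
    have := hle (t n) (ht n) (s n) ⟨hs n, (hsδ n).le, hsc n⟩
    linarith [hfk n]
  linarith

theorem iInf_kappaLow_eq (A : StandingAssumptions φ Q g k Θ γ0 P0 δ) :
    ⨅ θ ∈ Θ, kappaLow φ Q g k δ θ γ0 P0 =
      ⨅ θ ∈ ThetaDelta φ Q g Θ γ0 P0 δ, kappaLow φ Q g k δ θ γ0 P0 := by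
  refine le_antisymm (le_iInf₂ fun θ hθ => iInf₂_le θ hθ.1) (le_iInf₂ fun θ hθ => ?_)
  rcases le_or_gt (deltaStar φ Q g θ γ0 P0) (δ : EReal) with hle | hlt
  · refine le_of_forall_lt fun a ha => ?_
    obtain ⟨m, ham, hm⟩ := EReal.lt_iff_exists_real_btwn.1 ha
    obtain ⟨η, l, hη, hl, hlt⟩ := A.exists_lt_dVal hθ hle hm
    exact (ham.trans (EReal.coe_lt_coe_iff.2 hlt)).trans_le
      ((dVal_le_kappaLowDual A.phiOne A.phiTwo hl hη).trans
        (kappaLowDual_le_kappaLow A.phiOne A.phiTwo A.pos.le θ γ0 P0))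
  · rw [kappaLow_eq_top A.phiOne A.phiTwo A.pos.le hlt]
    exact le_top

theorem eventually_lt_KLowCrit (A : StandingAssumptions φ Q g k Θ γ0 P0 δ) {m : ℝ}
    (hm : (m : EReal) < ⨅ θ ∈ Θ, kappaLow φ Q g k δ θ γ0 P0) :
    ∀ᶠ x : Γ × Vec12 d1 d2 in nhds (γ0, P0), ∀ θ ∈ Θ,
      (m : EReal) < KLowCrit φ Q g k δ θ x.1 x.2 := by
  have h := A.phiOne
  have h2 := A.phiTwo
  rw [A.iInf_kappaLow_eq] at hm
  suffices hs : ∀ θ0 ∈ Θ, ∀ᶠ p : ((Fin dθ → ℝ) × Γ) × Vec12 d1 d2 in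
      nhdsWithin (θ0, γ0) (Θ ×ˢ univ) ×ˢ nhds P0,
      (m : EReal) < KLowCrit φ Q g k δ p.1.1 p.1.2 p.2 by
    have := A.isCompact.eventually_forall_of_forall_eventually (x₀ := (γ0, P0))
      (P := fun x θ => θ ∈ Θ → (m : EReal) < KLowCrit φ Q g k δ θ x.1 x.2) fun θ0 hθ0 => by
        have h3 := hs θ0 hθ0
        rw [← nhdsWithin_univ P0, ← nhdsWithin_prod_eq, eventually_nhdsWithin_iff] at h3
        have hc : Tendsto (fun z : (Γ × Vec12 d1 d2) × (Fin dθ → ℝ) => ((z.2, z.1.1), z.1.2))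
            (nhds ((γ0, P0), θ0)) (nhds ((θ0, γ0), P0)) :=
          Continuous.tendsto (by fun_prop) ((γ0, P0), θ0)
        exact (hc.eventually h3).mono fun z hz hθ => hz ⟨⟨hθ, mem_univ _⟩, mem_univ _⟩
    exact this.mono fun x hx θ hθ => hx θ hθ hθ
  intro θ0 hθ0
  rcases le_or_gt (deltaStar φ Q g θ0 γ0 P0) (δ : EReal) with hle | hlt
  · obtain ⟨η, l, hη, hl, hlt⟩ := A.exists_lt_dVal hθ0 hle hm
    have h3 := A.continuous_conj.tendsto_dVal (γ0 := γ0) (P0 := P0) h h2 hθ0 1 δ η l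
    simp only [one_mul] at h3
    refine (h3.eventually_const_lt hlt).mono fun p hp => (EReal.coe_lt_coe_iff.2 hp).trans_le
      ((dVal_le_kappaLowDual h h2 hl hη).trans
        (kappaLowDual_le_KLowCrit h h2 A.pos.le _ _ _))
  · obtain ⟨l, hl, hlt⟩ := exists_lt_dVal_of_lt_deltaStar h hlt
    have h3 := A.continuous_conj.tendsto_dVal (γ0 := γ0) (P0 := P0) h h2 hθ0 0 0 1 l
    simp only [zero_mul] at h3
    refine (h3.eventually_const_lt (EReal.coe_lt_coe_iff.1 hlt)).mono fun p hp => ?_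
    have h4 := (EReal.coe_lt_coe_iff.2 hp).trans_le (dVal_le_deltaStar h h2 hl)
    rw [KLowCrit, if_neg h4.not_gt, if_neg h4.ne']
    exact EReal.coe_lt_top m

theorem exists_strictly_feasible (A : StandingAssumptions φ Q g k Θ γ0 P0 δ) {θ : Fin dθ → ℝ}
    (hθ : θ ∈ ThetaDelta φ Q g Θ γ0 P0 δ) {M : ℝ}
    (hM : kappaLow φ Q g k δ θ γ0 P0 < (M : EReal)) :
    ∃ f, Adm φ Q f ∧ ∫ u, f u * k u θ γ0 ∂Q < M ∧ ∫ u, φ (f u) ∂Q < δ ∧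
      Con Q isIneq (mom g θ γ0) (rhs d3 d4 P0) f := by
  have h := A.phiOne
  have h2 := A.phiTwo
  have hg := h2.oHeart_mom h θ γ0
  obtain ⟨f, hf, hfM⟩ : ∃ f, FeasDens φ Q g δ θ γ0 P0 f ∧ ∫ u, f u * k u θ γ0 ∂Q < M := by
    by_contra! hno
    exact absurd (le_kappaLow h h2 A.pos.le fun f hf => EReal.coe_le_coe_iff.2 (hno f hf))
      (not_le.2 hM)
  obtain ⟨s, hs, hsδ, hsc⟩ := A.exists_slater hθ
  have hlim : Tendsto (fun t : ℝ => (1 - t) * ∫ u, f u * k u θ γ0 ∂Q +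
      t * ∫ u, s u * k u θ γ0 ∂Q) (nhdsWithin 0 (Ioi 0)) (nhds (∫ u, f u * k u θ γ0 ∂Q)) := by
    have : Continuous fun t : ℝ => (1 - t) * ∫ u, f u * k u θ γ0 ∂Q +
      t * ∫ u, s u * k u θ γ0 ∂Q := by fun_prop
    simpa using (this.tendsto 0).mono_left nhdsWithin_le_nhds
  obtain ⟨t, htM, ht0, ht1⟩ := ((hlim.eventually_lt_const hfM).and
    (Ioo_mem_nhdsGT (zero_lt_one' ℝ))).exists
  have h1t : 0 ≤ 1 - t := by linarith
  have hsum : 1 - t + t = 1 := by ring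
  refine ⟨_, hf.1.convexComb h hs h1t ht0.le hsum, ?_, ?_, fun i => ?_⟩
  · rwa [hf.1.integral_convexComb_mul h hs (h2.oHeart_k h θ γ0)]
  · refine (hf.1.integral_convexComb_le h hs h1t ht0.le hsum).trans_lt ?_
    have := mul_le_mul_of_nonneg_left hf.2.1 h1t
    have := mul_lt_mul_of_pos_left hsδ ht0
    linarith
  · rw [hf.1.integral_convexComb_mul h hs (hg i)]
    refine ⟨?_, fun hi => by rw [(hf.2.2 i).2 hi, (hsc i).2 hi]; ring⟩
    have := mul_le_mul_of_nonneg_left (hf.2.2 i).1 h1t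
    have := mul_le_mul_of_nonneg_left (hsc i).1 ht0.le
    linarith

theorem eventually_iInf_KLowCrit_lt (A : StandingAssumptions φ Q g k Θ γ0 P0 δ) {a : EReal}
    (ha : ⨅ θ ∈ Θ, kappaLow φ Q g k δ θ γ0 P0 < a) :
    ∀ᶠ x : Γ × Vec12 d1 d2 in nhds (γ0, P0),
      ⨅ θ ∈ Θ, KLowCrit φ Q g k δ θ x.1 x.2 < a := by
  have h := A.phiOne
  have h2 := A.phiTwo
  rw [A.iInf_kappaLow_eq] at ha
  simp only [iInf_lt_iff] at ha
  obtain ⟨θ, hθ, hθa⟩ := ha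
  obtain ⟨M, hM, hMa⟩ := EReal.lt_iff_exists_real_btwn.1 hθa
  obtain ⟨f0, h0, h0M, h0δ, h0c⟩ := A.exists_strictly_feasible hθ hM
  have hp : Tendsto (fun x : Γ × Vec12 d1 d2 => (θ, x.1)) (nhds (γ0, P0))
      (nhdsWithin (θ, γ0) (Θ ×ˢ (univ : Set Γ))) :=
    tendsto_nhdsWithin_iff.2 ⟨Continuous.tendsto (by fun_prop) (γ0, P0),
      Eventually.of_forall fun n => ⟨hθ.1, mem_univ _⟩⟩
  have hev := (A.nondegenerate hθ).eventually_exists h (F := nhds (γ0, P0))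
    (kk := fun x u => k u θ x.1) (GG := fun x => mom g θ x.1) (bb := fun x => rhs d3 d4 x.2)
    (k := fun u => k u θ γ0) (fun x => h2.oHeart_k h θ x.1) (fun x => h2.oHeart_mom h θ x.1)
    (fun f hf => tendsto_sub_nhds_zero_iff.1 (A.continuous_k.tendsto_sub h (h2.oHeart_k h) hθ.1 hp
      (fun _ => hf) fun _ => le_rfl))
    (fun f hf i => tendsto_sub_nhds_zero_iff.1 (A.continuous_g.tendsto_sub h h2 hθ.1 hp
      (fun _ => hf) (fun _ => le_rfl) i))
    (fun i => by
      have : Continuous fun x : Γ × Vec12 d1 d2 => rhs d3 d4 x.2 i := by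
        rcases i with _ | i | i | i | i <;> simp only [rhs, stack] <;> fun_prop
      exact this.tendsto (γ0, P0)) h0 h0M h0δ h0c
  refine hev.mono fun x ⟨f, hf, hfM, hfδ, hfc⟩ => ?_
  have hfe : FeasDens φ Q g δ θ x.1 x.2 f := ⟨hf, hfδ.le, hfc⟩
  refine (iInf₂_le θ hθ.1).trans_lt (lt_trans ?_ hMa)
  rw [KLowCrit, if_pos ((hfe.deltaStar_le h h2).trans_lt (EReal.coe_lt_coe_iff.2 hfδ))]
  exact (hfe.kappaLowDual_le h h2).trans_lt (EReal.coe_lt_coe_iff.2 hfM)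

/-- Continuity of the lower criterion's minimum at the true first-stage parameters. -/
theorem tendsto_iInf_KLowCrit (A : StandingAssumptions φ Q g k Θ γ0 P0 δ) :
    Tendsto (fun x : Γ × Vec12 d1 d2 => ⨅ θ ∈ Θ, KLowCrit φ Q g k δ θ x.1 x.2) (nhds (γ0, P0))
      (nhds (⨅ θ ∈ Θ, kappaLow φ Q g k δ θ γ0 P0)) := by
  refine tendsto_order.2 ⟨fun a ha => ?_, fun a ha => A.eventually_iInf_KLowCrit_lt ha⟩
  obtain ⟨m, ham, hm⟩ := EReal.lt_iff_exists_real_btwn.1 ha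
  exact (A.eventually_lt_KLowCrit hm).mono fun x hx =>
    ham.trans_le (le_iInf₂ fun θ hθ => (hx θ hθ).le)

end StandingAssumptions

section Negation

theorem sSup_eq_neg_sInf {S T : Set EReal} (h : ∀ x, x ∈ S ↔ -x ∈ T) :
    sSup S = -sInf T := by
  refine le_antisymm (sSup_le fun x hx => EReal.le_neg_of_le_neg (sInf_le ((h x).1 hx)))
    (EReal.neg_le_of_neg_le (le_sInf fun y hy => EReal.neg_le_of_neg_le (le_sSup ((h _).2 ?_))))
  rwa [neg_neg]

variable {U : Type*} [MeasurableSpace U] {dθ d1 d2 d3 d4 : ℕ} {Γ : Type*}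
  (φ : ℝ → ℝ) (Q : Measure U)
  (g : U → (Fin dθ → ℝ) → Γ → Vec4 d1 d2 d3 d4) (k : U → (Fin dθ → ℝ) → Γ → ℝ)
  (δ : ℝ) (θ : Fin dθ → ℝ) (γ : Γ) (P : Vec12 d1 d2)

theorem kappaHigh_eq_neg_kappaLow :
    kappaHigh φ Q g k δ θ γ P = -kappaLow φ Q g (-k) δ θ γ P := by
  refine sSup_eq_neg_sInf fun x => exists_congr fun F => and_congr_right fun _ =>
    and_congr integrable_neg_iff.symm ?_
  simp only [Pi.neg_apply, integral_neg, EReal.coe_neg, neg_inj]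

theorem kappaHighDual_eq_neg_kappaLowDual :
    kappaHighDual φ Q g k δ θ γ P = -kappaLowDual φ Q g (-k) δ θ γ P := by
  rw [eq_comm, neg_eq_iff_eq_neg]
  refine sSup_eq_neg_sInf fun x => exists_congr fun η => and_congr_right fun _ =>
    exists_congr fun ζ => exists_congr fun l => and_congr_right fun _ => exists_congr fun w =>
    and_congr_right fun _ => ?_
  simp only [Pi.neg_apply, neg_neg]
  refine and_congr_right fun _ => ?_
  rw [neg_eq_iff_eq_neg, ← EReal.coe_neg]
  ring_nf

theorem KHighCrit_eq_neg_KLowCrit :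
    KHighCrit φ Q g k δ θ γ P = -KLowCrit φ Q g (-k) δ θ γ P := by
  unfold KHighCrit KLowCrit
  split_ifs
  · exact kappaHighDual_eq_neg_kappaLowDual φ Q g k δ θ γ P
  · exact kappaHigh_eq_neg_kappaLow φ Q g k δ θ γ P
  · exact EReal.neg_top.symm

theorem biSup_neg {α : Type*} (s : Set α) (f : α → EReal) :
    ⨆ a ∈ s, -f a = -⨅ a ∈ s, f a :=
  le_antisymm (iSup₂_le fun a ha => EReal.neg_le_neg_iff.2 (iInf₂_le a ha))
    (EReal.neg_le_of_neg_le (le_iInf₂ fun a ha => EReal.neg_le_of_neg_le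
      (le_iSup₂_of_le a ha le_rfl)))

end Negation

namespace StandingAssumptions

variable {U : Type*} [MeasurableSpace U] {dθ d1 d2 d3 d4 : ℕ} {Γ : Type*} [MetricSpace Γ]
  {φ : ℝ → ℝ} {Q : Measure U}
  {g : U → (Fin dθ → ℝ) → Γ → Vec4 d1 d2 d3 d4} {k : U → (Fin dθ → ℝ) → Γ → ℝ}
  {Θ : Set (Fin dθ → ℝ)} {γ0 : Γ} {P0 : Vec12 d1 d2} {δ : ℝ}

protected theorem neg (A : StandingAssumptions φ Q g k Θ γ0 P0 δ) :
    StandingAssumptions φ Q g (-k) Θ γ0 P0 δ where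
  pos := A.pos
  phiOne := A.phiOne
  phiTwo θ γ := ⟨⟨(A.phiTwo θ γ).1.1.neg, fun c hc => by
    simpa only [Pi.neg_apply, abs_neg] using (A.phiTwo θ γ).1.2 c hc⟩, (A.phiTwo θ γ).2⟩
  continuous_k θ hθ γ := by
    have := A.continuous_k θ hθ γ
    simp only [psiNorm] at this ⊢
    simpa only [Pi.neg_apply, neg_sub_neg, abs_sub_comm] using this
  continuous_g := A.continuous_g
  conditionS := A.conditionS
  subset_closure := A.subset_closure
  isCompact := A.isCompact
  continuous_conj c1 c2 c3 := by
    simpa only [Pi.neg_apply, mul_neg, neg_mul] using A.continuous_conj c1 (-c2) c3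

/-- Continuity of the upper criterion's maximum at the true first-stage parameters. -/
theorem tendsto_iSup_KHighCrit [IsProbabilityMeasure Q]
    (A : StandingAssumptions φ Q g k Θ γ0 P0 δ) :
    Tendsto (fun x : Γ × Vec12 d1 d2 => ⨆ θ ∈ Θ, KHighCrit φ Q g k δ θ x.1 x.2) (nhds (γ0, P0))
      (nhds (⨆ θ ∈ Θ, kappaHigh φ Q g k δ θ γ0 P0)) := by
  simp only [KHighCrit_eq_neg_KLowCrit, kappaHigh_eq_neg_kappaLow, biSup_neg]
  exact (continuous_neg.tendsto _).comp A.neg.tendsto_iInf_KLowCrit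

end StandingAssumptions

end CFSens

/-- **Theorem 1: consistency of the plug-in estimators.**
Under Assumptions Φ(i), Φ(ii) and M(i)–(v), if the first-stage estimators
`(γ̂_n, P̂_n)` converge in probability to `(γ0, P0)`, then the plug-in estimators
`κ̲̂_n(N_δ) = inf_{θ∈Θ} K̲_δ(θ;γ̂_n,P̂_n)` and `κ̄̂_n(N_δ) = sup_{θ∈Θ} K̄_δ(θ;γ̂_n,P̂_n)`
converge in probability to `(κ̲(N_δ), κ̄(N_δ))` (convergence in probability to a constant
is stated through neighborhoods of the limit). -/
theorem consistency_plugin_estimators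
    {U : Type*} [MeasurableSpace U] {dθ d1 d2 d3 d4 : ℕ} {Γ : Type*} [MetricSpace Γ]
    (φ : ℝ → ℝ) (Fstar : Measure U) [IsProbabilityMeasure Fstar]
    (g : U → (Fin dθ → ℝ) → Γ → Vec4 d1 d2 d3 d4)
    (k : U → (Fin dθ → ℝ) → Γ → ℝ)
    (Θ : Set (Fin dθ → ℝ)) (γ0 : Γ) (P0 : Vec12 d1 d2)
    (δ : ℝ) (hδ : 0 < δ)
    (hΦ1 : PhiOne φ)
    (hΦ2 : PhiTwo φ Fstar g k)
    -- Assumption M(i)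
    (hM1k : EContinuousIn φ Fstar Θ k)
    (hM1g : MOneG φ Fstar g Θ)
    -- Assumption M(ii)
    (hM2ne : (ThetaDelta φ Fstar g Θ γ0 P0 δ).Nonempty)
    (hM2S : ∀ θ ∈ ThetaDelta φ Fstar g Θ γ0 P0 δ, ConditionS φ Fstar g θ γ0 P0)
    -- Assumption M(iii)
    (hM3 : {θ ∈ Θ | deltaStar φ Fstar g θ γ0 P0 ≤ ((δ : ℝ) : EReal)} ⊆
      closure (ThetaDelta φ Fstar g Θ γ0 P0 δ))
    -- Assumption M(iv)
    (hM4 : IsCompact Θ)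
    -- Assumption M(v)
    (hM5 : MFive φ Fstar g k Θ)
    -- first-stage estimators on a probability space Ω
    {Ω : Type*} [MeasurableSpace Ω] (μ : Measure Ω) [IsProbabilityMeasure μ]
    (γhat : ℕ → Ω → Γ) (Phat : ℕ → Ω → Vec12 d1 d2)
    (hcons : ∀ V ∈ nhds ((γ0, P0) : Γ × Vec12 d1 d2),
      Tendsto (fun n => μ {ω | (γhat n ω, Phat n ω) ∉ V}) atTop (nhds (0 : ℝ≥0∞))) :
    ∀ W ∈ nhds ((((⨅ θ ∈ Θ, kappaLow φ Fstar g k δ θ γ0 P0),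
                  (⨆ θ ∈ Θ, kappaHigh φ Fstar g k δ θ γ0 P0))) : EReal × EReal),
      Tendsto (fun n => μ {ω |
          (((⨅ θ ∈ Θ, KLowCrit φ Fstar g k δ θ (γhat n ω) (Phat n ω)),
            (⨆ θ ∈ Θ, KHighCrit φ Fstar g k δ θ (γhat n ω) (Phat n ω))) : EReal × EReal) ∉ W})
        atTop (nhds (0 : ℝ≥0∞)) := by
  have A : StandingAssumptions φ Fstar g k Θ γ0 P0 δ :=
    ⟨hδ, hΦ1, hΦ2, hM1k, hM1g, hM2S, hM3, hM4, hM5⟩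
  intro W hW
  have hV := (A.tendsto_iInf_KLowCrit.prodMk_nhds A.tendsto_iSup_KHighCrit) hW
  exact tendsto_of_tendsto_of_tendsto_of_le_of_le tendsto_const_nhds (hcons _ hV)
    (fun _ => bot_le) fun _ => le_rfl
end
end

section
/- Sharpness of the bounds as neighborhoods expand, explicit-dependence case (Theorem 3): under Assumptions Φ(i) and Φ(ii), if Condition S holds at (θ,γ0,P0) for every θ ∈ Θ, μ and F* are mutually absolutely continuous, and k is μ-essentially bounded (i.e. μ-esssup |k(·,θ,γ0)| < ∞ for each θ ∈ Θ), then κ̲(N_δ) → inf K_# and κ̄(N_δ) → sup K_# as δ → ∞. -/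
open MeasureTheory Filter Set
open scoped ENNReal Pointwise Classical

noncomputable section

namespace CFSens

variable {U : Type*} [MeasurableSpace U] {dθ d1 d2 d3 d4 : ℕ} {Γ : Type*}

/-- The identified set of counterfactuals `K_#` (explicit-dependence case):
values `E^F[k(U,θ,γ0)]` over `θ ∈ Θ` and `F ∈ F_θ` (probability measures absolutely
continuous w.r.t. `μ` with finite moments) satisfying the model constraints. -/
def KSharp (μmeas : Measure U) (g : U → (Fin dθ → ℝ) → Γ → Vec4 d1 d2 d3 d4)
    (k : U → (Fin dθ → ℝ) → Γ → ℝ) (Θ : Set (Fin dθ → ℝ)) (γ0 : Γ)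
    (P0 : Vec12 d1 d2) : Set ℝ :=
  {x | ∃ θ ∈ Θ, ∃ F : Measure U, IsProbabilityMeasure F ∧ F ≪ μmeas ∧
    ConstraintsHold g θ γ0 P0 F ∧ Integrable (fun u => k u θ γ0) F ∧
    x = ∫ u, k u θ γ0 ∂F}

end CFSens

namespace CFSens

variable {U : Type*} [MeasurableSpace U] {dθ d1 d2 d3 d4 : ℕ} {Γ : Type*}

section Moments

variable {g : U → (Fin dθ → ℝ) → Γ → Vec4 d1 d2 d3 d4} {θ : Fin dθ → ℝ} {γ : Γ}

theorem gIntegrable_iff {F : Measure U} :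
    GIntegrable g θ γ F ↔ Integrable (fun u => g u θ γ) F := by
  simp only [GIntegrable, integrable_prod]
  refine and_congr ?_ (and_congr ?_ (and_congr ?_ ?_)) <;>
    exact ⟨fun h => Integrable.of_eval h, fun h i => h.eval i⟩

theorem integral_moments {F : Measure U} (h : Integrable (fun u => g u θ γ) F) :
    ∫ u, g u θ γ ∂F =
      ((fun i => ∫ u, (g u θ γ).1 i ∂F), (fun i => ∫ u, (g u θ γ).2.1 i ∂F),
        (fun i => ∫ u, (g u θ γ).2.2.1 i ∂F), (fun i => ∫ u, (g u θ γ).2.2.2 i ∂F)) := by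
  obtain ⟨h1, h2, h3, h4⟩ := gIntegrable_iff.2 h
  have e2 := (integrable_prod.1 h).2
  have e3 := (integrable_prod.1 e2).2
  refine Prod.ext ?_ (Prod.ext ?_ (Prod.ext ?_ ?_))
  · rw [fst_integral h]
    exact funext fun i => eval_integral h1 i
  · rw [snd_integral h, fst_integral e2]
    exact funext fun i => eval_integral h2 i
  · rw [snd_integral h, snd_integral e2, fst_integral e3]
    exact funext fun i => eval_integral h3 i
  · rw [snd_integral h, snd_integral e2, snd_integral e3]
    exact funext fun i => eval_integral h4 i

theorem constraintsHold_iff {P : Vec12 d1 d2} {F : Measure U} :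
    ConstraintsHold g θ γ P F ↔ Integrable (fun u => g u θ γ) F ∧
      ((P.1, P.2, 0, 0) : Vec4 d1 d2 d3 d4) - ∫ u, g u θ γ ∂F ∈ coneC := by
  rw [ConstraintsHold, gIntegrable_iff]
  refine and_congr_right fun h => ?_
  rw [integral_moments h]
  simp [coneC, funext_iff, sub_eq_zero, @eq_comm _ (P.2 _)]

theorem add_mem_coneC {a b : Vec4 d1 d2 d3 d4} (ha : a ∈ coneC) (hb : b ∈ coneC) :
    a + b ∈ coneC := by
  obtain ⟨a1, a2, a3, a4⟩ := ha
  obtain ⟨b1, b2, b3, b4⟩ := hb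
  exact ⟨fun i => add_nonneg (a1 i) (b1 i), by simp [a2, b2],
    fun i => add_nonneg (a3 i) (b3 i), by simp [a4, b4]⟩

theorem smul_mem_coneC {t : ℝ} (ht : 0 ≤ t) {a : Vec4 d1 d2 d3 d4} (ha : a ∈ coneC) :
    t • a ∈ coneC := by
  obtain ⟨a1, a2, a3, a4⟩ := ha
  exact ⟨fun i => mul_nonneg ht (a1 i), by simp [a2],
    fun i => mul_nonneg ht (a3 i), by simp [a4]⟩

end Moments

theorem absolutelyContinuous_of_Dphi_lt_top {φ : ℝ → ℝ} {Fstar F : Measure U}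
    (h : Dphi φ Fstar F < ⊤) : F ≪ Fstar := by
  by_contra hF
  simp [Dphi, hF] at h

/-- The mixture `(1 - t) F + t G`. -/
def mix (t : ℝ) (F G : Measure U) : Measure U :=
  ENNReal.ofReal (1 - t) • F + ENNReal.ofReal t • G

theorem isProbabilityMeasure_mix {t : ℝ} (h0 : 0 ≤ t) (h1 : t ≤ 1) (F G : Measure U)
    [IsProbabilityMeasure F] [IsProbabilityMeasure G] : IsProbabilityMeasure (mix t F G) := by
  constructor
  simp only [mix, Measure.add_apply, Measure.smul_apply, measure_univ, smul_eq_mul, mul_one]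
  rw [← ENNReal.ofReal_add (by linarith) h0]
  simp

section Integral

variable {E : Type*} [NormedAddCommGroup E]

theorem integrable_mix {t : ℝ} {F G : Measure U} {h : U → E}
    (hF : Integrable h F) (hG : Integrable h G) : Integrable h (mix t F G) :=
  (hF.smul_measure ENNReal.ofReal_ne_top).add_measure (hG.smul_measure ENNReal.ofReal_ne_top)

theorem integral_mix [NormedSpace ℝ E] {t : ℝ} (h0 : 0 ≤ t) (h1 : t ≤ 1) {F G : Measure U}
    {h : U → E} (hF : Integrable h F) (hG : Integrable h G) :
    ∫ u, h u ∂(mix t F G) = (1 - t) • ∫ u, h u ∂F + t • ∫ u, h u ∂G := by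
  rw [mix, integral_add_measure (hF.smul_measure ENNReal.ofReal_ne_top)
    (hG.smul_measure ENNReal.ofReal_ne_top), integral_smul_measure, integral_smul_measure,
    ENNReal.toReal_ofReal h0, ENNReal.toReal_ofReal (by linarith)]

end Integral

theorem Dphi_mix_lt_top {φ : ℝ → ℝ} (hφ : ConvexOn ℝ (Set.Ici 0) φ) {Fstar F G : Measure U}
    [IsFiniteMeasure Fstar] [IsFiniteMeasure F] [IsFiniteMeasure G] (hF : F ≪ Fstar)
    {C : ℝ} (hC : ∀ᵐ u ∂Fstar, (F.rnDeriv Fstar u).toReal ≤ C) (hG : Dphi φ Fstar G < ⊤)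
    {t : ℝ} (h0 : 0 ≤ t) (h1 : t ≤ 1) : Dphi φ Fstar (mix t F G) < ⊤ := by
  have hGac := absolutelyContinuous_of_Dphi_lt_top hG
  have hac : mix t F G ≪ Fstar := (hF.smul_left _).add_left (hGac.smul_left _)
  rw [Dphi, if_pos hGac] at hG
  rw [Dphi, if_pos hac]
  set M := max (φ 0) (φ C)
  have hle : ∀ᵐ u ∂Fstar, ENNReal.ofReal (φ ((mix t F G).rnDeriv Fstar u).toReal) ≤
      ENNReal.ofReal ((1 - t) * M) +
        ENNReal.ofReal t * ENNReal.ofReal (φ (G.rnDeriv Fstar u).toReal) := by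
    have hF' : IsFiniteMeasure (ENNReal.ofReal (1 - t) • F) := F.smul_finite ENNReal.ofReal_ne_top
    have hG' : IsFiniteMeasure (ENNReal.ofReal t • G) := G.smul_finite ENNReal.ofReal_ne_top
    filter_upwards [hC,
      Measure.rnDeriv_add (ENNReal.ofReal (1 - t) • F) (ENNReal.ofReal t • G) Fstar,
      Measure.rnDeriv_smul_left_of_ne_top F Fstar (r := ENNReal.ofReal (1 - t))
        ENNReal.ofReal_ne_top,
      Measure.rnDeriv_smul_left_of_ne_top G Fstar (r := ENNReal.ofReal t) ENNReal.ofReal_ne_top,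
      Measure.rnDeriv_lt_top F Fstar, Measure.rnDeriv_lt_top G Fstar]
      with u hCu hadd hsF hsG hFt hGt
    have hden : ((mix t F G).rnDeriv Fstar u).toReal =
        (1 - t) * (F.rnDeriv Fstar u).toReal + t * (G.rnDeriv Fstar u).toReal := by
      rw [mix, hadd, Pi.add_apply, hsF, hsG, Pi.smul_apply, Pi.smul_apply, smul_eq_mul, smul_eq_mul,
        ENNReal.toReal_add (ENNReal.mul_ne_top ENNReal.ofReal_ne_top hFt.ne)
          (ENNReal.mul_ne_top ENNReal.ofReal_ne_top hGt.ne), ENNReal.toReal_mul, ENNReal.toReal_mul,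
        ENNReal.toReal_ofReal h0, ENNReal.toReal_ofReal (by linarith)]
    have hconv := hφ.2 (x := (F.rnDeriv Fstar u).toReal) ENNReal.toReal_nonneg
      (y := (G.rnDeriv Fstar u).toReal) ENNReal.toReal_nonneg (sub_nonneg.2 h1) h0 (by ring)
    have hM : φ (F.rnDeriv Fstar u).toReal ≤ M :=
      hφ.le_max_of_mem_Icc Set.self_mem_Ici
        (Set.mem_Ici.2 (ENNReal.toReal_nonneg.trans hCu)) ⟨ENNReal.toReal_nonneg, hCu⟩
    rw [hden, ← ENNReal.ofReal_mul h0]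
    refine le_trans (ENNReal.ofReal_le_ofReal ?_) ENNReal.ofReal_add_le
    simp only [smul_eq_mul] at hconv
    have := mul_le_mul_of_nonneg_left hM (sub_nonneg.2 h1)
    linarith
  refine (lintegral_mono_ae hle).trans_lt ?_
  rw [lintegral_add_left measurable_const, lintegral_const,
    lintegral_const_mul' _ _ ENNReal.ofReal_ne_top]
  exact ENNReal.add_lt_top.2 ⟨ENNReal.mul_lt_top ENNReal.ofReal_lt_top (measure_lt_top _ _),
    ENNReal.mul_lt_top ENNReal.ofReal_lt_top hG⟩

section Truncation

open ProbabilityTheory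

/-- The event that the density of `F` with respect to `Fstar` is at most `n`. -/
def densityLe (Fstar F : Measure U) (n : ℕ) : Set U := {u | F.rnDeriv Fstar u ≤ n}

variable {Fstar F : Measure U}

theorem measurableSet_densityLe (n : ℕ) : MeasurableSet (densityLe Fstar F n) :=
  measurableSet_le (Measure.measurable_rnDeriv _ _) measurable_const

theorem monotone_densityLe : Monotone (densityLe Fstar F) := fun _ _ hab _ hu =>
  le_trans (Set.mem_ofPred.1 hu) (by exact_mod_cast hab)

theorem iUnion_densityLe_ae_eq_univ [SigmaFinite F] (hF : F ≪ Fstar) :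
    (⋃ n, densityLe Fstar F n) =ᵐ[F] (Set.univ : Set U) := by
  rw [eventuallyEq_univ]
  filter_upwards [hF (Measure.rnDeriv_lt_top F Fstar)] with u hu
  obtain ⟨n, hn⟩ := ENNReal.exists_nat_gt hu.ne
  exact Set.mem_iUnion.2 ⟨n, hn.le⟩

theorem tendsto_measure_densityLe [IsProbabilityMeasure F] (hF : F ≪ Fstar) :
    Tendsto (fun n => F (densityLe Fstar F n)) atTop (nhds 1) := by
  have h := tendsto_measure_iUnion_atTop (μ := F) (monotone_densityLe (Fstar := Fstar) (F := F))
  rwa [measure_congr (iUnion_densityLe_ae_eq_univ hF), measure_univ] at h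

theorem tendsto_integral_cond_densityLe {E : Type*} [NormedAddCommGroup E] [NormedSpace ℝ E]
    [IsProbabilityMeasure F] (hF : F ≪ Fstar) {h : U → E} (hh : Integrable h F) :
    Tendsto (fun n => ∫ u, h u ∂(cond F (densityLe Fstar F n))) atTop (nhds (∫ u, h u ∂F)) := by
  have hset := tendsto_setIntegral_of_monotone (measurableSet_densityLe (Fstar := Fstar) (F := F))
    monotone_densityLe hh.integrableOn
  rw [setIntegral_congr_set (iUnion_densityLe_ae_eq_univ hF), setIntegral_univ] at hset
  have hinv : Tendsto (fun n => ((F (densityLe Fstar F n))⁻¹).toReal) atTop (nhds 1) := by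
    have := (ENNReal.tendsto_toReal (by simp)).comp
      (tendsto_inv_iff.2 (tendsto_measure_densityLe hF))
    simpa [Function.comp_def] using this
  simpa [ProbabilityTheory.cond, integral_smul_measure] using hinv.smul hset

theorem rnDeriv_cond_densityLe_le [IsFiniteMeasure Fstar] [IsFiniteMeasure F] {n : ℕ}
    (h0 : F (densityLe Fstar F n) ≠ 0) : ∀ᵐ u ∂Fstar,
      ((cond F (densityLe Fstar F n)).rnDeriv Fstar u).toReal ≤
        ((F (densityLe Fstar F n))⁻¹).toReal * n := by
  filter_upwards [Measure.rnDeriv_smul_left_of_ne_top (F.restrict (densityLe Fstar F n)) Fstar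
      (ENNReal.inv_ne_top.2 h0),
    Measure.rnDeriv_restrict F Fstar (measurableSet_densityLe (Fstar := Fstar) (F := F) n)]
    with u hs hr
  rw [ProbabilityTheory.cond, hs, Pi.smul_apply, hr, smul_eq_mul, ENNReal.toReal_mul]
  refine mul_le_mul_of_nonneg_left ?_ ENNReal.toReal_nonneg
  by_cases hu : u ∈ densityLe Fstar F n
  · rw [Set.indicator_of_mem hu]
    exact ENNReal.toReal_le_of_le_ofReal n.cast_nonneg (by simpa [densityLe] using hu)
  · simp [Set.indicator_of_notMem hu]

end Truncation

section Approximation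

open ProbabilityTheory

variable {φ : ℝ → ℝ} {Fstar : Measure U} [IsProbabilityMeasure Fstar]
  {g : U → (Fin dθ → ℝ) → Γ → Vec4 d1 d2 d3 d4} {θ : Fin dθ → ℝ} {γ : Γ} {P : Vec12 d1 d2}

/-- Under Condition S, the expectation of an essentially bounded function under a distribution
satisfying the constraints is approximated by feasible distributions of finite divergence. -/
theorem exists_feasible_integral_near (hφ : ConvexOn ℝ (Set.Ici 0) φ)
    (hS : ConditionS φ Fstar g θ γ P) {F : Measure U} [IsProbabilityMeasure F] (hF : F ≪ Fstar)
    (hc : ConstraintsHold g θ γ P F) {f : U → ℝ} (hf : Measurable f) {K : ℝ}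
    (hK : ∀ᵐ u ∂Fstar, |f u| ≤ K) {ε : ℝ} (hε : 0 < ε) :
    ∃ δ : ℝ, ∃ F' : Measure U, Feasible φ Fstar g δ θ γ P F' ∧ Integrable f F' ∧
      |∫ u, f u ∂F' - ∫ u, f u ∂F| < ε := by
  have hf_int : ∀ {H : Measure U} [IsProbabilityMeasure H], H ≪ Fstar → Integrable f H :=
    fun {H} _ hH => Integrable.of_bound hf.aestronglyMeasurable K
      (hH.ae_le hK)
  have hbd : ∀ {H : Measure U} [IsProbabilityMeasure H], H ≪ Fstar → |∫ u, f u ∂H| ≤ K := by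
    intro H _ hH
    have := norm_integral_le_of_norm_le_const (μ := H) (f := f) (C := K)
      (hH.ae_le hK)
    simpa using this
  have hK0 : 0 ≤ K := (abs_nonneg _).trans (hbd hF)
  obtain ⟨hgF, hcone⟩ := constraintsHold_iff.1 hc
  set p : Vec4 d1 d2 d3 d4 := (P.1, P.2, 0, 0)
  obtain ⟨t, ht0, ht1, htε⟩ : ∃ t : ℝ, 0 < t ∧ t ≤ 1 ∧ t * (2 * K) < ε / 2 := by
    refine ⟨min 1 (ε / (4 * (2 * K + 1))), lt_min one_pos (by positivity), min_le_left _ _, ?_⟩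
    calc _ ≤ ε / (4 * (2 * K + 1)) * (2 * K) := by gcongr; exact min_le_right _ _
      _ < ε / 2 := by
        rw [div_mul_eq_mul_div, div_lt_div_iff₀ (by positivity) (by positivity)]
        nlinarith
  have hg_tend := tendsto_integral_cond_densityLe hF hgF
  have hp_tend : Tendsto (fun n => p - ((1 - t) / t) •
      (∫ u, g u θ γ ∂(cond F (densityLe Fstar F n)) - ∫ u, g u θ γ ∂F)) atTop (nhds p) := by
    simpa using (tendsto_const_nhds (x := p)).sub
      ((hg_tend.sub_const (∫ u, g u θ γ ∂F)).const_smul ((1 - t) / t))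
  have hev1 := hp_tend.eventually (mem_interior_iff_mem_nhds.1 hS)
  have hev2 := (tendsto_integral_cond_densityLe hF (hf_int hF)).eventually
    (Metric.ball_mem_nhds _ (half_pos hε))
  have hev3 := (tendsto_measure_densityLe hF).eventually_ne one_ne_zero
  obtain ⟨n, hn1, hn2, hn3⟩ := (hev1.and (hev2.and hev3)).exists
  set Fn := cond F (densityLe Fstar F n)
  have hFn : IsProbabilityMeasure Fn := cond_isProbabilityMeasure hn3
  have hFnac : Fn ≪ Fstar := cond_absolutelyContinuous.trans hF
  have hgFn : Integrable (fun u => g u θ γ) Fn :=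
    hgF.restrict.smul_measure (ENNReal.inv_ne_top.2 hn3)
  obtain ⟨_, ⟨G, hG, hGD, hGi, rfl⟩, c', hc', hsum⟩ := hn1
  have hgG := gIntegrable_iff.1 hGi
  rw [← integral_moments hgG] at hsum
  have hGac := absolutelyContinuous_of_Dphi_lt_top hGD
  have hD := Dphi_mix_lt_top hφ hFnac (rnDeriv_cond_densityLe_le hn3) hGD ht0.le ht1
  have hmix := isProbabilityMeasure_mix ht0.le ht1 Fn G
  refine ⟨(Dphi φ Fstar (mix t Fn G)).toReal, mix t Fn G,
    ⟨hmix, (ENNReal.ofReal_toReal hD.ne).ge, constraintsHold_iff.2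
      ⟨integrable_mix hgFn hgG, ?_⟩⟩, integrable_mix (hf_int hFnac) (hf_int hGac), ?_⟩
  · rw [integral_mix ht0.le ht1 hgFn hgG]
    convert add_mem_coneC (smul_mem_coneC (sub_nonneg.2 ht1) hcone) (smul_mem_coneC ht0.le hc')
      using 1
    have hc'' : t • c' = t • (p - ((1 - t) / t) • (∫ u, g u θ γ ∂Fn - ∫ u, g u θ γ ∂F)
        - ∫ u, g u θ γ ∂G) := by
      rw [← hsum]; simp
    rw [hc'', smul_sub t, smul_sub t p, smul_smul, mul_div_cancel₀ _ ht0.ne']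
    module
  · rw [integral_mix ht0.le ht1 (hf_int hFnac) (hf_int hGac)]
    have b1 := abs_le.1 (hbd hFnac)
    have b2 := abs_le.1 (hbd hGac)
    have b3 := abs_lt.1 (show |∫ u, f u ∂Fn - ∫ u, f u ∂F| < ε / 2 from hn2)
    simp only [smul_eq_mul]
    rw [abs_lt]
    constructor <;> nlinarith [b1.1, b1.2, b2.1, b2.2, b3.1, b3.2]

end Approximation

theorem Feasible.mono {φ : ℝ → ℝ} {Fstar : Measure U}
    {g : U → (Fin dθ → ℝ) → Γ → Vec4 d1 d2 d3 d4} {θ : Fin dθ → ℝ} {γ : Γ} {P : Vec12 d1 d2}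
    {F : Measure U} {δ δ' : ℝ} (hδ : δ ≤ δ') (h : Feasible φ Fstar g δ θ γ P F) :
    Feasible φ Fstar g δ' θ γ P F :=
  ⟨h.1, h.2.1.trans (ENNReal.ofReal_le_ofReal hδ), h.2.2⟩

end CFSens

open CFSens

/-- **Theorem 3: sharpness of the bounds, explicit-dependence case.**
Under Assumptions Φ(i) and Φ(ii), if Condition S holds at `(θ,γ0,P0)` for every `θ ∈ Θ`,
`μ` and `F*` are mutually absolutely continuous, and `k(·,θ,γ0)` is `μ`-essentially
bounded for each `θ ∈ Θ`, then `κ̲(N_δ) → inf K_#` and `κ̄(N_δ) → sup K_#` as `δ → ∞`. -/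
theorem sharp_bounds_explicit
    {U : Type*} [MeasurableSpace U] {dθ d1 d2 d3 d4 : ℕ} {Γ : Type*}
    (φ : ℝ → ℝ) (Fstar : Measure U) [IsProbabilityMeasure Fstar]
    (μmeas : Measure U) [SigmaFinite μmeas]
    (g : U → (Fin dθ → ℝ) → Γ → Vec4 d1 d2 d3 d4)
    (k : U → (Fin dθ → ℝ) → Γ → ℝ)
    (Θ : Set (Fin dθ → ℝ)) (γ0 : Γ) (P0 : Vec12 d1 d2)
    (hΦ1 : PhiOne φ)
    (hΦ2 : PhiTwo φ Fstar g k)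
    (hS : ∀ θ ∈ Θ, ConditionS φ Fstar g θ γ0 P0)
    (hac1 : μmeas ≪ Fstar) (hac2 : Fstar ≪ μmeas)
    (hbdd : ∀ θ ∈ Θ, essSup (fun u => ENNReal.ofReal |k u θ γ0|) μmeas < ⊤) :
    Tendsto (fun δ : ℝ => ⨅ θ ∈ Θ, kappaLow φ Fstar g k δ θ γ0 P0) atTop
      (nhds (sInf ((fun x : ℝ => (x : EReal)) '' KSharp μmeas g k Θ γ0 P0))) ∧
    Tendsto (fun δ : ℝ => ⨆ θ ∈ Θ, kappaHigh φ Fstar g k δ θ γ0 P0) atTop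
      (nhds (sSup ((fun x : ℝ => (x : EReal)) '' KSharp μmeas g k Θ γ0 P0))) := by
  have happrox : ∀ θ ∈ Θ, ∀ F : Measure U, IsProbabilityMeasure F → F ≪ μmeas →
      ConstraintsHold g θ γ0 P0 F → ∀ ε : ℝ, 0 < ε →
      ∃ δ : ℝ, ∃ F' : Measure U, Feasible φ Fstar g δ θ γ0 P0 F' ∧
        Integrable (fun u => k u θ γ0) F' ∧
        |∫ u, k u θ γ0 ∂F' - ∫ u, k u θ γ0 ∂F| < ε := by
    intro θ hθ F _ hF hc ε hε
    refine exists_feasible_integral_near hΦ1.sconvex.convexOn (hS θ hθ) (hF.trans hac1) hc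
      (hΦ2 θ γ0).1.1
      (K := (essSup (fun u => ENNReal.ofReal |k u θ γ0|) μmeas).toReal) ?_ hε
    filter_upwards [hac2 (ENNReal.ae_le_essSup fun u => ENNReal.ofReal |k u θ γ0|)] with u hu
    exact (ENNReal.ofReal_le_iff_le_toReal (hbdd θ hθ).ne).1 hu
  have hsharp : ∀ {δ : ℝ} {θ : Fin dθ → ℝ} {F : Measure U}, θ ∈ Θ →
      Feasible φ Fstar g δ θ γ0 P0 F → Integrable (fun u => k u θ γ0) F →
      ((∫ u, k u θ γ0 ∂F : ℝ) : EReal) ∈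
        (fun x : ℝ => (x : EReal)) '' KSharp μmeas g k Θ γ0 P0 :=
    fun hθ hF hk => Set.mem_image_of_mem _ ⟨_, hθ, _, hF.1,
      (absolutelyContinuous_of_Dphi_lt_top (hF.2.1.trans_lt ENNReal.ofReal_lt_top)).trans hac2,
      hF.2.2, hk, rfl⟩
  constructor
  · have hanti : Antitone fun δ : ℝ => ⨅ θ ∈ Θ, kappaLow φ Fstar g k δ θ γ0 P0 :=
      fun δ δ' h => iInf₂_mono fun θ _ => sInf_le_sInf
        fun _ ⟨F, hF, hk⟩ => ⟨F, hF.mono h, hk⟩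
    convert tendsto_atTop_iInf hanti using 2
    refine le_antisymm ?_ ?_
    · refine le_iInf fun δ => le_iInf₂ fun θ hθ => le_sInf ?_
      rintro _ ⟨F, hF, hk, rfl⟩
      exact sInf_le (hsharp hθ hF hk)
    · refine le_sInf ?_
      rintro _ ⟨x, ⟨θ, hθ, F, hFp, hF, hc, -, rfl⟩, rfl⟩
      refine le_of_forall_gt_imp_ge_of_dense fun a ha => ?_
      obtain ⟨y, hy, hya⟩ := EReal.lt_iff_exists_real_btwn.1 ha
      obtain ⟨δ, F', hF', hk', hlt⟩ :=
        happrox θ hθ F hFp hF hc _ (sub_pos.2 (EReal.coe_lt_coe_iff.1 hy))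
      refine (iInf_le _ δ).trans <| (iInf₂_le θ hθ).trans <|
        (sInf_le ⟨F', hF', hk', rfl⟩ : kappaLow φ Fstar g k δ θ γ0 P0 ≤ _).trans (le_trans ?_ hya.le)
      exact EReal.coe_le_coe_iff.2 (by linarith [(abs_lt.1 hlt).2])
  · have hmono : Monotone fun δ : ℝ => ⨆ θ ∈ Θ, kappaHigh φ Fstar g k δ θ γ0 P0 :=
      fun δ δ' h => iSup₂_mono fun θ _ => sSup_le_sSup
        fun _ ⟨F, hF, hk⟩ => ⟨F, hF.mono h, hk⟩
    convert tendsto_atTop_iSup hmono using 2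
    refine le_antisymm ?_ ?_
    · refine sSup_le ?_
      rintro _ ⟨x, ⟨θ, hθ, F, hFp, hF, hc, -, rfl⟩, rfl⟩
      refine le_of_forall_lt_imp_le_of_dense fun a ha => ?_
      obtain ⟨y, hya, hy⟩ := EReal.lt_iff_exists_real_btwn.1 ha
      obtain ⟨δ, F', hF', hk', hlt⟩ :=
        happrox θ hθ F hFp hF hc _ (sub_pos.2 (EReal.coe_lt_coe_iff.1 hy))
      refine (le_trans hya.le ?_ : a ≤ ((∫ u, k u θ γ0 ∂F' : ℝ) : EReal)).trans <|
        (le_sSup ⟨F', hF', hk', rfl⟩ : _ ≤ kappaHigh φ Fstar g k δ θ γ0 P0).trans <|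
        (le_iSup₂ (f := fun θ (_ : θ ∈ Θ) => kappaHigh φ Fstar g k δ θ γ0 P0) θ hθ).trans <|
        le_iSup (fun δ : ℝ => ⨆ θ ∈ Θ, kappaHigh φ Fstar g k δ θ γ0 P0) δ
      exact EReal.coe_le_coe_iff.2 (by linarith [(abs_lt.1 hlt).1])
    · refine iSup_le fun δ => iSup₂_le fun θ hθ => sSup_le ?_
      rintro _ ⟨F, hF, hk, rfl⟩
      exact le_sSup (hsharp hθ hF hk)
end
end
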